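/- Let φ be a Gibbs measure for FK-percolation on the square lattice with parameters p ∈ (0,1) and q ≥ 1 which is invariant under translations and tail trivial. Then φ[0 ↔ ∞] = 0 or φ[(1,0) ↔* ∞] = 0 (there is no infinite primal cluster, or no infinite dual cluster, φ-a.s.). As a consequence, φ = φ^0_{p,q} or φ = φ^1_{p,q}. -/

import Mathlib

open MeasureTheory ProbabilityTheory Filter
open scoped ENNReal

noncomputable section

namespace FK

/-- Ambient vertex set: points of the plane with integer coordinates. -/
abbrev V : Type := ℤ × ℤ

variable (Adj : V → V → Prop)

/-- The edge set of the graph with adjacency relation `Adj`, as unordered pairs. -/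
def EdgeSet : Set (Sym2 V) := {e | ∃ u v : V, Adj u v ∧ e = s(u, v)}

/-- Edges of the graph. -/
abbrev Edge := {e : Sym2 V // e ∈ EdgeSet Adj}

/-- A percolation configuration: each edge is open (`true`) or closed (`false`). -/
abbrev Config := Edge Adj → Bool

/-- A vertex is an endpoint of an edge. -/
def Inc (v : V) (e : Edge Adj) : Prop := v ∈ (e : Sym2 V)

/-- The vertex set of a finite set of edges. -/
def vertexSet (D : Finset (Edge Adj)) : Set V := {v | ∃ e ∈ D, Inc Adj v e}

open Classical in
/-- The degree of a vertex in a finite set of edges. -/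
def degree (D : Finset (Edge Adj)) (v : V) : ℕ :=
  (D.filter fun e => Inc Adj v e).card

/-- Boundary of a finite domain: its vertices of degree less than `maxDeg`
(the degree of the full lattice). -/
def bdry (maxDeg : ℕ) (D : Finset (Edge Adj)) : Set V :=
  {v | v ∈ vertexSet Adj D ∧ degree Adj D v < maxDeg}

/-- `u` and `v` are connected by a path of `ω`-open edges, all belonging to `S`. -/
def ConnectedIn (ω : Config Adj) (S : Set (Edge Adj)) (u v : V) : Prop :=
  Relation.ReflTransGen
    (fun a b => ∃ e : Edge Adj, e ∈ S ∧ ω e = true ∧ Inc Adj a e ∧ Inc Adj b e) u v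

/-- `u` lies in an infinite cluster of `ω` restricted to the edges of `S`. -/
def InfCluster (ω : Config Adj) (S : Set (Edge Adj)) (u : V) : Prop :=
  {v | ConnectedIn Adj ω S u v}.Infinite

/-- The set of edges whose endpoints all belong to the region `S`. -/
def edgesInRegion (S : Set V) : Set (Edge Adj) := {e | ∀ v ∈ (e : Sym2 V), v ∈ S}

/-- The boundary condition induced on `D` by the configuration outside of `D`:
two boundary vertices are wired iff they are connected outside of `D`,
or both belong to infinite clusters of the configuration outside of `D`. -/
def inducedBC (maxDeg : ℕ) (D : Finset (Edge Adj)) (ω : Config Adj) :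
    Setoid (bdry Adj maxDeg D) :=
  Relation.EqvGen.setoid fun u v =>
    ConnectedIn Adj ω {e | e ∉ D} u.1 v.1 ∨
      (InfCluster Adj ω {e | e ∉ D} u.1 ∧ InfCluster Adj ω {e | e ∉ D} v.1)

/-- Extension of a local configuration on `D` by closed edges. -/
def extendBy (D : Finset (Edge Adj)) (η : {e // e ∈ D} → Bool) : Config Adj :=
  fun e => if h : e ∈ D then η ⟨e, h⟩ else false

open Classical in
/-- Number of open edges of a local configuration. -/
def openCount (D : Finset (Edge Adj)) (η : {e // e ∈ D} → Bool) : ℕ :=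
  (Finset.univ.filter fun e : {e // e ∈ D} => η e = true).card

/-- The number of clusters of the configuration `ω` in the domain `D`, where boundary
vertices wired together by `ξ` are identified. -/
def clusterCount (maxDeg : ℕ) (D : Finset (Edge Adj)) (ξ : Setoid (bdry Adj maxDeg D))
    (ω : Config Adj) : ℕ :=
  Nat.card (Quot fun u v : vertexSet Adj D =>
    (∃ e ∈ D, ω e = true ∧ Inc Adj u.1 e ∧ Inc Adj v.1 e) ∨
      ∃ hu : u.1 ∈ bdry Adj maxDeg D, ∃ hv : v.1 ∈ bdry Adj maxDeg D,
        ξ.r ⟨u.1, hu⟩ ⟨v.1, hv⟩)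

/-- The FK-percolation weight of a local configuration `η` on the domain `D` with
boundary condition `ξ`. -/
def fkWeight (p q : ℝ) (maxDeg : ℕ) (D : Finset (Edge Adj)) (ξ : Setoid (bdry Adj maxDeg D))
    (η : {e // e ∈ D} → Bool) : ℝ :=
  (p / (1 - p)) ^ openCount Adj D η * q ^ clusterCount Adj maxDeg D ξ (extendBy Adj D η)

/-- The finite-volume FK-percolation measure on the domain `D` with edge-intensity `p`,
cluster-weight `q` and boundary condition `ξ`. -/
def fkFin (p q : ℝ) (maxDeg : ℕ) (D : Finset (Edge Adj)) (ξ : Setoid (bdry Adj maxDeg D)) :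
    Measure ({e // e ∈ D} → Bool) :=
  (∑ η : {e // e ∈ D} → Bool, ENNReal.ofReal (fkWeight Adj p q maxDeg D ξ η))⁻¹ •
    ∑ η : {e // e ∈ D} → Bool,
      ENNReal.ofReal (fkWeight Adj p q maxDeg D ξ η) • Measure.dirac η

/-- Restriction of a configuration to the edges of `D`. -/
def restrictD (D : Finset (Edge Adj)) (ω : Config Adj) : {e // e ∈ D} → Bool := fun e => ω e.1

/-- The event `B` depends only on the edges outside of `D`. -/
def DependsOutside (D : Finset (Edge Adj)) (B : Set (Config Adj)) : Prop :=
  ∀ ω ω' : Config Adj, (∀ e : Edge Adj, e ∉ D → ω e = ω' e) → (ω ∈ B ↔ ω' ∈ B)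

/-- `φ` is a Gibbs measure for FK-percolation with parameters `(p, q)`:
for every finite domain `D` and boundary condition `ξ`, conditionally on the event that
the configuration outside `D` induces the boundary condition `ξ` and on any event
measurable with respect to the edges outside of `D`, the restriction of `φ` to `D`
is the finite-volume FK-percolation measure with boundary condition `ξ`. -/
def IsGibbs (maxDeg : ℕ) (p q : ℝ) (φ : Measure (Config Adj)) : Prop :=
  IsProbabilityMeasure φ ∧
    ∀ (D : Finset (Edge Adj)) (ξ : Setoid (bdry Adj maxDeg D)) (B : Set (Config Adj)),
      MeasurableSet B → DependsOutside Adj D B →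
      φ ({ω | inducedBC Adj maxDeg D ω = ξ} ∩ B) ≠ 0 →
      (φ[|{ω | inducedBC Adj maxDeg D ω = ξ} ∩ B]).map (restrictD Adj D) =
        fkFin Adj p q maxDeg D ξ

/-- The cylinder event prescribing the configuration on the edges of `D`. -/
def cylinder (D : Finset (Edge Adj)) (η : {e // e ∈ D} → Bool) : Set (Config Adj) :=
  {ω | ∀ e : {e // e ∈ D}, ω e.1 = η e}

/-- Weak convergence of measures on configurations: convergence of the probabilities of
all cylinder events. -/
def WeakLim (μs : ℕ → Measure (Config Adj)) (μ : Measure (Config Adj)) : Prop :=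
  ∀ (D : Finset (Edge Adj)) (η : {e // e ∈ D} → Bool),
    Tendsto (fun k => μs k (cylinder Adj D η)) atTop (nhds (μ (cylinder Adj D η)))

/-- A sequence of finite domains increasing to the full lattice. -/
def IsExhaustion (Dseq : ℕ → Finset (Edge Adj)) : Prop :=
  Monotone Dseq ∧ ∀ e : Edge Adj, ∃ k, e ∈ Dseq k

/-- `φ` is the free infinite-volume FK measure: the weak limit of finite-volume measures
with free boundary conditions along any exhaustion. -/
def IsFreeLimit (maxDeg : ℕ) (p q : ℝ) (φ : Measure (Config Adj)) : Prop :=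
  IsProbabilityMeasure φ ∧
    ∀ Dseq : ℕ → Finset (Edge Adj), IsExhaustion Adj Dseq →
      WeakLim Adj
        (fun k => (fkFin Adj p q maxDeg (Dseq k) ⊥).map (extendBy Adj (Dseq k))) φ

/-- `φ` is the wired infinite-volume FK measure: the weak limit of finite-volume measures
with wired boundary conditions along any exhaustion. -/
def IsWiredLimit (maxDeg : ℕ) (p q : ℝ) (φ : Measure (Config Adj)) : Prop :=
  IsProbabilityMeasure φ ∧
    ∀ Dseq : ℕ → Finset (Edge Adj), IsExhaustion Adj Dseq →
      WeakLim Adj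
        (fun k => (fkFin Adj p q maxDeg (Dseq k) ⊤).map (extendBy Adj (Dseq k))) φ

/-- Tail triviality: every event depending on no finite set of edges has probability 0 or 1. -/
def TailTrivial (φ : Measure (Config Adj)) : Prop :=
  ∀ B : Set (Config Adj), MeasurableSet B →
    (∀ D : Finset (Edge Adj), DependsOutside Adj D B) → φ B = 0 ∨ φ B = 1


open Classical in
/-- The finite set of edges of the graph with both endpoints in the finite vertex set `W`. -/
def finEdgesIn (W : Finset V) : Finset (Edge Adj) :=
  (((W ×ˢ W).filter fun p => Adj p.1 p.2).image fun p => s(p.1, p.2)).subtype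
    (· ∈ EdgeSet Adj)

/-- Adjacency of the square lattice `L`: vertices with even coordinate sum at
euclidean distance `√2`. -/
def AdjL (u v : V) : Prop :=
  Even (u.1 + u.2) ∧ Even (v.1 + v.2) ∧ (u.1 - v.1) ^ 2 = 1 ∧ (u.2 - v.2) ^ 2 = 1

end FK

namespace FK

/-! ### Additional structure on the square lattice: translations, duality, half-planes,
boxes and slit domains. -/

/-- Translation vectors of the square lattice `L`. -/
def IsLatticeVec (t : V) : Prop := Even (t.1 + t.2)

/-- Translation of the plane by `t`. -/
def shiftV (t : V) (v : V) : V := (v.1 + t.1, v.2 + t.2)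

lemma adjL_shift {t : V} (ht : IsLatticeVec t) {u v : V} (h : AdjL u v) :
    AdjL (shiftV t u) (shiftV t v) := by
  obtain ⟨hu, hv, h1, h2⟩ := h
  refine ⟨?_, ?_, ?_, ?_⟩
  · have e : (u.1 + t.1) + (u.2 + t.2) = (u.1 + u.2) + (t.1 + t.2) := by ring
    exact e ▸ hu.add ht
  · have e : (v.1 + t.1) + (v.2 + t.2) = (v.1 + v.2) + (t.1 + t.2) := by ring
    exact e ▸ hv.add ht
  · have e : (u.1 + t.1) - (v.1 + t.1) = u.1 - v.1 := by ring
    exact e ▸ h1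
  · have e : (u.2 + t.2) - (v.2 + t.2) = u.2 - v.2 := by ring
    exact e ▸ h2

lemma edgeSet_shift {t : V} (ht : IsLatticeVec t) {e : Sym2 V} (he : e ∈ EdgeSet AdjL) :
    Sym2.map (shiftV t) e ∈ EdgeSet AdjL := by
  obtain ⟨u, v, huv, rfl⟩ := he
  exact ⟨shiftV t u, shiftV t v, adjL_shift ht huv, by rw [Sym2.map_pair_eq]⟩

/-- Translation of an edge of the square lattice by a lattice vector. -/
def shiftEdge (t : V) (ht : IsLatticeVec t) (e : Edge AdjL) : Edge AdjL :=
  ⟨Sym2.map (shiftV t) e.1, edgeSet_shift ht e.2⟩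

/-- The shift of a configuration by a lattice vector. -/
def Shift (t : V) (ht : IsLatticeVec t) (ω : Config AdjL) : Config AdjL :=
  fun e => ω (shiftEdge t ht e)

/-- Dual vertices: points with odd coordinate sum, i.e. vertices of `L* = L + (1,0)`. -/
def IsDualV (w : V) : Prop := Odd (w.1 + w.2)

/-- The primal edge crossed by the dual edge joining the dual vertices `w` and `w'`. -/
def crossSym (w w' : V) : Sym2 V := s(((w.1, w'.2) : V), ((w'.1, w.2) : V))

/-- One step of a dual-open path: `w` and `w'` are adjacent dual vertices and the primal
edge crossing the dual edge between them belongs to `S` and is closed in `ω`. -/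
def DualStep (ω : Config AdjL) (S : Set (Edge AdjL)) (w w' : V) : Prop :=
  IsDualV w ∧ IsDualV w' ∧ (w.1 - w'.1) ^ 2 = 1 ∧ (w.2 - w'.2) ^ 2 = 1 ∧
    ∃ h : crossSym w w' ∈ EdgeSet AdjL,
      (⟨crossSym w w', h⟩ : Edge AdjL) ∈ S ∧ ω ⟨crossSym w w', h⟩ = false

/-- Connectivity by a dual-open path whose crossed primal edges all lie in `S`. -/
def DualConnectedIn (ω : Config AdjL) (S : Set (Edge AdjL)) (w w' : V) : Prop :=
  Relation.ReflTransGen (DualStep ω S) w w'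

/-- The dual vertex `w` lies in an infinite dual cluster. -/
def DualInfCluster (ω : Config AdjL) (S : Set (Edge AdjL)) (w : V) : Prop :=
  {w' | DualConnectedIn ω S w w'}.Infinite

/-- The upper half-plane `H = ℝ × [0, ∞)`. -/
def HP : Set V := {v | 0 ≤ v.2}

/-- The edges of the square lattice contained in the upper half-plane. -/
def HPedges : Set (Edge AdjL) := edgesInRegion AdjL HP

/-- The vertex set of the rectangle `[x1,x2] × [y1,y2]`. -/
def rectV (x1 x2 y1 y2 : ℤ) : Finset V := Finset.Icc x1 x2 ×ˢ Finset.Icc y1 y2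

/-- The edges of the box `Λ_n = [-n,n]²`. -/
def boxE (n : ℤ) : Finset (Edge AdjL) := finEdgesIn AdjL (rectV (-n) n (-n) n)

open Classical in
/-- The configuration in which precisely the edges of the upper half-plane are open. -/
def tau10 : Config AdjL := fun e => if e ∈ HPedges then true else false

/-- The self-dual (= critical) point `p_c(q) = √q / (1 + √q)`. -/
def pc (q : ℝ) : ℝ := Real.sqrt q / (1 + Real.sqrt q)

/-- The domain `[-N,N] × [0,N]`. -/
def hpDomain (N : ℤ) : Finset (Edge AdjL) := finEdgesIn AdjL (rectV (-N) N 0 N)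

/-- `φ` is the infinite-volume FK measure on the upper half-plane with Dobrushin boundary
conditions at parameters `(p,q)`: the weak limit, as `N → ∞`, of the finite-volume FK
measures on `[-N,N] × [0,N]` with the boundary conditions induced by `tau10`. -/
def IsHPDobrushin (p q : ℝ) (φ : Measure (Config AdjL)) : Prop :=
  IsProbabilityMeasure φ ∧
    WeakLim AdjL (fun N =>
      (fkFin AdjL p q 4 (hpDomain N) (inducedBC AdjL 4 (hpDomain N) tau10)).map
        (extendBy AdjL (hpDomain N))) φ

/-- The free and wired infinite-volume measures (at parameters `(p,q)`) differ. -/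
def FreeNeqWired (p q : ℝ) : Prop :=
  ∃ φ0 φ1 : Measure (Config AdjL),
    IsFreeLimit AdjL 4 p q φ0 ∧ IsWiredLimit AdjL 4 p q φ1 ∧ φ0 ≠ φ1

/-! #### The slit domain `Slit(M,N)` -/

/-- Points of the axis that are split in the slit domain `Slit(M,N)`. -/
def SplitPt (M N : ℤ) (v : V) : Prop := v.2 = 0 ∧ (v.1 < -M ∨ N < v.1)

open Classical in
/-- The copy (upper = `true` / lower = `false`) of the endpoint `u` to which the edge `e`
is attached in the slit domain. -/
def endSide (M N : ℤ) (u : V) (e : Edge AdjL) : Bool :=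
  if SplitPt M N u ∧ e ∉ HPedges then false else true

/-- Admissible slit vertices: pairs (vertex, side), the side being `true` except that split
points carry two copies. -/
def SlitVOK (M N : ℤ) (a : V × Bool) : Prop := a.2 = true ∨ SplitPt M N a.1

open Classical in
/-- The degree of a slit vertex in the finite edge set `D`. -/
def slitDeg (M N : ℤ) (D : Finset (Edge AdjL)) (a : V × Bool) : ℕ :=
  (D.filter fun e => Inc AdjL a.1 e ∧ a.2 = endSide M N a.1 e).card

/-- A slit vertex belongs to the finite slit graph spanned by `D`. -/
def SlitPresent (M N : ℤ) (D : Finset (Edge AdjL)) (a : V × Bool) : Prop :=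
  SlitVOK M N a ∧ 0 < slitDeg M N D a

/-- Boundary of the finite slit graph spanned by `D`: its vertices of degree `< 4`. -/
def slitBdry (M N : ℤ) (D : Finset (Edge AdjL)) : Set (V × Bool) :=
  {a | SlitPresent M N D a ∧ slitDeg M N D a < 4}

/-- Number of clusters of `ω` in the finite slit graph spanned by `D`, with boundary
vertices wired together according to `ξ`. -/
def slitClusterCount (M N : ℤ) (D : Finset (Edge AdjL)) (ξ : Setoid (V × Bool))
    (ω : Config AdjL) : ℕ :=
  Nat.card (Quot fun a b : {a : V × Bool // SlitPresent M N D a} =>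
    (∃ e ∈ D, ω e = true ∧ Inc AdjL a.1.1 e ∧ Inc AdjL b.1.1 e ∧
        a.1.2 = endSide M N a.1.1 e ∧ b.1.2 = endSide M N b.1.1 e) ∨
      (a.1 ∈ slitBdry M N D ∧ b.1 ∈ slitBdry M N D ∧ ξ.r a.1 b.1))

/-- FK weight of a local configuration on the finite slit graph. -/
def slitWeight (p q : ℝ) (M N : ℤ) (D : Finset (Edge AdjL)) (ξ : Setoid (V × Bool))
    (η : {e // e ∈ D} → Bool) : ℝ :=
  (p / (1 - p)) ^ openCount AdjL D η *
    q ^ slitClusterCount M N D ξ (extendBy AdjL D η)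

/-- Finite-volume FK measure on the slit graph spanned by `D`, with boundary
condition `ξ`. -/
def slitFin (p q : ℝ) (M N : ℤ) (D : Finset (Edge AdjL)) (ξ : Setoid (V × Bool)) :
    Measure ({e // e ∈ D} → Bool) :=
  (∑ η : {e // e ∈ D} → Bool, ENNReal.ofReal (slitWeight p q M N D ξ η))⁻¹ •
    ∑ η : {e // e ∈ D} → Bool,
      ENNReal.ofReal (slitWeight p q M N D ξ η) • Measure.dirac η

/-- The boundary condition on the slit graph which is wired on `∂Slit⁺` (the upper copies
of the split points) and free everywhere else. -/
def slitPlusBC (M N : ℤ) : Setoid (V × Bool) :=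
  Relation.EqvGen.setoid fun a b =>
    (SplitPt M N a.1 ∧ a.2 = true) ∧ (SplitPt M N b.1 ∧ b.2 = true)

/-- `φ` is the FK measure `φ^{1/0}_{Slit(M,N),p,q}` on `Slit(M,N)`, with wired boundary
conditions on `∂Slit⁺` and free boundary conditions on `∂Slit⁻`: the weak limit of the
finite-volume slit measures on `Λ_R ∩ Slit` as `R → ∞`. -/
def IsSlitMeasure (p q : ℝ) (M N : ℤ) (φ : Measure (Config AdjL)) : Prop :=
  IsProbabilityMeasure φ ∧
    WeakLim AdjL (fun R =>
      (slitFin p q M N (boxE R) (slitPlusBC M N)).map (extendBy AdjL (boxE R))) φ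

/-- The event that `z` is connected to `∂Slit⁺` by an open path contained in the upper
half-plane `H`. -/
def slitPlusConn (M N : ℤ) (z : V) : Set (Config AdjL) :=
  {ω | ∃ a : ℤ, (a < -M ∨ N < a) ∧ ConnectedIn AdjL ω HPedges z (a, 0)}

open Classical in
/-- The number of `c`-good points `(a, 0)`, `a ∈ [x1, x2]`, for the slit measure `φ`:
points of the primal lattice for which the probability of being connected to `∂Slit⁺`
inside `H` is at least `c`. -/
def goodCount (M N : ℤ) (φ : Measure (Config AdjL)) (c : ℝ) (x1 x2 : ℤ) : ℕ :=
  ((Finset.Icc x1 x2).filter fun a =>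
    Even a ∧ ENNReal.ofReal c ≤ φ (slitPlusConn M N (a, 0))).card

end FK

namespace FK

/-! ### Counting classes of a relation -/

/-- Rational functions that are constant along a relation. -/
def quotFun {α : Type*} (r : α → α → Prop) : Submodule ℚ (α → ℚ) where
  carrier := {f | ∀ a b, r a b → f a = f b}
  add_mem' := by
    intro f g hf hg a b h
    simp [hf a b h, hg a b h]
  zero_mem' := by simp
  smul_mem' := by
    intro c f hf a b h
    simp [hf a b h]

theorem natCard_quot_eq_finrank {α : Type*} [Finite α] (r : α → α → Prop) :
    Nat.card (Quot r) = Module.finrank ℚ (quotFun r) := by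
  have e : (Quot r → ℚ) ≃ₗ[ℚ] quotFun r :=
    { toFun := fun f => ⟨fun a => f (Quot.mk r a), fun a b h => by
        show f _ = f _
        rw [Quot.sound h]⟩
      map_add' := fun f g => rfl
      map_smul' := fun c f => rfl
      invFun := fun f => Quot.lift f.1 f.2
      left_inv := fun f => by
        funext x
        induction x using Quot.ind
        rfl
      right_inv := fun f => rfl }
  have := Fintype.ofFinite (Quot r)
  rw [← e.finrank_eq, Module.finrank_fintype_fun_eq_card, Nat.card_eq_fintype_card]

/-- Supermodularity of the number of classes. -/
theorem natCard_quot_supermodular {α : Type*} [Finite α] {r s r' s' : α → α → Prop}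
    (h₁ : ∀ a b, r' a b → r a b) (h₂ : ∀ a b, r' a b → s a b)
    (h₃ : ∀ a b, s' a b → r a b ∨ s a b) :
    Nat.card (Quot r) + Nat.card (Quot s) ≤ Nat.card (Quot r') + Nat.card (Quot s') := by
  simp only [natCard_quot_eq_finrank]
  rw [← Submodule.finrank_sup_add_finrank_inf_eq]
  refine Nat.add_le_add (Submodule.finrank_mono ?_) (Submodule.finrank_mono ?_)
  · exact sup_le (fun f hf a b h => hf a b (h₁ a b h)) (fun f hf a b h => hf a b (h₂ a b h))
  · rintro f ⟨hf, hg⟩ a b h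
    exact (h₃ a b h).elim (hf a b) (hg a b)

/-! ### Probabilities given by finite weights -/

open Classical in
/-- The probability of `A` under the probability measure proportional to `W`. -/
def wProb {α : Type*} [Fintype α] (W : α → ℝ) (A : Set α) : ℝ :=
  (∑ a, if a ∈ A then W a else 0) / ∑ a, W a

theorem sum_weight_pos {α : Type*} [Fintype α] {W : α → ℝ} (h : ∀ a, 0 ≤ W a) {a₀ : α}
    (h₀ : 0 < W a₀) : 0 < ∑ a, W a :=
  Finset.sum_pos' (fun a _ => h a) ⟨a₀, Finset.mem_univ _, h₀⟩

theorem wProb_nonneg {α : Type*} [Fintype α] {W : α → ℝ} (h : ∀ a, 0 ≤ W a) (A : Set α) :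
    0 ≤ wProb W A := by
  classical
  refine div_nonneg (Finset.sum_nonneg fun a _ => ?_) (Finset.sum_nonneg fun a _ => h a)
  split_ifs
  exacts [h a, le_rfl]

theorem wProb_le_one {α : Type*} [Fintype α] {W : α → ℝ} (h : ∀ a, 0 ≤ W a) (A : Set α) :
    wProb W A ≤ 1 := by
  classical
  refine div_le_one_of_le₀ (Finset.sum_le_sum fun a _ => ?_) (Finset.sum_nonneg fun a _ => h a)
  split_ifs
  exacts [le_rfl, h a]

/-- Holley's criterion, for an increasing event. -/
theorem wProb_le_wProb {α : Type*} [DistribLattice α] [Fintype α] {f g : α → ℝ}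
    (hf : ∀ a, 0 ≤ f a) (hg : ∀ a, 0 ≤ g a) {a₀ b₀ : α} (hf₀ : 0 < f a₀) (hg₀ : 0 < g b₀)
    (h : ∀ a b, f a * g b ≤ f (a ⊓ b) * g (a ⊔ b)) {A : Set α} (hA : IsUpperSet A) :
    wProb f A ≤ wProb g A := by
  classical
  have Sf := sum_weight_pos hf hf₀
  have Sg := sum_weight_pos hg hg₀
  have := holley (μ := fun a => if a ∈ A then (1 : ℝ) else 0)
    (f := fun a => f a / ∑ a, f a) (g := fun a => g a / ∑ a, g a)
    (fun a => by dsimp; split_ifs <;> norm_num)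
    (fun a => div_nonneg (hf a) Sf.le) (fun a => div_nonneg (hg a) Sg.le)
    (fun a b hab => by
      dsimp
      by_cases ha : a ∈ A
      · simp [ha, hA hab ha]
      · simp only [ha, if_false]
        split_ifs <;> norm_num)
    (by rw [← Finset.sum_div, ← Finset.sum_div, div_self Sf.ne', div_self Sg.ne'])
    (fun a b => by
      rw [div_mul_div_comm, div_mul_div_comm]
      exact div_le_div_of_nonneg_right (h a b) (mul_pos Sf Sg).le)
  simp only [ite_mul, one_mul, zero_mul] at this
  have e : ∀ (h : α → ℝ) (c : ℝ), (∑ a, if a ∈ A then h a else 0) / c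
      = ∑ a, if a ∈ A then h a / c else 0 := fun h c => by
    rw [Finset.sum_div]
    exact Finset.sum_congr rfl fun a _ => by split_ifs <;> simp
  unfold wProb
  rw [e, e]
  exact this

/-- Positive association under the FKG lattice condition. -/
theorem wProb_mul_le_inter {α : Type*} [DistribLattice α] [Fintype α] {f : α → ℝ}
    (hf : ∀ a, 0 ≤ f a) {a₀ : α} (hf₀ : 0 < f a₀)
    (h : ∀ a b, f a * f b ≤ f (a ⊓ b) * f (a ⊔ b)) {A B : Set α} (hA : IsUpperSet A)
    (hB : IsUpperSet B) : wProb f A * wProb f B ≤ wProb f (A ∩ B) := by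
  classical
  have Sf := sum_weight_pos hf hf₀
  have mono : ∀ {A : Set α}, IsUpperSet A → Monotone fun a => if a ∈ A then (1 : ℝ) else 0 := by
    intro A hA a b hab
    dsimp
    by_cases ha : a ∈ A
    · simp [ha, hA hab ha]
    · simp only [ha, if_false]
      split_ifs <;> norm_num
  have := fkg (μ := f) (f := fun a => if a ∈ A then (1 : ℝ) else 0)
    (g := fun a => if a ∈ B then (1 : ℝ) else 0) hf
    (fun a => by dsimp; split_ifs <;> norm_num) (fun a => by dsimp; split_ifs <;> norm_num)
    (mono hA) (mono hB) h
  unfold wProb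
  rw [div_mul_div_comm, div_le_div_iff₀ (mul_pos Sf Sf) Sf]
  have e : ∀ C : Set α, (∑ a, f a * if a ∈ C then (1 : ℝ) else 0)
      = ∑ a, if a ∈ C then f a else 0 := fun C =>
    Finset.sum_congr rfl fun a _ => by split_ifs <;> simp
  have e2 : (∑ a, f a * ((if a ∈ A then (1 : ℝ) else 0) * if a ∈ B then (1 : ℝ) else 0))
      = ∑ a, if a ∈ A ∩ B then f a else 0 :=
    Finset.sum_congr rfl fun a _ => by
      by_cases h1 : a ∈ A <;> by_cases h2 : a ∈ B <;> simp [h1, h2]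
  rw [e, e, e2] at this
  rw [← mul_assoc]
  refine mul_le_mul_of_nonneg_right ?_ Sf.le
  rw [mul_comm (∑ a, f a)] at this
  convert this

theorem wProb_eq_of_injective {α β : Type*} [Fintype α] [Fintype β] {W : α → ℝ} {W' : β → ℝ}
    (e : α → β) (he : Function.Injective e) {c : ℝ} (hc : c ≠ 0)
    (h0 : ∀ b, b ∉ Set.range e → W' b = 0) (h1 : ∀ a, W' (e a) = c * W a) (A : Set β) :
    wProb W (e ⁻¹' A) = wProb W' A := by
  classical
  have s1 : ∑ a, c * W a = ∑ b, W' b :=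
    Fintype.sum_of_injective e he _ _ (fun b hb => h0 b hb) (fun a => (h1 a).symm)
  have s2 : (∑ a, c * if e a ∈ A then W a else 0) = ∑ b, if b ∈ A then W' b else 0 := by
    refine Fintype.sum_of_injective e he _ _ (fun b hb => ?_) (fun a => ?_)
    · simp [h0 b hb]
    · simp only [h1 a]
      split_ifs <;> simp
  unfold wProb
  rw [← s1, ← s2, ← Finset.mul_sum, ← Finset.mul_sum, mul_div_mul_left _ _ hc]
  rfl

/-! ### Local geometry of the lattice -/

/-- Edges of the square lattice. -/
abbrev EL : Type := Edge AdjL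

/-- Configurations on the square lattice. -/
abbrev CL : Type := Config AdjL

theorem adjL_iff {u v : V} : AdjL u v ↔ Even (u.1 + u.2) ∧
    (v.1 = u.1 + 1 ∨ v.1 = u.1 - 1) ∧ (v.2 = u.2 + 1 ∨ v.2 = u.2 - 1) := by
  unfold AdjL
  simp only [sq_eq_one_iff, Int.even_iff]
  constructor <;> intro h <;> refine ⟨?_, ?_⟩ <;> (try refine ⟨?_, ?_⟩) <;> omega

theorem AdjL.symm {u v : V} (h : AdjL u v) : AdjL v u := by
  rw [adjL_iff, Int.even_iff] at *
  omega

/-- The lattice edge joining two adjacent vertices. -/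
def mkE (u v : V) (h : AdjL u v) : EL := ⟨s(u, v), u, v, h, rfl⟩

theorem exists_eq_mkE (e : EL) : ∃ u v, ∃ h : AdjL u v, e = mkE u v h := by
  obtain ⟨e, u, v, h, rfl⟩ := e
  exact ⟨u, v, h, rfl⟩

theorem inc_mkE {u v w : V} (h : AdjL u v) : Inc AdjL w (mkE u v h) ↔ w = u ∨ w = v := by
  simp [Inc, mkE]

theorem inc_left {u v : V} (h : AdjL u v) : Inc AdjL u (mkE u v h) := by simp [inc_mkE]

theorem inc_right {u v : V} (h : AdjL u v) : Inc AdjL v (mkE u v h) := by simp [inc_mkE]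

theorem mkE_eq_iff {u v u' v' : V} (h : AdjL u v) (h' : AdjL u' v') :
    mkE u v h = mkE u' v' h' ↔ u = u' ∧ v = v' ∨ u = v' ∧ v = u' := by
  simp [mkE, Subtype.ext_iff]

theorem Inc.even {v : V} {e : EL} (h : Inc AdjL v e) : Even (v.1 + v.2) := by
  obtain ⟨a, b, hab, rfl⟩ := exists_eq_mkE e
  rcases (inc_mkE hab).1 h with rfl | rfl
  exacts [hab.1, hab.2.1]

theorem Inc.exists_mkE {v : V} {e : EL} (h : Inc AdjL v e) : ∃ w, ∃ a : AdjL v w, e = mkE v w a := by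
  obtain ⟨a, b, hab, rfl⟩ := exists_eq_mkE e
  rcases (inc_mkE hab).1 h with rfl | rfl
  · exact ⟨b, hab, rfl⟩
  · exact ⟨a, hab.symm, by simp [mkE_eq_iff]⟩

/-- Two endpoints of an edge are equal or joined by that edge. -/
theorem Inc.eq_or_adj {v w : V} {e : EL} (h : Inc AdjL v e) (h' : Inc AdjL w e) :
    v = w ∨ ∃ a : AdjL v w, e = mkE v w a := by
  obtain ⟨x, a, rfl⟩ := h.exists_mkE
  rcases (inc_mkE a).1 h' with rfl | rfl
  exacts [Or.inl rfl, Or.inr ⟨a, rfl⟩]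

theorem adjL_nbr {v : V} (hv : Even (v.1 + v.2)) (i j : Bool) :
    AdjL v (v.1 + (if i then 1 else -1), v.2 + (if j then 1 else -1)) := by
  rw [adjL_iff]
  refine ⟨hv, ?_, ?_⟩ <;> dsimp only <;> split_ifs <;> omega

/-- The edges at an even vertex, indexed by the signs of the two coordinates. -/
def starE (v : V) (hv : Even (v.1 + v.2)) (i : Bool × Bool) : EL :=
  mkE v (v.1 + (if i.1 then 1 else -1), v.2 + (if i.2 then 1 else -1)) (adjL_nbr hv i.1 i.2)

theorem starE_injective {v : V} (hv : Even (v.1 + v.2)) : Function.Injective (starE v hv) := by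
  rintro ⟨i, j⟩ ⟨k, l⟩ h
  simp only [starE, mkE_eq_iff, Prod.ext_iff] at h
  cases i <;> cases j <;> cases k <;> cases l <;> first | rfl | (simp at h)

theorem inc_iff_mem_range_starE {v : V} (hv : Even (v.1 + v.2)) {e : EL} :
    Inc AdjL v e ↔ e ∈ Set.range (starE v hv) := by
  constructor
  · intro h
    obtain ⟨⟨w1, w2⟩, a, rfl⟩ := h.exists_mkE
    obtain ⟨-, h1, h2⟩ := adjL_iff.1 a
    rcases h1 with h1 | h1 <;> rcases h2 with h2 | h2 <;> dsimp only at h1 h2 <;> subst h1 <;>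
      subst h2
    · exact ⟨(true, true), rfl⟩
    · exact ⟨(true, false), rfl⟩
    · exact ⟨(false, true), rfl⟩
    · exact ⟨(false, false), rfl⟩
  · rintro ⟨i, rfl⟩
    exact inc_left _

theorem degree_lt_four_iff {D : Finset EL} {v : V} (hv : Even (v.1 + v.2)) :
    degree AdjL D v < 4 ↔ ∃ e, Inc AdjL v e ∧ e ∉ D := by
  classical
  have hs : ∀ e, e ∈ Finset.univ.image (starE v hv) ↔ Inc AdjL v e := fun e => by
    rw [inc_iff_mem_range_starE hv]
    simp
  have hc : (Finset.univ.image (starE v hv)).card = 4 := by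
    rw [Finset.card_image_of_injective _ (starE_injective hv)]
    rfl
  have hsub : (D.filter fun e => Inc AdjL v e) ⊆ Finset.univ.image (starE v hv) := fun e he =>
    (hs e).2 (Finset.mem_filter.1 he).2
  have hd : degree AdjL D v = (D.filter fun e => Inc AdjL v e).card := by
    unfold degree
    congr
  constructor
  · intro h
    by_contra! hall
    rw [hd, ← hc] at h
    exact absurd (Finset.card_le_card fun e he =>
      Finset.mem_filter.2 ⟨hall e ((hs e).1 he), (hs e).1 he⟩) h.not_ge
  · rintro ⟨e, he, heD⟩
    rw [hd, ← hc]
    refine Finset.card_lt_card ⟨hsub, fun h => heD (Finset.mem_filter.1 (h ((hs e).2 he))).1⟩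

theorem mem_bdry_iff {D : Finset EL} {v : V} :
    v ∈ bdry AdjL 4 D ↔ v ∈ vertexSet AdjL D ∧ ∃ e, Inc AdjL v e ∧ e ∉ D := by
  refine and_congr_right fun ⟨e, _, he⟩ => degree_lt_four_iff he.even

theorem inc_endpoints_finite (e : EL) : {v : V | Inc AdjL v e}.Finite := by
  obtain ⟨u, v, h, rfl⟩ := exists_eq_mkE e
  refine (Set.toFinite {u, v}).subset fun w hw => ?_
  simpa using (inc_mkE h).1 hw

theorem finite_vertexSet (D : Finset EL) : (vertexSet AdjL D).Finite := by
  have : vertexSet AdjL D = ⋃ e ∈ D, {v | Inc AdjL v e} := by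
    ext v
    simp [vertexSet]
  rw [this]
  exact D.finite_toSet.biUnion fun e _ => inc_endpoints_finite e

instance (D : Finset EL) : Finite (vertexSet AdjL D) := finite_vertexSet D

instance (D : Finset EL) : Finite (bdry AdjL 4 D) :=
  (finite_vertexSet D).subset fun _ h => h.1

theorem bdry_nonempty {D : Finset EL} (hD : D.Nonempty) : (bdry AdjL 4 D).Nonempty := by
  obtain ⟨e, he⟩ := hD
  obtain ⟨u, v, h, rfl⟩ := exists_eq_mkE e
  obtain ⟨x, hx, hmax⟩ := Set.exists_max_image (vertexSet AdjL D) Prod.fst (finite_vertexSet D)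
    ⟨u, _, he, inc_left h⟩
  obtain ⟨e', he', hx'⟩ := hx
  refine ⟨x, mem_bdry_iff.2 ⟨⟨e', he', hx'⟩, starE x hx'.even (true, true), inc_left _, ?_⟩⟩
  intro hm
  have := hmax _ ⟨_, hm, inc_right (adjL_nbr hx'.even true true)⟩
  simp at this

instance : Countable EL := inferInstance

/-! ### Comparison of finite-volume measures -/

theorem natCard_quot_congr {α β : Type*} {r : α → α → Prop} {s : β → β → Prop}
    (i : α → β) (j : β → α) (hi : ∀ a b, r a b → Relation.EqvGen s (i a) (i b))
    (hj : ∀ a b, s a b → Relation.EqvGen r (j a) (j b))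
    (hji : ∀ a, Relation.EqvGen r (j (i a)) a) (hij : ∀ b, Relation.EqvGen s (i (j b)) b) :
    Nat.card (Quot r) = Nat.card (Quot s) :=
  Nat.card_congr
    { toFun := Quot.lift (fun a => Quot.mk s (i a)) fun a b h => Quot.eqvGen_sound (hi a b h)
      invFun := Quot.lift (fun a => Quot.mk r (j a)) fun a b h => Quot.eqvGen_sound (hj a b h)
      left_inv := fun x => by
        induction x using Quot.ind with
        | mk a => exact Quot.eqvGen_sound (hji a)
      right_inv := fun x => by
        induction x using Quot.ind with
        | mk a => exact Quot.eqvGen_sound (hij a) }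

/-- Adding isolated points adds as many classes. -/
theorem natCard_quot_add_isolated {α β : Type*} [Finite β] {r : α → α → Prop}
    {s : β → β → Prop} (i : α → β) (hinj : Function.Injective i)
    (hi : ∀ a b, r a b → a = b ∨ s (i a) (i b)) (hi' : ∀ a b, s (i a) (i b) → a = b ∨ r a b)
    (hs : ∀ x y, s x y → x = y ∨ x ∈ Set.range i ∧ y ∈ Set.range i) :
    Nat.card (Quot s) = Nat.card (Quot r) + Nat.card ↥(Set.range i)ᶜ := by
  classical
  have : Finite α := Finite.of_injective i hinj
  have hfin : Finite (Quot r) := Quot.finite _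
  rw [← Nat.card_sum]
  refine Nat.card_congr
    { toFun := Quot.lift (fun x => if h : x ∈ Set.range i then Sum.inl (Quot.mk r h.choose)
        else Sum.inr ⟨x, h⟩) ?_
      invFun := Sum.elim (Quot.lift (fun a => Quot.mk s (i a))
        fun a b h => (hi a b h).elim (fun h => by rw [h]) fun h => Quot.sound h) fun x => Quot.mk s x.1
      left_inv := ?_
      right_inv := ?_ }
  · intro x y hxy
    rcases hs x y hxy with rfl | ⟨hx, hy⟩
    · rfl
    · simp only [hx, hy, dif_pos]
      congr 1
      have h : s (i hx.choose) (i hy.choose) := by rwa [hx.choose_spec, hy.choose_spec]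
      exact (hi' _ _ h).elim (fun h => by rw [h]) fun h => Quot.sound h
  · intro x
    induction x using Quot.ind with
    | mk x =>
      by_cases h : x ∈ Set.range i
      · simp only [h, dif_pos, Sum.elim_inl]
        rw [h.choose_spec]
      · simp only [h, dif_neg, not_false_eq_true, Sum.elim_inr]
  · rintro (x | x)
    · induction x using Quot.ind with
      | mk a =>
        have h : i a ∈ Set.range i := ⟨a, rfl⟩
        simp only [Sum.elim_inl, h, dif_pos]
        congr 2
        exact hinj h.choose_spec
    · have h : x.1 ∉ Set.range i := x.2
      simp only [Sum.elim_inr, h, dif_neg, not_false_eq_true]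

/-- All the edges of `F` are open. -/
def opn (F : Finset EL) : Set CL := {ω | ∀ e ∈ F, ω e = true}

/-- The cluster relation defining `clusterCount`. -/
def clRel (D : Finset EL) (ξ : Setoid (bdry AdjL 4 D)) (ω : CL) (u v : vertexSet AdjL D) : Prop :=
  (∃ e ∈ D, ω e = true ∧ Inc AdjL u.1 e ∧ Inc AdjL v.1 e) ∨
    ∃ hu : u.1 ∈ bdry AdjL 4 D, ∃ hv : v.1 ∈ bdry AdjL 4 D, ξ.r ⟨u.1, hu⟩ ⟨v.1, hv⟩

theorem clusterCount_eq (D : Finset EL) (ξ : Setoid (bdry AdjL 4 D)) (ω : CL) :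
    clusterCount AdjL 4 D ξ ω = Nat.card (Quot (clRel D ξ ω)) := rfl

theorem openCount_eq (D : Finset EL) (η : {e // e ∈ D} → Bool) :
    openCount AdjL D η = (D.filter fun e => extendBy AdjL D η e = true).card := by
  classical
  unfold openCount
  rw [← Finset.card_map (Function.Embedding.subtype (· ∈ D))]
  congr 1
  ext e
  rw [Finset.mem_map, Finset.mem_filter]
  constructor
  · rintro ⟨x, hx, rfl⟩
    exact ⟨x.2, by simpa [extendBy] using (Finset.mem_filter.1 hx).2⟩
  · rintro ⟨h, h'⟩
    exact ⟨⟨e, h⟩, Finset.mem_filter.2 ⟨Finset.mem_univ _, by simpa [extendBy, h] using h'⟩, rfl⟩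

theorem openCount_inf_add_sup (D : Finset EL) (a b : {e // e ∈ D} → Bool) :
    openCount AdjL D (a ⊓ b) + openCount AdjL D (a ⊔ b)
      = openCount AdjL D a + openCount AdjL D b := by
  classical
  unfold openCount
  rw [← Finset.card_inter_add_card_union (Finset.univ.filter fun e => a e = true)]
  congr 2 <;> ext e <;> simp

theorem extendBy_eq_true {D : Finset EL} {η : {e // e ∈ D} → Bool} {e : EL} :
    extendBy AdjL D η e = true ↔ ∃ h : e ∈ D, η ⟨e, h⟩ = true := by
  unfold extendBy
  split_ifs with h <;> simp [h]

section Weights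

variable {p q : ℝ}

theorem fkWeight_pos (hp0 : 0 < p) (hp1 : p < 1) (hq : 1 ≤ q) (D : Finset EL)
    (ξ : Setoid (bdry AdjL 4 D)) (η : {e // e ∈ D} → Bool) : 0 < fkWeight AdjL p q 4 D ξ η :=
  mul_pos (pow_pos (div_pos hp0 (by linarith)) _) (pow_pos (by linarith) _)

/-- The lattice condition for weights of cluster type. -/
theorem weight_lattice {r q : ℝ} (hr : 0 < r) (hq : 1 ≤ q) {o₁ o₂ o₃ o₄ k₁ k₂ k₃ k₄ : ℕ}
    (ho : o₃ + o₄ = o₁ + o₂) (hk : k₁ + k₂ ≤ k₃ + k₄) :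
    (r ^ o₁ * q ^ k₁) * (r ^ o₂ * q ^ k₂) ≤ (r ^ o₃ * q ^ k₃) * (r ^ o₄ * q ^ k₄) := by
  have e : ∀ a b c d : ℕ, (r ^ a * q ^ b) * (r ^ c * q ^ d) = r ^ (a + c) * q ^ (b + d) :=
    fun a b c d => by ring
  rw [e, e, ho]
  exact mul_le_mul_of_nonneg_left (pow_le_pow_right₀ hq hk) (pow_pos hr _).le

theorem clusterCount_supermodular (D : Finset EL) {ξ ξ' : Setoid (bdry AdjL 4 D)} (h : ξ ≤ ξ')
    (a b : {e // e ∈ D} → Bool) :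
    clusterCount AdjL 4 D ξ (extendBy AdjL D a) + clusterCount AdjL 4 D ξ' (extendBy AdjL D b) ≤
      clusterCount AdjL 4 D ξ (extendBy AdjL D (a ⊓ b)) +
        clusterCount AdjL 4 D ξ' (extendBy AdjL D (a ⊔ b)) := by
  refine natCard_quot_supermodular ?_ ?_ ?_
  · rintro u v (⟨e, he, h1, h2⟩ | h1)
    · obtain ⟨h3, h4⟩ := extendBy_eq_true.1 h1
      refine Or.inl ⟨e, he, extendBy_eq_true.2 ⟨h3, ?_⟩, h2⟩
      simp at h4
      exact h4.1
    · exact Or.inr h1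
  · rintro u v (⟨e, he, h1, h2⟩ | ⟨hu, hv, h1⟩)
    · obtain ⟨h3, h4⟩ := extendBy_eq_true.1 h1
      refine Or.inl ⟨e, he, extendBy_eq_true.2 ⟨h3, ?_⟩, h2⟩
      simp at h4
      exact h4.2
    · exact Or.inr ⟨hu, hv, h h1⟩
  · rintro u v (⟨e, he, h1, h2⟩ | h1)
    · obtain ⟨h3, h4⟩ := extendBy_eq_true.1 h1
      simp at h4
      rcases h4 with h4 | h4
      · exact Or.inl (Or.inl ⟨e, he, extendBy_eq_true.2 ⟨h3, h4⟩, h2⟩)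
      · exact Or.inr (Or.inl ⟨e, he, extendBy_eq_true.2 ⟨h3, h4⟩, h2⟩)
    · exact Or.inr (Or.inr h1)

variable (hp0 : 0 < p) (hp1 : p < 1) (hq : 1 ≤ q)
include hp0 hp1 hq

theorem fkWeight_lattice (D : Finset EL) {ξ ξ' : Setoid (bdry AdjL 4 D)} (h : ξ ≤ ξ')
    (a b : {e // e ∈ D} → Bool) :
    fkWeight AdjL p q 4 D ξ a * fkWeight AdjL p q 4 D ξ' b ≤
      fkWeight AdjL p q 4 D ξ (a ⊓ b) * fkWeight AdjL p q 4 D ξ' (a ⊔ b) :=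
  weight_lattice (div_pos hp0 (by linarith)) hq (openCount_inf_add_sup D a b)
    (clusterCount_supermodular D h a b)

theorem wProb_fkWeight_mono_bc (D : Finset EL) {ξ ξ' : Setoid (bdry AdjL 4 D)} (h : ξ ≤ ξ')
    {A : Set ({e // e ∈ D} → Bool)} (hA : IsUpperSet A) :
    wProb (fkWeight AdjL p q 4 D ξ) A ≤ wProb (fkWeight AdjL p q 4 D ξ') A :=
  wProb_le_wProb (fun a => (fkWeight_pos hp0 hp1 hq D ξ a).le)
    (fun a => (fkWeight_pos hp0 hp1 hq D ξ' a).le) (fkWeight_pos hp0 hp1 hq D ξ ⊥)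
    (fkWeight_pos hp0 hp1 hq D ξ' ⊥) (fkWeight_lattice hp0 hp1 hq D h) hA

theorem wProb_fkWeight_fkg (D : Finset EL) (ξ : Setoid (bdry AdjL 4 D))
    {A B : Set ({e // e ∈ D} → Bool)} (hA : IsUpperSet A) (hB : IsUpperSet B) :
    wProb (fkWeight AdjL p q 4 D ξ) A * wProb (fkWeight AdjL p q 4 D ξ) B ≤
      wProb (fkWeight AdjL p q 4 D ξ) (A ∩ B) :=
  wProb_mul_le_inter (fun a => (fkWeight_pos hp0 hp1 hq D ξ a).le)
    (fkWeight_pos hp0 hp1 hq D ξ ⊥) (fkWeight_lattice hp0 hp1 hq D le_rfl) hA hB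

end Weights

theorem isUpperSet_extendBy_opn (D F : Finset EL) :
    IsUpperSet {η : {e // e ∈ D} → Bool | extendBy AdjL D η ∈ opn F} := by
  intro a b hab ha e he
  obtain ⟨h, h'⟩ := extendBy_eq_true.1 (ha e he)
  refine extendBy_eq_true.2 ⟨h, ?_⟩
  have := hab ⟨e, h⟩
  rw [h'] at this
  exact top_le_iff.1 this

theorem extendBy_restrictD_extendBy {D D' : Finset EL} (h : D ⊆ D') (a : {e // e ∈ D} → Bool) :
    extendBy AdjL D' (restrictD AdjL D' (extendBy AdjL D a)) = extendBy AdjL D a := by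
  funext e
  unfold extendBy restrictD
  by_cases h1 : e ∈ D
  · simp [h1, h h1]
  · simp [h1]

theorem vertexSet_mono {D D' : Finset EL} (h : D ⊆ D') : vertexSet AdjL D ⊆ vertexSet AdjL D' :=
  fun _ ⟨e, he, hv⟩ => ⟨e, h he, hv⟩

/-- With free boundary conditions, the probability that given edges are open increases with
the domain. -/
theorem wProb_free_mono {p q : ℝ} (hp0 : 0 < p) (hp1 : p < 1) (hq : 1 ≤ q) {D D' : Finset EL}
    (h : D ⊆ D') (F : Finset EL) :
    wProb (fkWeight AdjL p q 4 D ⊥) {η | extendBy AdjL D η ∈ opn F} ≤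
      wProb (fkWeight AdjL p q 4 D' ⊥) {η | extendBy AdjL D' η ∈ opn F} := by
  classical
  set f : ({e // e ∈ D'} → Bool) → ℝ := fun η =>
    if ∀ e : {e // e ∈ D'}, e.1 ∉ D → η e = false then fkWeight AdjL p q 4 D' ⊥ η else 0 with hf
  let ι : ({e // e ∈ D} → Bool) → ({e // e ∈ D'} → Bool) := fun a =>
    restrictD AdjL D' (extendBy AdjL D a)
  have hι : Function.Injective ι := by
    intro a b hab
    funext e
    have := congr_fun hab ⟨e.1, h e.2⟩
    simpa [ι, restrictD, extendBy] using this
  have hf0 : ∀ a, 0 ≤ f a := fun a => by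
    simp only [hf]
    split_ifs
    exacts [(fkWeight_pos hp0 hp1 hq D' ⊥ a).le, le_rfl]
  have hbot : 0 < f ⊥ := by
    have h1 : ∀ e : {e // e ∈ D'}, e.1 ∉ D → (⊥ : {e // e ∈ D'} → Bool) e = false :=
      fun e _ => rfl
    simp only [hf]
    rw [if_pos h1]
    exact fkWeight_pos hp0 hp1 hq D' ⊥ ⊥
  set i : vertexSet AdjL D → vertexSet AdjL D' := fun v => ⟨v.1, vertexSet_mono h v.2⟩ with hi
  have hcount : ∀ a : {e // e ∈ D} → Bool,
      clusterCount AdjL 4 D' ⊥ (extendBy AdjL D a)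
        = clusterCount AdjL 4 D ⊥ (extendBy AdjL D a) + Nat.card ↥(Set.range i)ᶜ := by
    intro a
    refine natCard_quot_add_isolated i (fun u v huv => ?_) (fun u v => ?_) (fun u v => ?_) ?_
    · exact Subtype.ext (congr_arg (fun x : vertexSet AdjL D' => x.1) huv)
    · rintro (⟨e, h0, h1, h2⟩ | ⟨hu, hv, h1⟩)
      · exact Or.inr (Or.inl ⟨e, h h0, h1, h2⟩)
      · exact Or.inl (Subtype.ext (congr_arg (fun x : bdry AdjL 4 D => x.1) h1))
    · rintro (⟨e, -, h1, h2⟩ | ⟨hu, hv, h1⟩)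
      · exact Or.inr (Or.inl ⟨e, (extendBy_eq_true.1 h1).1, h1, h2⟩)
      · exact Or.inl (Subtype.ext (congr_arg (fun x : bdry AdjL 4 D' => x.1) h1))
    · rintro x y (⟨e, -, h1, h2, h3⟩ | ⟨hu, hv, h1⟩)
      · have he := (extendBy_eq_true.1 h1).1
        exact Or.inr ⟨⟨⟨x.1, e, he, h2⟩, rfl⟩, ⟨⟨y.1, e, he, h3⟩, rfl⟩⟩
      · exact Or.inl (Subtype.ext (congr_arg (fun x : bdry AdjL 4 D' => x.1) h1))
  have hweight : ∀ a, f (ι a) = q ^ Nat.card ↥(Set.range i)ᶜ * fkWeight AdjL p q 4 D ⊥ a := by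
    intro a
    have h1 : ∀ e : {e // e ∈ D'}, e.1 ∉ D → ι a e = false := fun e he => by
      simp [ι, restrictD, extendBy, he]
    simp only [hf]
    rw [if_pos h1]
    unfold fkWeight
    rw [openCount_eq, openCount_eq, extendBy_restrictD_extendBy h, hcount, pow_add]
    have : (D'.filter fun e => extendBy AdjL D a e = true)
        = D.filter fun e => extendBy AdjL D a e = true := by
      ext e
      simp only [Finset.mem_filter]
      exact ⟨fun h => ⟨(extendBy_eq_true.1 h.2).1, h.2⟩, fun h' => ⟨h h'.1, h'.2⟩⟩
    rw [this]
    ring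
  have key := wProb_eq_of_injective ι hι (W := fkWeight AdjL p q 4 D ⊥) (W' := f)
    (pow_pos (by linarith : (0 : ℝ) < q) (Nat.card ↥(Set.range i)ᶜ)).ne' ?_ hweight
    {η | extendBy AdjL D' η ∈ opn F}
  · have e : ι ⁻¹' {η | extendBy AdjL D' η ∈ opn F} = {η | extendBy AdjL D η ∈ opn F} := by
      ext η
      simp only [ι, Set.mem_preimage, Set.mem_ofPred_eq, extendBy_restrictD_extendBy h]
    rw [← e, key]
    refine wProb_le_wProb hf0 (fun a => (fkWeight_pos hp0 hp1 hq D' ⊥ a).le) hbot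
      (fkWeight_pos hp0 hp1 hq D' ⊥ ⊥) (fun a b => ?_) (isUpperSet_extendBy_opn D' F)
    by_cases ha : ∀ e : {e // e ∈ D'}, e.1 ∉ D → a e = false
    · have hab : ∀ e : {e // e ∈ D'}, e.1 ∉ D → (a ⊓ b) e = false := fun e he => by
        simp [ha e he]
      simp only [hf]
      rw [if_pos ha, if_pos hab]
      exact fkWeight_lattice hp0 hp1 hq D' le_rfl a b
    · simp only [hf]
      rw [if_neg ha, zero_mul]
      exact mul_nonneg (hf0 _) (fkWeight_pos hp0 hp1 hq D' ⊥ _).le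
  · intro b hb
    simp only [hf]
    rw [if_neg]
    intro hb'
    refine hb ⟨fun e => b ⟨e.1, h e.2⟩, ?_⟩
    funext e
    by_cases he : e.1 ∈ D
    · simp [ι, restrictD, extendBy, he]
    · simp [ι, restrictD, extendBy, he, hb' e he]

/-- Extension of a configuration on `D` by open edges. -/
def openExt (D : Finset EL) (a : {e // e ∈ D} → Bool) : CL :=
  fun e => if h : e ∈ D then a ⟨e, h⟩ else true

/-- With wired boundary conditions, the probability that given edges are open decreases with
the domain. -/
theorem wProb_wired_anti {p q : ℝ} (hp0 : 0 < p) (hp1 : p < 1) (hq : 1 ≤ q) {D D' : Finset EL}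
    (h : D ⊆ D') (hD : D.Nonempty) {F : Finset EL} (hF : F ⊆ D) :
    wProb (fkWeight AdjL p q 4 D' ⊤) {η | extendBy AdjL D' η ∈ opn F} ≤
      wProb (fkWeight AdjL p q 4 D ⊤) {η | extendBy AdjL D η ∈ opn F} := by
  classical
  -- wired weight on `D'` where moreover all vertices outside the interior of `D` are identified
  let rel : ({e // e ∈ D'} → Bool) → vertexSet AdjL D' → vertexSet AdjL D' → Prop :=
    fun η u v => (∃ e ∈ D', extendBy AdjL D' η e = true ∧ Inc AdjL u.1 e ∧ Inc AdjL v.1 e) ∨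
      ((∃ e, Inc AdjL u.1 e ∧ e ∉ D) ∧ ∃ e, Inc AdjL v.1 e ∧ e ∉ D)
  let w : ({e // e ∈ D'} → Bool) → ℝ := fun η =>
    (p / (1 - p)) ^ openCount AdjL D' η * q ^ Nat.card (Quot (rel η))
  have hwpos : ∀ η, 0 < w η := fun η =>
    mul_pos (pow_pos (div_pos hp0 (by linarith)) _) (pow_pos (by linarith) _)
  set g : ({e // e ∈ D'} → Bool) → ℝ := fun η =>
    if ∀ e : {e // e ∈ D'}, e.1 ∉ D → η e = true then w η else 0 with hg
  let ι : ({e // e ∈ D} → Bool) → ({e // e ∈ D'} → Bool) := fun a =>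
    restrictD AdjL D' (openExt D a)
  have hιval : ∀ a e, extendBy AdjL D' (ι a) e = true ↔ e ∈ D' ∧ openExt D a e = true := by
    intro a e
    simp [extendBy_eq_true, ι, restrictD]
  have hιD : ∀ a e, e ∈ D → (extendBy AdjL D' (ι a) e = true ↔ extendBy AdjL D a e = true) := by
    intro a e he
    rw [hιval, extendBy_eq_true]
    simp [openExt, he, h he]
  have hι : Function.Injective ι := by
    intro a b hab
    funext e
    have := congr_fun hab ⟨e.1, h e.2⟩
    simpa [ι, restrictD, openExt] using this
  have hg0 : ∀ a, 0 ≤ g a := fun a => by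
    simp only [hg]
    split_ifs
    exacts [(hwpos a).le, le_rfl]
  have htop : 0 < g ⊤ := by
    have h1 : ∀ e : {e // e ∈ D'}, e.1 ∉ D → (⊤ : {e // e ∈ D'} → Bool) e = true :=
      fun e _ => rfl
    simp only [hg]
    rw [if_pos h1]
    exact hwpos ⊤
  obtain ⟨b₀, hb₀⟩ := bdry_nonempty hD
  set i : vertexSet AdjL D → vertexSet AdjL D' := fun v => ⟨v.1, vertexSet_mono h v.2⟩ with hi
  set j : vertexSet AdjL D' → vertexSet AdjL D := fun v =>
    if hv : v.1 ∈ vertexSet AdjL D then ⟨v.1, hv⟩ else ⟨b₀, hb₀.1⟩ with hj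
  have hjbd : ∀ v : vertexSet AdjL D', (∃ e, Inc AdjL v.1 e ∧ e ∉ D) →
      (j v).1 ∈ bdry AdjL 4 D := by
    intro v hv
    by_cases hv' : v.1 ∈ vertexSet AdjL D
    · simp only [hj, hv', dif_pos]
      exact mem_bdry_iff.2 ⟨hv', hv⟩
    · simp only [hj, hv', dif_neg, not_false_eq_true]
      exact hb₀
  have hout : ∀ v : vertexSet AdjL D', v.1 ∉ vertexSet AdjL D → ∃ e, Inc AdjL v.1 e ∧ e ∉ D := by
    rintro ⟨v, e, he, hv⟩ hv'
    exact ⟨e, hv, fun hm => hv' ⟨e, hm, hv⟩⟩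
  have hcount : ∀ a : {e // e ∈ D} → Bool,
      Nat.card (Quot (rel (ι a))) = clusterCount AdjL 4 D ⊤ (extendBy AdjL D a) := by
    intro a
    refine (natCard_quot_congr i j (fun u v huv => ?_) (fun u v huv => ?_) (fun u => ?_)
      fun u => ?_).symm
    · refine Relation.EqvGen.rel _ _ ?_
      rcases huv with ⟨e, he, h1, h2⟩ | ⟨hu, hv, h1⟩
      · exact Or.inl ⟨e, h he, (hιD a e he).2 h1, h2⟩
      · exact Or.inr ⟨(mem_bdry_iff.1 hu).2, (mem_bdry_iff.1 hv).2⟩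
    · have hbd : (∃ e, Inc AdjL u.1 e ∧ e ∉ D) → (∃ e, Inc AdjL v.1 e ∧ e ∉ D) →
          Relation.EqvGen (clRel D ⊤ (extendBy AdjL D a)) (j u) (j v) := fun hu hv =>
        Relation.EqvGen.rel _ _ (Or.inr ⟨hjbd u hu, hjbd v hv, trivial⟩)
      rcases huv with ⟨e, he, h1, h2, h3⟩ | ⟨hu, hv⟩
      · by_cases heD : e ∈ D
        · refine Relation.EqvGen.rel _ _ (Or.inl ⟨e, heD, (hιD a e heD).1 h1, ?_, ?_⟩)
          · have : u.1 ∈ vertexSet AdjL D := ⟨e, heD, h2⟩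
            simpa only [hj, this, dif_pos] using h2
          · have : v.1 ∈ vertexSet AdjL D := ⟨e, heD, h3⟩
            simpa only [hj, this, dif_pos] using h3
        · exact hbd ⟨e, h2, heD⟩ ⟨e, h3, heD⟩
      · exact hbd hu hv
    · have : j (i u) = u := by
        simp [hj, hi]
      rw [this]
      exact Relation.EqvGen.refl _
    · by_cases hv' : u.1 ∈ vertexSet AdjL D
      · have : i (j u) = u := by simp [hj, hi, hv']
        rw [this]
        exact Relation.EqvGen.refl _
      · refine Relation.EqvGen.rel _ _ (Or.inr ⟨?_, hout u hv'⟩)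
        exact (mem_bdry_iff.1 (hjbd u (hout u hv'))).2
  have hweight : ∀ a, g (ι a) = (p / (1 - p)) ^ (D' \ D).card * fkWeight AdjL p q 4 D ⊤ a := by
    intro a
    have h1 : ∀ e : {e // e ∈ D'}, e.1 ∉ D → ι a e = true := fun e he => by
      simp [ι, restrictD, openExt, he]
    simp only [hg]
    rw [if_pos h1]
    simp only [w]
    unfold fkWeight
    have : (D'.filter fun e => extendBy AdjL D' (ι a) e = true)
        = (D' \ D) ∪ D.filter fun e => extendBy AdjL D a e = true := by
      ext e
      simp only [Finset.mem_filter, Finset.mem_union, Finset.mem_sdiff]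
      by_cases he : e ∈ D
      · simp [he, h he, hιD a e he]
      · simp [he, hιval, openExt]
    rw [openCount_eq, openCount_eq, this, hcount, Finset.card_union_of_disjoint, pow_add]
    · ring
    · exact Finset.disjoint_left.2 fun e he he' =>
        (Finset.mem_sdiff.1 he).2 (Finset.mem_filter.1 he').1
  have key := wProb_eq_of_injective ι hι (W := fkWeight AdjL p q 4 D ⊤) (W' := g)
    (pow_pos (div_pos hp0 (by linarith)) (D' \ D).card).ne' ?_ hweight
    {η | extendBy AdjL D' η ∈ opn F}
  · have e : ι ⁻¹' {η | extendBy AdjL D' η ∈ opn F} = {η | extendBy AdjL D η ∈ opn F} := by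
      ext η
      simp only [Set.mem_preimage, Set.mem_ofPred_eq, opn]
      exact forall₂_congr fun e he => hιD η e (hF he)
    rw [← e, key]
    refine wProb_le_wProb (fun a => (fkWeight_pos hp0 hp1 hq D' ⊤ a).le) hg0
      (fkWeight_pos hp0 hp1 hq D' ⊤ ⊤) htop (fun a b => ?_) (isUpperSet_extendBy_opn D' F)
    by_cases hb : ∀ e : {e // e ∈ D'}, e.1 ∉ D → b e = true
    · have hab : ∀ e : {e // e ∈ D'}, e.1 ∉ D → (a ⊔ b) e = true := fun e he => by
        simp [hb e he]
      simp only [hg]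
      rw [if_pos hb, if_pos hab]
      refine weight_lattice (div_pos hp0 (by linarith)) hq (openCount_inf_add_sup D' a b) ?_
      rw [clusterCount_eq, clusterCount_eq]
      refine natCard_quot_supermodular ?_ ?_ ?_
      · rintro u v (⟨e, he, h1, h2⟩ | h1)
        · obtain ⟨h3, h4⟩ := extendBy_eq_true.1 h1
          simp at h4
          exact Or.inl ⟨e, he, extendBy_eq_true.2 ⟨h3, h4.1⟩, h2⟩
        · exact Or.inr h1
      · rintro u v (⟨e, he, h1, h2⟩ | ⟨hu, hv, h1⟩)
        · obtain ⟨h3, h4⟩ := extendBy_eq_true.1 h1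
          simp at h4
          exact Or.inl ⟨e, he, extendBy_eq_true.2 ⟨h3, h4.2⟩, h2⟩
        · obtain ⟨-, e, he, heD⟩ := mem_bdry_iff.1 hu
          obtain ⟨-, e', he', heD'⟩ := mem_bdry_iff.1 hv
          exact Or.inr ⟨⟨e, he, fun hm => heD (h hm)⟩, ⟨e', he', fun hm => heD' (h hm)⟩⟩
      · rintro u v (⟨e, he, h1, h2⟩ | h1)
        · obtain ⟨h3, h4⟩ := extendBy_eq_true.1 h1
          simp at h4
          rcases h4 with h4 | h4
          · exact Or.inl (Or.inl ⟨e, he, extendBy_eq_true.2 ⟨h3, h4⟩, h2⟩)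
          · exact Or.inr (Or.inl ⟨e, he, extendBy_eq_true.2 ⟨h3, h4⟩, h2⟩)
        · exact Or.inr (Or.inr h1)
    · simp only [hg]
      rw [if_neg hb, mul_zero]
      exact mul_nonneg (fkWeight_pos hp0 hp1 hq D' ⊤ _).le (hg0 _)
  · intro b hb
    simp only [hg]
    rw [if_neg]
    intro hb'
    refine hb ⟨fun e => b ⟨e.1, h e.2⟩, ?_⟩
    funext e
    by_cases he : e.1 ∈ D
    · simp [ι, restrictD, openExt, he]
    · simp [ι, restrictD, openExt, he, hb' e he]

/-! ### Connections and measurability -/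

theorem reflTransGen_symm {α : Type*} {r : α → α → Prop} (hr : ∀ a b, r a b → r b a) {a b : α}
    (h : Relation.ReflTransGen r a b) : Relation.ReflTransGen r b a := by
  induction h with
  | refl => exact Relation.ReflTransGen.refl
  | tail _ h ih => exact Relation.ReflTransGen.head (hr _ _ h) ih

namespace ConnectedIn

variable {ω ω' : CL} {S S' : Set EL} {u v w : V}

theorem refl : ConnectedIn AdjL ω S u u := Relation.ReflTransGen.refl

theorem trans (h : ConnectedIn AdjL ω S u v) (h' : ConnectedIn AdjL ω S v w) :
    ConnectedIn AdjL ω S u w := Relation.ReflTransGen.trans h h'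

theorem symm (h : ConnectedIn AdjL ω S u v) : ConnectedIn AdjL ω S v u := by
  refine reflTransGen_symm ?_ h
  rintro a b ⟨e, h1, h2, h3, h4⟩
  exact ⟨e, h1, h2, h4, h3⟩

theorem step {e : EL} (h1 : e ∈ S) (h2 : ω e = true) (h3 : Inc AdjL u e) (h4 : Inc AdjL v e) :
    ConnectedIn AdjL ω S u v := Relation.ReflTransGen.single ⟨e, h1, h2, h3, h4⟩

theorem mono' (h : ConnectedIn AdjL ω S u v)
    (hS : ∀ e ∈ S, ω e = true → e ∈ S' ∧ ω' e = true) : ConnectedIn AdjL ω' S' u v := by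
  refine Relation.ReflTransGen.mono ?_ _ _ h
  rintro a b ⟨e, h1, h2, h3⟩
  exact ⟨e, (hS e h1 h2).1, (hS e h1 h2).2, h3⟩

theorem mono (h : ConnectedIn AdjL ω S u v) (hS : S ⊆ S') : ConnectedIn AdjL ω S' u v :=
  h.mono' fun _ he ho => ⟨hS he, ho⟩

theorem congr (h : ∀ e ∈ S, ω e = ω' e) :
    ConnectedIn AdjL ω S u v ↔ ConnectedIn AdjL ω' S u v :=
  ⟨fun hc => hc.mono' fun e he ho => ⟨he, h e he ▸ ho⟩,
    fun hc => hc.mono' fun e he ho => ⟨he, (h e he).symm ▸ ho⟩⟩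

theorem exists_finset (h : ConnectedIn AdjL ω S u v) :
    ∃ F : Finset EL, ↑F ⊆ S ∧ ConnectedIn AdjL ω ↑F u v := by
  classical
  induction h with
  | refl => exact ⟨∅, by simp, refl⟩
  | tail _ h ih =>
    obtain ⟨F, hF, hc⟩ := ih
    obtain ⟨e, h1, h2, h3, h4⟩ := h
    refine ⟨insert e F, ?_, (hc.mono (by simp)).trans (step (by simp) h2 h3 h4)⟩
    rw [Finset.coe_insert]
    exact Set.insert_subset h1 hF

end ConnectedIn

theorem InfCluster.mono' {ω ω' : CL} {S S' : Set EL} {u : V} (h : InfCluster AdjL ω S u)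
    (hS : ∀ e ∈ S, ω e = true → e ∈ S' ∧ ω' e = true) : InfCluster AdjL ω' S' u :=
  Set.Infinite.mono (fun _ hv => ConnectedIn.mono' hv hS) h

theorem InfCluster.mono {ω : CL} {S S' : Set EL} {u : V} (h : InfCluster AdjL ω S u)
    (hS : S ⊆ S') : InfCluster AdjL ω S' u :=
  h.mono' fun _ he ho => ⟨hS he, ho⟩

theorem InfCluster.congr {ω ω' : CL} {S : Set EL} {u : V} (h : ∀ e ∈ S, ω e = ω' e) :
    InfCluster AdjL ω S u ↔ InfCluster AdjL ω' S u :=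
  ⟨fun hc => hc.mono' fun e he ho => ⟨he, h e he ▸ ho⟩,
    fun hc => hc.mono' fun e he ho => ⟨he, (h e he).symm ▸ ho⟩⟩

theorem InfCluster.of_conn {ω : CL} {S : Set EL} {u v : V} (h : InfCluster AdjL ω S u)
    (hc : ConnectedIn AdjL ω S u v) : InfCluster AdjL ω S v :=
  Set.Infinite.mono (fun _ hw => hc.symm.trans hw) h

namespace DualConnectedIn

variable {ω ω' : CL} {S S' : Set EL} {u v w : V}

theorem refl : DualConnectedIn ω S u u := Relation.ReflTransGen.refl

theorem trans (h : DualConnectedIn ω S u v) (h' : DualConnectedIn ω S v w) :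
    DualConnectedIn ω S u w := Relation.ReflTransGen.trans h h'

theorem _root_.FK.crossSym_symm (u v : V) : crossSym u v = crossSym v u := Sym2.eq_swap

theorem _root_.FK.DualStep.symm (h : DualStep ω S u v) : DualStep ω S v u := by
  obtain ⟨h1, h2, h3, h4, h5, h6⟩ := h
  refine ⟨h2, h1, by rw [← h3]; ring, by rw [← h4]; ring, crossSym_symm u v ▸ h5, ?_⟩
  simpa only [crossSym_symm v u] using h6

theorem symm (h : DualConnectedIn ω S u v) : DualConnectedIn ω S v u :=
  reflTransGen_symm (fun _ _ h => DualStep.symm h) h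

theorem mono' (h : DualConnectedIn ω S u v)
    (hS : ∀ e ∈ S, ω e = false → e ∈ S' ∧ ω' e = false) : DualConnectedIn ω' S' u v := by
  refine Relation.ReflTransGen.mono ?_ _ _ h
  rintro a b ⟨h1, h2, h3, h4, h5, h6, h7⟩
  exact ⟨h1, h2, h3, h4, h5, hS _ h6 h7⟩

theorem mono (h : DualConnectedIn ω S u v) (hS : S ⊆ S') : DualConnectedIn ω S' u v :=
  h.mono' fun _ he ho => ⟨hS he, ho⟩

theorem congr (h : ∀ e ∈ S, ω e = ω' e) :
    DualConnectedIn ω S u v ↔ DualConnectedIn ω' S u v :=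
  ⟨fun hc => hc.mono' fun e he ho => ⟨he, h e he ▸ ho⟩,
    fun hc => hc.mono' fun e he ho => ⟨he, (h e he).symm ▸ ho⟩⟩

theorem exists_finset (h : DualConnectedIn ω S u v) :
    ∃ F : Finset EL, ↑F ⊆ S ∧ DualConnectedIn ω ↑F u v := by
  classical
  induction h with
  | refl => exact ⟨∅, by simp, refl⟩
  | tail _ h ih =>
    obtain ⟨F, hF, hc⟩ := ih
    obtain ⟨h1, h2, h3, h4, h5, h6, h7⟩ := h
    refine ⟨insert ⟨_, h5⟩ F, ?_, (hc.mono (by simp)).trans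
      (Relation.ReflTransGen.single ⟨h1, h2, h3, h4, h5, by simp, h7⟩)⟩
    rw [Finset.coe_insert]
    exact Set.insert_subset h6 hF

end DualConnectedIn

theorem DualInfCluster.mono' {ω ω' : CL} {S S' : Set EL} {u : V} (h : DualInfCluster ω S u)
    (hS : ∀ e ∈ S, ω e = false → e ∈ S' ∧ ω' e = false) : DualInfCluster ω' S' u :=
  Set.Infinite.mono (fun _ hv => DualConnectedIn.mono' hv hS) h

theorem DualInfCluster.of_conn {ω : CL} {S : Set EL} {u v : V} (h : DualInfCluster ω S u)
    (hc : DualConnectedIn ω S u v) : DualInfCluster ω S v :=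
  Set.Infinite.mono (fun _ hw => hc.symm.trans hw) h

/-- The event `A` only depends on the edges of `S`. -/
def DepOn (S : Set EL) (A : Set CL) : Prop :=
  ∀ ω ω' : CL, (∀ e ∈ S, ω e = ω' e) → (ω ∈ A ↔ ω' ∈ A)

theorem DepOn.mono {S S' : Set EL} {A : Set CL} (h : DepOn S A) (hS : S ⊆ S') : DepOn S' A :=
  fun ω ω' hω => h ω ω' fun e he => hω e (hS he)

theorem DepOn.inter {S : Set EL} {A B : Set CL} (hA : DepOn S A) (hB : DepOn S B) :
    DepOn S (A ∩ B) :=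
  fun ω ω' hω => and_congr (hA ω ω' hω) (hB ω ω' hω)

theorem DepOn.union {S : Set EL} {A B : Set CL} (hA : DepOn S A) (hB : DepOn S B) :
    DepOn S (A ∪ B) :=
  fun ω ω' hω => or_congr (hA ω ω' hω) (hB ω ω' hω)

theorem DepOn.compl {S : Set EL} {A : Set CL} (hA : DepOn S A) : DepOn S Aᶜ :=
  fun ω ω' hω => not_congr (hA ω ω' hω)

theorem measurable_restrictD (D : Finset EL) : Measurable (restrictD AdjL D) :=
  measurable_pi_lambda _ fun e => measurable_pi_apply e.1

theorem DepOn.eq_preimage {D : Finset EL} {A : Set CL} (h : DepOn ↑D A) :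
    A = restrictD AdjL D ⁻¹' {η | extendBy AdjL D η ∈ A} := by
  ext ω
  refine h _ _ fun e he => ?_
  have he' : e ∈ D := he
  simp [extendBy, restrictD, he']

theorem DepOn.measurableSet {D : Finset EL} {A : Set CL} (h : DepOn ↑D A) : MeasurableSet A := by
  rw [h.eq_preimage]
  exact measurable_restrictD D (Set.toFinite _).measurableSet

theorem depOn_opn (F : Finset EL) : DepOn ↑F (opn F) :=
  fun _ _ h => forall₂_congr fun e he => by rw [h e he]

theorem measurableSet_opn (F : Finset EL) : MeasurableSet (opn F) := (depOn_opn F).measurableSet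

theorem depOn_connectedIn (S : Set EL) (u v : V) : DepOn S {ω | ConnectedIn AdjL ω S u v} :=
  fun _ _ h => ConnectedIn.congr h

theorem measurableSet_connectedIn (S : Set EL) (u v : V) :
    MeasurableSet {ω : CL | ConnectedIn AdjL ω S u v} := by
  have : {ω : CL | ConnectedIn AdjL ω S u v}
      = ⋃ F : Finset EL, ⋃ _ : ↑F ⊆ S, {ω : CL | ConnectedIn AdjL ω ↑F u v} := by
    ext ω
    simp only [Set.mem_iUnion]
    exact ⟨fun h => h.exists_finset.imp fun F hF => ⟨hF.1, hF.2⟩,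
      fun ⟨F, hF, h⟩ => ConnectedIn.mono h hF⟩
  rw [this]
  exact MeasurableSet.iUnion fun F => MeasurableSet.iUnion fun _ =>
    (depOn_connectedIn ↑F u v).measurableSet

theorem measurableSet_dualConnectedIn (S : Set EL) (u v : V) :
    MeasurableSet {ω : CL | DualConnectedIn ω S u v} := by
  have : {ω : CL | DualConnectedIn ω S u v}
      = ⋃ F : Finset EL, ⋃ _ : ↑F ⊆ S, {ω : CL | DualConnectedIn ω ↑F u v} := by
    ext ω
    simp only [Set.mem_iUnion]
    exact ⟨fun h => h.exists_finset.imp fun F hF => ⟨hF.1, hF.2⟩,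
      fun ⟨F, hF, h⟩ => DualConnectedIn.mono h hF⟩
  rw [this]
  refine MeasurableSet.iUnion fun F => MeasurableSet.iUnion fun _ => ?_
  exact DepOn.measurableSet (D := F) fun _ _ h => DualConnectedIn.congr h

theorem measurableSet_infinite {P : CL → V → Prop} (h : ∀ v, MeasurableSet {ω | P ω v}) :
    MeasurableSet {ω | {v | P ω v}.Infinite} := by
  have : {ω | {v | P ω v}.Infinite}
      = ⋂ T : Finset V, ⋃ v : V, ⋃ _ : v ∉ T, {ω | P ω v} := by
    ext ω
    simp only [Set.mem_iInter, Set.mem_iUnion]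
    constructor
    · intro hi T
      obtain ⟨v, hv, hT⟩ := Set.Infinite.exists_notMem_finset hi T
      exact ⟨v, hT, hv⟩
    · intro hi hf
      obtain ⟨v, hv, hv'⟩ := hi (Set.Finite.toFinset hf)
      exact hv (by simpa using hv')
  rw [this]
  exact MeasurableSet.iInter fun T => MeasurableSet.iUnion fun v => MeasurableSet.iUnion fun _ => h v

theorem measurableSet_infCluster (S : Set EL) (u : V) :
    MeasurableSet {ω : CL | InfCluster AdjL ω S u} :=
  measurableSet_infinite fun v => measurableSet_connectedIn S u v

theorem measurableSet_dualInfCluster (S : Set EL) (u : V) :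
    MeasurableSet {ω : CL | DualInfCluster ω S u} :=
  measurableSet_infinite fun v => measurableSet_dualConnectedIn S u v

/-- The relation generating the induced boundary condition. -/
def bcRel (D : Finset EL) (ω : CL) (u v : V) : Prop :=
  ConnectedIn AdjL ω {e | e ∉ D} u v ∨
    (InfCluster AdjL ω {e | e ∉ D} u ∧ InfCluster AdjL ω {e | e ∉ D} v)

theorem bcRel_equivalence (D : Finset EL) (ω : CL) : Equivalence (bcRel D ω) where
  refl _ := Or.inl ConnectedIn.refl
  symm := fun h => h.elim (fun h => Or.inl h.symm) fun h => Or.inr ⟨h.2, h.1⟩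
  trans := by
    rintro x y z (h | h) (h' | h')
    · exact Or.inl (h.trans h')
    · exact Or.inr ⟨h'.1.of_conn h.symm, h'.2⟩
    · exact Or.inr ⟨h.1, h.2.of_conn h'⟩
    · exact Or.inr ⟨h.1, h'.2⟩

theorem inducedBC_r {D : Finset EL} {ω : CL} {u v : bdry AdjL 4 D} :
    (inducedBC AdjL 4 D ω).r u v ↔ bcRel D ω u.1 v.1 := by
  have he : Equivalence fun u v : bdry AdjL 4 D => bcRel D ω u.1 v.1 :=
    ⟨fun _ => (bcRel_equivalence D ω).refl _, fun h => (bcRel_equivalence D ω).symm h,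
      fun h h' => (bcRel_equivalence D ω).trans h h'⟩
  exact he.eqvGen_iff

theorem inducedBC_congr {D : Finset EL} {ω ω' : CL} (h : ∀ e, e ∉ D → ω e = ω' e) :
    inducedBC AdjL 4 D ω = inducedBC AdjL 4 D ω' := by
  refine Setoid.ext fun u v => ?_
  refine inducedBC_r.trans (Iff.trans ?_ inducedBC_r.symm)
  exact or_congr (ConnectedIn.congr h) (and_congr (InfCluster.congr h) (InfCluster.congr h))

theorem depOn_inducedBC (D : Finset EL) (ξ : Setoid (bdry AdjL 4 D)) :
    DepOn {e | e ∉ D} {ω | inducedBC AdjL 4 D ω = ξ} := by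
  intro ω ω' h
  show _ = _ ↔ _ = _
  rw [inducedBC_congr h]

theorem measurableSet_inducedBC (D : Finset EL) (ξ : Setoid (bdry AdjL 4 D)) :
    MeasurableSet {ω : CL | inducedBC AdjL 4 D ω = ξ} := by
  have : {ω : CL | inducedBC AdjL 4 D ω = ξ}
      = ⋂ u : bdry AdjL 4 D, ⋂ v : bdry AdjL 4 D, {ω | bcRel D ω u.1 v.1 ↔ ξ.r u v} := by
    ext ω
    simp only [Set.mem_iInter]
    constructor
    · rintro rfl u v
      exact inducedBC_r.symm
    · intro h
      exact Setoid.ext fun u v => inducedBC_r.trans (h u v)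
  rw [this]
  refine MeasurableSet.iInter fun u => MeasurableSet.iInter fun v => ?_
  have hm : MeasurableSet {ω | bcRel D ω u.1 v.1} :=
    (measurableSet_connectedIn _ _ _).union
      ((measurableSet_infCluster _ _).inter (measurableSet_infCluster _ _))
  by_cases hξ : ξ.r u v
  · simpa [hξ] using hm
  · have : {ω | bcRel D ω u.1 v.1 ↔ ξ.r u v} = {ω | bcRel D ω u.1 v.1}ᶜ := by
      ext ω
      simp [hξ]
    rw [this]
    exact hm.compl

/-! ### The Gibbs property -/

theorem fkFin_apply {p q : ℝ} (hp0 : 0 < p) (hp1 : p < 1) (hq : 1 ≤ q) (D : Finset EL)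
    (ξ : Setoid (bdry AdjL 4 D)) (A : Set ({e // e ∈ D} → Bool)) :
    fkFin AdjL p q 4 D ξ A = ENNReal.ofReal (wProb (fkWeight AdjL p q 4 D ξ) A) := by
  classical
  have hpos := fkWeight_pos hp0 hp1 hq D ξ
  have hA : MeasurableSet A := (Set.toFinite A).measurableSet
  have hS : 0 < ∑ η, fkWeight AdjL p q 4 D ξ η := sum_weight_pos (fun a => (hpos a).le) (hpos ⊥)
  unfold fkFin wProb
  rw [Measure.smul_apply, Measure.finsetSum_apply, smul_eq_mul, ENNReal.ofReal_div_of_pos hS,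
    ENNReal.ofReal_sum_of_nonneg (fun a _ => (hpos a).le), mul_comm, ← div_eq_mul_inv,
    ENNReal.ofReal_sum_of_nonneg]
  · congr 1
    refine Finset.sum_congr rfl fun a _ => ?_
    rw [Measure.smul_apply, Measure.dirac_apply' _ hA, smul_eq_mul]
    by_cases ha : a ∈ A <;> simp [ha]
  · intro a _
    split_ifs
    exacts [(hpos a).le, le_rfl]

instance {X : Type*} [Finite X] : Finite (Setoid X) :=
  Finite.of_injective (fun s : Setoid X => s.r) fun s t h => Setoid.ext fun a b => by
    exact iff_of_eq (congr_fun (congr_fun h a) b)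

/-- The conditional probability of `A` given the configuration outside `D`. -/
def condP (p q : ℝ) (D : Finset EL) (A : Set CL) (ω : CL) : ℝ :=
  wProb (fkWeight AdjL p q 4 D (inducedBC AdjL 4 D ω)) {η | extendBy AdjL D η ∈ A}

theorem depOn_condP (p q : ℝ) (D : Finset EL) (A : Set CL) (T : Set ℝ) :
    DepOn {e | e ∉ D} {ω | condP p q D A ω ∈ T} := by
  intro ω ω' h
  show condP p q D A ω ∈ T ↔ condP p q D A ω' ∈ T
  unfold condP
  rw [inducedBC_congr h]

theorem measurable_condP (p q : ℝ) (D : Finset EL) (A : Set CL) : Measurable (condP p q D A) := by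
  let _ : MeasurableSpace (Setoid (bdry AdjL 4 D)) := ⊤
  have h1 : Measurable fun ω : CL => inducedBC AdjL 4 D ω :=
    measurable_to_countable' fun ξ => measurableSet_inducedBC D ξ
  exact Measurable.comp (g := fun ξ : Setoid (bdry AdjL 4 D) =>
    wProb (fkWeight AdjL p q 4 D ξ) {η | extendBy AdjL D η ∈ A}) measurable_from_top h1

section Gibbs

variable {p q : ℝ} (hp0 : 0 < p) (hp1 : p < 1) (hq : 1 ≤ q)
include hp0 hp1 hq

theorem condP_nonneg (D : Finset EL) (A : Set CL) (ω : CL) : 0 ≤ condP p q D A ω :=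
  wProb_nonneg (fun a => (fkWeight_pos hp0 hp1 hq D _ a).le) _

theorem condP_le_one (D : Finset EL) (A : Set CL) (ω : CL) : condP p q D A ω ≤ 1 :=
  wProb_le_one (fun a => (fkWeight_pos hp0 hp1 hq D _ a).le) _

theorem integrable_condP (φ : Measure CL) [IsFiniteMeasure φ] (D : Finset EL) (A : Set CL) :
    Integrable (condP p q D A) φ :=
  Integrable.of_bound (measurable_condP p q D A).aestronglyMeasurable 1 <|
    Eventually.of_forall fun ω => by
      rw [Real.norm_of_nonneg (condP_nonneg hp0 hp1 hq D A ω)]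
      exact condP_le_one hp0 hp1 hq D A ω

variable {φ : Measure CL} (hφ : IsGibbs AdjL 4 p q φ)
include hφ

theorem gibbs_bc (D : Finset EL) (ξ : Setoid (bdry AdjL 4 D)) {B : Set CL} (hB : MeasurableSet B)
    (hBD : DepOn {e | e ∉ D} B) {A : Set CL} (hA : DepOn ↑D A) :
    φ.real (A ∩ ({ω | inducedBC AdjL 4 D ω = ξ} ∩ B)) =
      φ.real ({ω | inducedBC AdjL 4 D ω = ξ} ∩ B) *
        wProb (fkWeight AdjL p q 4 D ξ) {η | extendBy AdjL D η ∈ A} := by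
  have := hφ.1
  set S := {ω | inducedBC AdjL 4 D ω = ξ} ∩ B with hS
  have hSm : MeasurableSet S := (measurableSet_inducedBC D ξ).inter hB
  by_cases h0 : φ S = 0
  · have h1 : φ.real S = 0 := by simp [Measure.real, h0]
    have h2 : φ.real (A ∩ S) = 0 := by
      have : φ (A ∩ S) = 0 := measure_mono_null Set.inter_subset_right h0
      simp [Measure.real, this]
    rw [h1, h2, zero_mul]
  · have h1 := hφ.2 D ξ B hB hBD h0
    have h2 := congr_arg (fun m => m {η | extendBy AdjL D η ∈ A}) h1
    rw [Measure.map_apply (measurable_restrictD D) (Set.toFinite _).measurableSet,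
      ← hA.eq_preimage, cond_apply hSm, fkFin_apply hp0 hp1 hq] at h2
    have h3 := congr_arg ENNReal.toReal h2
    rw [ENNReal.toReal_ofReal
      (wProb_nonneg (fun a => (fkWeight_pos hp0 hp1 hq D _ a).le) _), ENNReal.toReal_mul,
      ENNReal.toReal_inv] at h3
    rw [← h3, Set.inter_comm A S]
    have h4 : φ.real S ≠ 0 := by
      rw [Measure.real, ENNReal.toReal_ne_zero]
      exact ⟨h0, measure_ne_top _ _⟩
    simp only [Measure.real] at h4 ⊢
    field_simp

/-- Integrals decompose over the induced boundary conditions. -/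
theorem setIntegral_condP (D : Finset EL) {B : Set CL} (hB : MeasurableSet B)
    (hBD : DepOn {e | e ∉ D} B) {A : Set CL} (hA : DepOn ↑D A) :
    ∫ ω in B, condP p q D A ω ∂φ = φ.real (A ∩ B) := by
  have := hφ.1
  have := Fintype.ofFinite (Setoid (bdry AdjL 4 D))
  have hdis : Pairwise (Function.onFun Disjoint fun ξ : Setoid (bdry AdjL 4 D) =>
      {ω | inducedBC AdjL 4 D ω = ξ} ∩ B) := by
    intro ξ ξ' hne
    refine Set.disjoint_left.2 fun ω h h' => hne (h.1.symm.trans h'.1)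
  have hU : B = ⋃ ξ, {ω | inducedBC AdjL 4 D ω = ξ} ∩ B := by
    ext ω
    simp
  have hAm := hA.measurableSet
  have hU' : A ∩ B = ⋃ ξ, A ∩ ({ω | inducedBC AdjL 4 D ω = ξ} ∩ B) := by
    rw [← Set.inter_iUnion, ← hU]
  have hm : ∀ ξ, MeasurableSet ({ω | inducedBC AdjL 4 D ω = ξ} ∩ B) := fun ξ =>
    (measurableSet_inducedBC D ξ).inter hB
  rw [hU']
  conv_lhs => rw [hU]
  rw [integral_iUnion_fintype hm hdis
    fun ξ => (integrable_condP hp0 hp1 hq φ D A).integrableOn, measureReal_iUnion_fintype]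
  · refine Finset.sum_congr rfl fun ξ _ => ?_
    rw [gibbs_bc hp0 hp1 hq hφ D ξ hB hBD hA, ← smul_eq_mul, ← setIntegral_const]
    refine setIntegral_congr_fun (hm ξ) fun ω hω => ?_
    have : inducedBC AdjL 4 D ω = ξ := hω.1
    simp only [condP, this]
  · exact fun ξ ξ' hne => (hdis hne).mono Set.inter_subset_right Set.inter_subset_right
  · exact fun ξ => hAm.inter (hm ξ)

theorem integral_condP (D : Finset EL) {A : Set CL} (hA : DepOn ↑D A) :
    ∫ ω, condP p q D A ω ∂φ = φ.real A := by
  have := setIntegral_condP hp0 hp1 hq hφ D MeasurableSet.univ (fun _ _ _ => Iff.rfl) hA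
  simpa using this

/-- Comparison of probabilities under a bound on the conditional probabilities. -/
theorem measureReal_inter_le_of_condP_le (D : Finset EL) {B : Set CL} (hB : MeasurableSet B)
    (hBD : DepOn {e | e ∉ D} B) {A : Set CL} (hA : DepOn ↑D A) {c : ℝ}
    (hc : ∀ ω ∈ B, condP p q D A ω ≤ c) : φ.real (A ∩ B) ≤ c * φ.real B := by
  have := hφ.1
  rw [← setIntegral_condP hp0 hp1 hq hφ D hB hBD hA, mul_comm, ← smul_eq_mul,
    ← setIntegral_const]
  exact setIntegral_mono_on (integrable_condP hp0 hp1 hq φ D A).integrableOn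
    (integrable_const c).integrableOn hB hc

theorem le_measureReal_inter_of_le_condP (D : Finset EL) {B : Set CL} (hB : MeasurableSet B)
    (hBD : DepOn {e | e ∉ D} B) {A : Set CL} (hA : DepOn ↑D A) {c : ℝ}
    (hc : ∀ ω ∈ B, c ≤ condP p q D A ω) : c * φ.real B ≤ φ.real (A ∩ B) := by
  have := hφ.1
  rw [← setIntegral_condP hp0 hp1 hq hφ D hB hBD hA, mul_comm, ← smul_eq_mul,
    ← setIntegral_const]
  exact setIntegral_mono_on (integrable_const c).integrableOn
    (integrable_condP hp0 hp1 hq φ D A).integrableOn hB hc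

end Gibbs

/-- The configuration equal to `η` on `D` and to `ω` elsewhere. -/
def repl (D : Finset EL) (η ω : CL) : CL := fun e => by
  classical exact if e ∈ D then η e else ω e

theorem repl_of_mem {D : Finset EL} {η ω : CL} {e : EL} (h : e ∈ D) : repl D η ω e = η e := by
  simp [repl, h]

theorem repl_of_notMem {D : Finset EL} {η ω : CL} {e : EL} (h : e ∉ D) : repl D η ω e = ω e := by
  simp [repl, h]

theorem measurable_repl (D : Finset EL) (η : CL) : Measurable (repl D η) := by
  refine measurable_pi_lambda _ fun e => ?_
  by_cases h : e ∈ D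
  · simp only [repl_of_mem h]
    exact measurable_const
  · simp only [repl_of_notMem h]
    exact measurable_pi_apply e

/-- Finite energy: almost sure properties are stable under finite modifications. -/
theorem ae_repl {p q : ℝ} (hp0 : 0 < p) (hp1 : p < 1) (hq : 1 ≤ q) {φ : Measure CL}
    (hφ : IsGibbs AdjL 4 p q φ) {P : CL → Prop} (hP : ∀ᵐ ω ∂φ, P ω) (D : Finset EL) (η : CL) :
    ∀ᵐ ω ∂φ, P (repl D η ω) := by
  have := hφ.1
  set A := toMeasurable φ {ω | ¬ P ω} with hA
  have hA0 : φ A = 0 := by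
    rw [hA, measure_toMeasurable]
    exact hP
  have hAm : MeasurableSet A := measurableSet_toMeasurable _ _
  set B := repl D η ⁻¹' A with hB
  have hBm : MeasurableSet B := measurable_repl D η hAm
  have hBD : DepOn {e | e ∉ D} B := by
    intro ω ω' h
    have : repl D η ω = repl D η ω' := by
      funext e
      by_cases he : e ∈ D
      · simp [repl_of_mem he]
      · simp [repl_of_notMem he, h e he]
    simp only [hB, Set.mem_preimage, this]
  set E : Set CL := {ω | ∀ e ∈ D, ω e = η e} with hE
  have hED : DepOn ↑D E := fun ω ω' h => forall₂_congr fun e he => by rw [h e he]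
  have hsub : E ∩ B ⊆ A := by
    rintro ω ⟨h1, h2⟩
    have : repl D η ω = ω := by
      funext e
      by_cases he : e ∈ D
      · simp [repl_of_mem he, h1 e he]
      · simp [repl_of_notMem he]
    simpa only [hB, Set.mem_preimage, this] using h2
  have h0 : φ (E ∩ B) = 0 := measure_mono_null hsub hA0
  have key : φ B = 0 := by
    have hBU : B ⊆ ⋃ ξ, {ω | inducedBC AdjL 4 D ω = ξ} ∩ B := fun ω h => by simpa using h
    refine measure_mono_null hBU (measure_iUnion_null fun ξ => ?_)
    have h1 := gibbs_bc hp0 hp1 hq hφ D ξ hBm hBD hED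
    have h2 : φ.real (E ∩ ({ω | inducedBC AdjL 4 D ω = ξ} ∩ B)) = 0 := by
      have : φ (E ∩ ({ω | inducedBC AdjL 4 D ω = ξ} ∩ B)) = 0 :=
        measure_mono_null (Set.inter_subset_inter_right _ Set.inter_subset_right) h0
      simp [Measure.real, this]
    have h3 : 0 < wProb (fkWeight AdjL p q 4 D ξ) {η' | extendBy AdjL D η' ∈ E} := by
      classical
      unfold wProb
      refine div_pos (Finset.sum_pos' (fun a _ => ?_) ⟨restrictD AdjL D η, Finset.mem_univ _, ?_⟩)
        (sum_weight_pos (fun a => (fkWeight_pos hp0 hp1 hq D ξ a).le)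
          (fkWeight_pos hp0 hp1 hq D ξ ⊥))
      · split_ifs
        exacts [(fkWeight_pos hp0 hp1 hq D ξ a).le, le_rfl]
      · have : restrictD AdjL D η ∈ {η' | extendBy AdjL D η' ∈ E} := by
          intro e he
          simp [extendBy, restrictD, he]
        rw [if_pos this]
        exact fkWeight_pos hp0 hp1 hq D ξ _
    rw [h2] at h1
    have h4 : φ.real ({ω | inducedBC AdjL 4 D ω = ξ} ∩ B) = 0 :=
      (mul_eq_zero.1 h1.symm).resolve_right h3.ne'
    exact (measureReal_eq_zero_iff).1 h4
  refine measure_mono_null (fun ω hω => ?_) key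
  exact subset_toMeasurable _ _ hω

/-! ### Consequences of tail triviality -/

theorem mem_boxE_mkE {u v : V} (h : AdjL u v) (n : ℤ) :
    mkE u v h ∈ boxE n ↔ (|u.1| ≤ n ∧ |u.2| ≤ n) ∧ |v.1| ≤ n ∧ |v.2| ≤ n := by
  have hr : ∀ w : V, w ∈ rectV (-n) n (-n) n ↔ |w.1| ≤ n ∧ |w.2| ≤ n := fun w => by
    simp [rectV, abs_le]
  unfold boxE finEdgesIn
  simp only [Finset.mem_subtype, Finset.mem_image, Finset.mem_filter, Finset.mem_product, hr,
    mkE, Prod.exists]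
  constructor
  · rintro ⟨a, b, c, d, ⟨⟨h1, h2⟩, h3⟩, h4⟩
    rcases Sym2.eq_iff.1 h4 with ⟨rfl, rfl⟩ | ⟨rfl, rfl⟩
    exacts [⟨h1, h2⟩, ⟨h2, h1⟩]
  · rintro ⟨h1, h2⟩
    exact ⟨u.1, u.2, v.1, v.2, ⟨⟨h1, h2⟩, h⟩, rfl⟩

theorem mem_boxE {e : EL} {n : ℤ} :
    e ∈ boxE n ↔ ∀ v, Inc AdjL v e → |v.1| ≤ n ∧ |v.2| ≤ n := by
  obtain ⟨u, v, h, rfl⟩ := exists_eq_mkE e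
  rw [mem_boxE_mkE]
  refine ⟨fun h' w hw => ?_, fun h' => ⟨h' u (inc_left h), h' v (inc_right h)⟩⟩
  rcases (inc_mkE h).1 hw with rfl | rfl
  exacts [h'.1, h'.2]

theorem boxE_mono {m n : ℤ} (h : m ≤ n) : boxE m ⊆ boxE n := fun _ he =>
  mem_boxE.2 fun v hv => ⟨(mem_boxE.1 he v hv).1.trans h, (mem_boxE.1 he v hv).2.trans h⟩

theorem exists_mem_boxE (e : EL) : ∃ n : ℕ, e ∈ boxE n := by
  obtain ⟨u, v, h, rfl⟩ := exists_eq_mkE e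
  refine ⟨(|u.1| + |u.2| + |v.1| + |v.2|).toNat, ?_⟩
  have := abs_nonneg u.1
  have := abs_nonneg u.2
  have := abs_nonneg v.1
  have := abs_nonneg v.2
  rw [mem_boxE_mkE]
  omega

theorem exists_subset_boxE (F : Finset EL) : ∃ n : ℕ, F ⊆ boxE n := by
  classical
  induction F using Finset.induction_on with
  | empty => exact ⟨0, by simp⟩
  | insert e F _ ih =>
    obtain ⟨n, hn⟩ := ih
    obtain ⟨m, hm⟩ := exists_mem_boxE e
    exact ⟨max n m, Finset.insert_subset (boxE_mono (by simp) hm) (hn.trans (boxE_mono (by simp)))⟩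

theorem abs_le_of_sq {x t : ℝ} (ht : 0 < t) : |x| ≤ (t + x ^ 2 / t) / 2 := by
  have h : 0 ≤ (|x| - t) ^ 2 / t := div_nonneg (sq_nonneg _) ht.le
  have e : (|x| - t) ^ 2 / t = x ^ 2 / t - 2 * |x| + t := by
    rw [sub_sq, sq_abs]
    field_simp
  linarith

/-- Reverse martingale convergence to a constant, in the form needed below. -/
theorem exists_integral_abs_sub_le {Ω : Type*} [MeasurableSpace Ω] {μ : Measure Ω}
    [IsProbabilityMeasure μ] {X : ℕ → Ω → ℝ} (hXm : ∀ n, Measurable (X n))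
    (h0 : ∀ n ω, 0 ≤ X n ω) (h1 : ∀ n ω, X n ω ≤ 1) {a : ℝ} (ha : ∀ n, ∫ ω, X n ω ∂μ = a)
    (hX : ∀ n m, n ≤ m → ∫ ω, X n ω * X m ω ∂μ = ∫ ω, X m ω * X m ω ∂μ)
    (hconst : ∀ k : ℕ → ℕ, StrictMono k → ∃ c : ℝ,
      (fun ω => limsup (fun i => X (k i) ω) atTop) =ᵐ[μ] fun _ => c)
    {ε : ℝ} (hε : 0 < ε) : ∃ n, ∫ ω, |X n ω - a| ∂μ ≤ ε := by
  have hint : ∀ n, Integrable (X n) μ := fun n =>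
    Integrable.of_bound (hXm n).aestronglyMeasurable 1 <|
      Eventually.of_forall fun ω => by rw [Real.norm_of_nonneg (h0 n ω)]; exact h1 n ω
  have hint2 : ∀ n m, Integrable (fun ω => X n ω * X m ω) μ := fun n m =>
    Integrable.of_bound ((hXm n).mul (hXm m)).aestronglyMeasurable 1 <|
      Eventually.of_forall fun ω => by
        rw [Real.norm_of_nonneg (mul_nonneg (h0 n ω) (h0 m ω))]
        exact mul_le_one₀ (h1 n ω) (h0 m ω) (h1 m ω)
  set s : ℕ → ℝ := fun n => ∫ ω, X n ω * X n ω ∂μ with hs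
  have hsq : ∀ n m, n ≤ m → ∫ ω, (X n ω - X m ω) ^ 2 ∂μ = s n - s m := by
    intro n m hnm
    have e : (fun ω => (X n ω - X m ω) ^ 2)
        = fun ω => (X n ω * X n ω - X n ω * X m ω) - (X n ω * X m ω - X m ω * X m ω) := by
      funext ω
      ring
    have i1 : Integrable (fun ω => X n ω * X n ω - X n ω * X m ω) μ := (hint2 n n).sub (hint2 n m)
    have i2 : Integrable (fun ω => X n ω * X m ω - X m ω * X m ω) μ := (hint2 n m).sub (hint2 m m)
    rw [e, integral_sub i1 i2, integral_sub (hint2 n n) (hint2 n m), integral_sub (hint2 n m) (hint2 m m), hX n m hnm]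
    simp [hs]
  have hanti : Antitone s := fun n m hnm => by
    have : 0 ≤ ∫ ω, (X n ω - X m ω) ^ 2 ∂μ := integral_nonneg fun ω => sq_nonneg _
    rw [hsq n m hnm] at this
    linarith
  have hs0 : ∀ n, 0 ≤ s n := fun n => integral_nonneg fun ω => mul_self_nonneg _
  have hbdd : BddBelow (Set.range s) := ⟨0, by rintro _ ⟨n, rfl⟩; exact hs0 n⟩
  have hlim := tendsto_atTop_ciInf hanti hbdd
  set v := ⨅ n, s n with hv
  have hvle : ∀ n, v ≤ s n := fun n => ciInf_le hbdd n
  have hδ : ∀ i : ℕ, ∃ N, ∀ n ≥ N, s n < v + (1 / 4) ^ i := fun i =>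
    eventually_atTop.1 (hlim.eventually (gt_mem_nhds (by
      have : (0 : ℝ) < (1 / 4) ^ i := by positivity
      linarith)))
  choose N hN using hδ
  obtain ⟨k, hk, hkN⟩ := Filter.extraction_forall_of_eventually
    (P := fun i n => ∀ m ≥ n, s m < v + (1 / 4) ^ i)
    (fun i => eventually_atTop.2 ⟨N i, fun n hn m hm => hN i m (le_trans hn hm)⟩)
  have hL1 : ∀ i n m, k i ≤ n → k i ≤ m → ∫ ω, |X n ω - X m ω| ∂μ ≤ (1 / 2) ^ i := by
    have main : ∀ i n m, k i ≤ n → n ≤ m → ∫ ω, |X n ω - X m ω| ∂μ ≤ (1 / 2) ^ i := by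
      intro i n m hn hnm
      have ht : (0 : ℝ) < (1 / 2) ^ i := by positivity
      have hi2 : Integrable (fun ω => (X n ω - X m ω) ^ 2) μ := by
        have e : (fun ω => (X n ω - X m ω) ^ 2)
            = fun ω => (X n ω * X n ω - X n ω * X m ω) - (X n ω * X m ω - X m ω * X m ω) := by
          funext ω
          ring
        rw [e]
        exact ((hint2 n n).sub (hint2 n m)).sub ((hint2 n m).sub (hint2 m m))
      have hle : ∫ ω, |X n ω - X m ω| ∂μ
          ≤ ∫ ω, ((1 / 2) ^ i + (X n ω - X m ω) ^ 2 / (1 / 2) ^ i) / 2 ∂μ :=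
        integral_mono ((hint n).sub (hint m)).abs
          (((integrable_const _).add (hi2.div_const _)).div_const 2)
          fun ω => abs_le_of_sq ht
      have i3 : Integrable (fun ω => (X n ω - X m ω) ^ 2 / (1 / 2) ^ i) μ := hi2.div_const _
      rw [integral_div, integral_add (integrable_const _) i3, integral_div,
        hsq n m hnm] at hle
      have h3 : s n - s m ≤ (1 / 4) ^ i := by
        have := hkN i n hn
        have := hvle m
        linarith
      have h4 : (s n - s m) / (1 / 2) ^ i ≤ (1 / 2) ^ i := by
        rw [div_le_iff₀ ht, ← mul_pow]
        norm_num at h3 ⊢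
        exact h3
      simp only [integral_const, probReal_univ, smul_eq_mul, one_mul] at hle
      linarith
    intro i n m hn hm
    rcases le_total n m with h | h
    · exact main i n m hn h
    · have := main i m n hm h
      simpa only [abs_sub_comm] using this
  have hae : ∀ᵐ ω ∂μ, ∃ l : ℝ, Tendsto (fun i => X (k i) ω) atTop (nhds l) := by
    refine Lp.ae_tendsto_of_cauchy_eLpNorm (p := 1) (f := fun i => X (k i))
      (B := fun i => ENNReal.ofReal (2 * (1 / 2) ^ i)) (fun i => (hXm _).aestronglyMeasurable)
      le_rfl ?_ ?_
    · rw [← ENNReal.ofReal_tsum_of_nonneg (fun i => by positivity)]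
      · exact ENNReal.ofReal_ne_top
      · exact (summable_geometric_of_lt_one (by norm_num) (by norm_num)).mul_left 2
    · intro i n m hn hm
      rw [eLpNorm_one_eq_lintegral_enorm,
        ← ofReal_integral_norm_eq_lintegral_enorm ((hint _).sub (hint _))]
      refine (ENNReal.ofReal_lt_ofReal_iff (by positivity)).2 ?_
      have := hL1 i (k n) (k m) (hk.monotone hn) (hk.monotone hm)
      have ht : (0 : ℝ) < (1 / 2) ^ i := by positivity
      simp only [Pi.sub_apply, Real.norm_eq_abs]
      linarith
  obtain ⟨c, hc⟩ := hconst k hk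
  have hlimc : ∀ᵐ ω ∂μ, Tendsto (fun i => X (k i) ω) atTop (nhds c) := by
    filter_upwards [hae, hc] with ω ⟨l, hl⟩ hω
    rw [← hω, hl.limsup_eq]
    exact hl
  have hca : c = a := by
    have h2 : Tendsto (fun i => ∫ ω, X (k i) ω ∂μ) atTop (nhds (∫ _, c ∂μ)) :=
      tendsto_integral_of_dominated_convergence (fun _ => 1)
        (fun i => (hXm _).aestronglyMeasurable) (integrable_const _)
        (fun i => Eventually.of_forall fun ω => by
          rw [Real.norm_of_nonneg (h0 _ ω)]; exact h1 _ ω) hlimc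
    simp only [ha, integral_const, probReal_univ, smul_eq_mul, one_mul] at h2
    exact tendsto_nhds_unique h2 tendsto_const_nhds
  subst hca
  have h2 : Tendsto (fun i => ∫ ω, |X (k i) ω - c| ∂μ) atTop (nhds (∫ _ : Ω, (0 : ℝ) ∂μ)) := by
    refine tendsto_integral_of_dominated_convergence (fun _ => 1 + |c|)
      (fun i => ((hXm _).sub_const c).abs.aestronglyMeasurable) (integrable_const _)
      (fun i => Eventually.of_forall fun ω => ?_) ?_
    · rw [Real.norm_eq_abs, abs_abs]
      refine (abs_sub _ _).trans ?_
      rw [abs_of_nonneg (h0 _ ω)]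
      linarith [h1 (k i) ω]
    · filter_upwards [hlimc] with ω hω
      have := (hω.sub_const c).abs
      simpa using this
  rw [integral_zero] at h2
  obtain ⟨i, hi⟩ := (h2.eventually (gt_mem_nhds hε)).exists
  exact ⟨k i, hi.le⟩

section TailTrivial

variable {p q : ℝ} (hp0 : 0 < p) (hp1 : p < 1) (hq : 1 ≤ q) {φ : Measure CL}
  (hφ : IsGibbs AdjL 4 p q φ)

include hp0 hp1 hq hφ

theorem integral_condP_mul_condP {D D' : Finset EL} (hD : D ⊆ D') {A : Set CL} (hA : DepOn ↑D A) :
    ∫ ω, condP p q D A ω * condP p q D' A ω ∂φ = ∫ ω, condP p q D' A ω * condP p q D' A ω ∂φ := by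
  have := hφ.1
  have := Fintype.ofFinite (Setoid (bdry AdjL 4 D'))
  have hdis : Pairwise (Function.onFun Disjoint fun ξ : Setoid (bdry AdjL 4 D') =>
      {ω | inducedBC AdjL 4 D' ω = ξ}) := by
    intro ξ ξ' hne
    exact Set.disjoint_left.2 fun ω h h' => hne (Eq.trans (Eq.symm h) h')
  have hU : Set.univ = ⋃ ξ, {ω : CL | inducedBC AdjL 4 D' ω = ξ} := by
    ext ω
    simp
  have key : ∀ D₀ : Finset EL, DepOn ↑D₀ A → D₀ ⊆ D' →
      ∫ ω, condP p q D₀ A ω * condP p q D' A ω ∂φ = ∑ ξ : Setoid (bdry AdjL 4 D'),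
        φ.real (A ∩ {ω | inducedBC AdjL 4 D' ω = ξ}) *
          wProb (fkWeight AdjL p q 4 D' ξ) {η | extendBy AdjL D' η ∈ A} := by
    intro D₀ h1 h2
    have hi : Integrable (fun ω => condP p q D₀ A ω * condP p q D' A ω) φ :=
      Integrable.of_bound
        ((measurable_condP p q D₀ A).mul (measurable_condP p q D' A)).aestronglyMeasurable 1 <|
        Eventually.of_forall fun ω => by
          rw [Real.norm_of_nonneg (mul_nonneg (condP_nonneg hp0 hp1 hq _ _ ω)
            (condP_nonneg hp0 hp1 hq _ _ ω))]
          exact mul_le_one₀ (condP_le_one hp0 hp1 hq _ _ ω) (condP_nonneg hp0 hp1 hq _ _ ω)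
            (condP_le_one hp0 hp1 hq _ _ ω)
    rw [← setIntegral_univ, hU, integral_iUnion_fintype (fun ξ => measurableSet_inducedBC D' ξ)
      hdis fun ξ => hi.integrableOn]
    refine Finset.sum_congr rfl fun ξ _ => ?_
    rw [← setIntegral_condP hp0 hp1 hq hφ D₀ (measurableSet_inducedBC D' ξ)
      ((depOn_inducedBC D' ξ).mono fun e he h => he (h2 h)) h1, ← integral_mul_const]
    refine setIntegral_congr_fun (measurableSet_inducedBC D' ξ) fun ω hω => ?_
    have : inducedBC AdjL 4 D' ω = ξ := hω
    simp only [condP, this]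
  rw [key D hA hD, key D' (hA.mono hD) subset_rfl]

variable (htail : TailTrivial AdjL φ)
include htail

theorem exists_integral_condP_sub_le {D : Finset EL} {A : Set CL} (hA : DepOn ↑D A) {ε : ℝ}
    (hε : 0 < ε) (D₁ : Finset EL) :
    ∃ D', D ⊆ D' ∧ D₁ ⊆ D' ∧ ∫ ω, |condP p q D' A ω - φ.real A| ∂φ ≤ ε := by
  classical
  have := hφ.1
  obtain ⟨n₀, hn₀⟩ := exists_subset_boxE (D ∪ D₁)
  have hmono : ∀ n m : ℕ, n ≤ m → boxE ((n₀ + n : ℕ) : ℤ) ⊆ boxE ((n₀ + m : ℕ) : ℤ) :=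
    fun n m h => boxE_mono (by omega)
  have hsub : ∀ n : ℕ, D ∪ D₁ ⊆ boxE ((n₀ + n : ℕ) : ℤ) := fun n =>
    hn₀.trans (boxE_mono (by omega))
  have hA' : ∀ n : ℕ, DepOn ↑(boxE ((n₀ + n : ℕ) : ℤ)) A := fun n =>
    hA.mono (Finset.coe_subset.2 (Finset.subset_union_left.trans (hsub n)))
  obtain ⟨n, hn⟩ := exists_integral_abs_sub_le (μ := φ)
    (X := fun n : ℕ => condP p q (boxE ((n₀ + n : ℕ) : ℤ)) A) (fun n => measurable_condP _ _ _ _)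
    (fun n ω => condP_nonneg hp0 hp1 hq _ _ _) (fun n ω => condP_le_one hp0 hp1 hq _ _ _)
    (fun n => integral_condP hp0 hp1 hq hφ _ (hA' n))
    (fun n m h => integral_condP_mul_condP hp0 hp1 hq hφ (hmono n m h) (hA' n))
    (fun k hk => by
      have hm : Measurable fun ω : CL =>
          limsup (fun i => condP p q (boxE ((n₀ + k i : ℕ) : ℤ)) A ω) atTop :=
        Measurable.limsup fun i => measurable_condP _ _ _ _
      obtain ⟨c, hc⟩ := exists_eventuallyEq_const_of_forall_separating (l := ae φ)
        (f := fun ω : CL => limsup (fun i => condP p q (boxE ((n₀ + k i : ℕ) : ℤ)) A ω) atTop)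
        MeasurableSet fun U hU => by
          have := htail _ (hm hU) fun F ω ω' h => by
            have : limsup (fun i => condP p q (boxE ((n₀ + k i : ℕ) : ℤ)) A ω) atTop
                = limsup (fun i => condP p q (boxE ((n₀ + k i : ℕ) : ℤ)) A ω') atTop := by
              obtain ⟨m, hm⟩ := exists_subset_boxE F
              refine limsup_congr (eventually_atTop.2 ⟨m, fun i hi => ?_⟩)
              have h1 := hk.le_apply (x := i)
              have := depOn_condP p q (boxE ((n₀ + k i : ℕ) : ℤ)) A
                {condP p q (boxE ((n₀ + k i : ℕ) : ℤ)) A ω'} ω ω' fun e he =>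
                  h e fun he' => he (boxE_mono (by omega) (hm he'))
              exact this.2 rfl
            exact iff_of_eq (congrArg (· ∈ U) this)
          rcases this with h | h
          · right
            exact measure_eq_zero_iff_ae_notMem.1 h
          · left
            exact (prob_compl_eq_zero_iff (hm hU)).2 h
      exact ⟨c, hc⟩) hε
  exact ⟨_, Finset.subset_union_left.trans (hsub n), Finset.subset_union_right.trans (hsub n), hn⟩

theorem exists_mixing {D : Finset EL} {A : Set CL} (hA : DepOn ↑D A) {ε : ℝ} (hε : 0 < ε) :
    ∃ D' : Finset EL, ∀ B : Set CL, MeasurableSet B → DepOn {e | e ∉ D'} B →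
      |φ.real (A ∩ B) - φ.real A * φ.real B| ≤ ε := by
  have := hφ.1
  obtain ⟨D', h1, -, h2⟩ := exists_integral_condP_sub_le hp0 hp1 hq hφ htail hA hε ∅
  refine ⟨D', fun B hB hBD => ?_⟩
  have hi := integrable_condP hp0 hp1 hq φ D' A
  have hi' : Integrable (fun ω => condP p q D' A ω - φ.real A) φ := hi.sub (integrable_const _)
  have e : φ.real (A ∩ B) - φ.real A * φ.real B = ∫ ω in B, (condP p q D' A ω - φ.real A) ∂φ := by
    rw [integral_sub hi.integrableOn (integrable_const _).integrableOn,
      setIntegral_condP hp0 hp1 hq hφ D' hB hBD (hA.mono (Finset.coe_subset.2 h1)),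
      setIntegral_const, smul_eq_mul, mul_comm]
  rw [e]
  refine (abs_integral_le_integral_abs).trans (le_trans ?_ h2)
  exact setIntegral_le_integral hi'.abs (Eventually.of_forall fun ω => abs_nonneg _)

/-- Positive association of local increasing events. -/
theorem mul_le_measureReal_inter {D D₁ : Finset EL} {A B : Set CL} (hA : DepOn ↑D A)
    (hB : DepOn ↑D₁ B) (hAu : IsUpperSet A) (hBu : IsUpperSet B) :
    φ.real A * φ.real B ≤ φ.real (A ∩ B) := by
  have := hφ.1
  refine le_of_forall_pos_le_add fun ε hε => ?_
  obtain ⟨D', h1, h2, h3⟩ := exists_integral_condP_sub_le hp0 hp1 hq hφ htail hA hε D₁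
  have hA' := hA.mono (Finset.coe_subset.2 h1)
  have hB' := hB.mono (Finset.coe_subset.2 h2)
  have hup : ∀ {S : Set CL}, IsUpperSet S → IsUpperSet {η | extendBy AdjL D' η ∈ S} := by
    intro S hS η η' hη h
    refine hS ?_ h
    intro e
    unfold extendBy
    split_ifs with he
    exacts [hη _, le_rfl]
  have hiA := integrable_condP hp0 hp1 hq φ D' A
  have hiB := integrable_condP hp0 hp1 hq φ D' B
  have hd : Integrable (fun ω => |condP p q D' A ω - φ.real A|) φ :=
    (hiA.sub (integrable_const _)).abs
  have hi : Integrable (fun ω => condP p q D' (A ∩ B) ω + |condP p q D' A ω - φ.real A|) φ :=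
    (integrable_condP hp0 hp1 hq φ D' (A ∩ B)).add hd
  have : ∫ ω, φ.real A * condP p q D' B ω ∂φ
      ≤ ∫ ω, (condP p q D' (A ∩ B) ω + |condP p q D' A ω - φ.real A|) ∂φ := by
    refine integral_mono (hiB.const_mul _) hi fun ω => ?_
    have h4 : condP p q D' A ω * condP p q D' B ω ≤ condP p q D' (A ∩ B) ω :=
      wProb_fkWeight_fkg hp0 hp1 hq D' _ (hup hAu) (hup hBu)
    have h5 := condP_nonneg hp0 hp1 hq D' B ω
    have h6 := condP_le_one hp0 hp1 hq D' B ω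
    have h7 := neg_le_abs (condP p q D' A ω - φ.real A)
    have h8 := abs_nonneg (condP p q D' A ω - φ.real A)
    show φ.real A * condP p q D' B ω ≤ condP p q D' (A ∩ B) ω + |condP p q D' A ω - φ.real A|
    nlinarith
  rw [integral_const_mul, integral_condP hp0 hp1 hq hφ D' hB',
    integral_add (integrable_condP hp0 hp1 hq φ D' (A ∩ B)) hd,
    integral_condP hp0 hp1 hq hφ D' (hA'.inter hB')] at this
  linarith

omit hp0 hp1 hq hφ htail in
theorem exists_local_approx [IsFiniteMeasure φ] {S : Set CL} (hS : MeasurableSet S) {ε : ℝ}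
    (hε : 0 < ε) : ∃ (D : Finset EL) (A : Set CL), DepOn ↑D A ∧ φ.real (symmDiff S A) < ε := by
  classical
  have h𝒜 : IsSetAlgebra {A : Set CL | ∃ D : Finset EL, DepOn ↑D A} := by
    refine ⟨⟨∅, fun _ _ _ => Iff.rfl⟩, fun A ⟨D, h⟩ => ⟨D, h.compl⟩, ?_⟩
    rintro A B ⟨D, h⟩ ⟨D', h'⟩
    exact ⟨D ∪ D', (h.mono (by simp)).union (h'.mono (by simp))⟩
  have hgen : (inferInstance : MeasurableSpace CL)
      = MeasurableSpace.generateFrom {A : Set CL | ∃ D : Finset EL, DepOn ↑D A} := by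
    refine le_antisymm ?_ (MeasurableSpace.generateFrom_le fun A ⟨D, h⟩ => h.measurableSet)
    refine iSup_le fun e => ?_
    rintro _ ⟨T, -, rfl⟩
    refine MeasurableSpace.measurableSet_generateFrom ⟨{e}, fun ω ω' h => ?_⟩
    show ω e ∈ T ↔ ω' e ∈ T
    rw [h e (by simp)]
  obtain ⟨A, ⟨D, hA⟩, h⟩ :=
    (Measure.MeasureDense.of_generateFrom_isSetAlgebra_finite φ h𝒜 hgen).approx S hS
      (measure_ne_top _ _) ε hε
  refine ⟨D, A, hA, ?_⟩
  have := ENNReal.toReal_lt_of_lt_ofReal h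
  exact this

omit hp0 hp1 hq hφ htail in
theorem abs_measureReal_sub_le_symmDiff [IsFiniteMeasure φ] (S A : Set CL) :
    |φ.real S - φ.real A| ≤ φ.real (symmDiff S A) := by
  have h1 : φ.real S ≤ φ.real A + φ.real (symmDiff S A) :=
    (measureReal_mono fun x hx => by
      by_cases h : x ∈ A
      exacts [Or.inl h, Or.inr (Or.inl ⟨hx, h⟩)]).trans (measureReal_union_le _ _)
  have h2 : φ.real A ≤ φ.real S + φ.real (symmDiff S A) :=
    (measureReal_mono fun x hx => by
      by_cases h : x ∈ S
      exacts [Or.inl h, Or.inr (Or.inr ⟨hx, h⟩)]).trans (measureReal_union_le _ _)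
  rw [abs_le]
  constructor <;> linarith

/-- Zero-one law for events invariant under transformations that move finite sets far away. -/
theorem zero_or_one_of_invariant {S : Set CL} (hS : MeasurableSet S)
    (h : ∀ D D' : Finset EL, ∃ T : CL → CL, MeasurePreserving T φ φ ∧ T ⁻¹' S = S ∧
      ∀ E, DepOn ↑D E → DepOn {e | e ∉ D'} (T ⁻¹' E)) : φ.real S = 0 ∨ φ.real S = 1 := by
  have := hφ.1
  have h0 : φ.real S - φ.real S * φ.real S = 0 := by
    refine abs_eq_zero.1 (le_antisymm (le_of_forall_pos_le_add fun ε hε => ?_) (abs_nonneg _))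
    have hδ : 0 < ε / 5 := by positivity
    obtain ⟨D, A, hA, hSA⟩ := exists_local_approx (φ := φ) hS hδ
    obtain ⟨D', hD'⟩ := exists_mixing hp0 hp1 hq hφ htail hA hδ
    obtain ⟨T, hT, hTS, hTD⟩ := h D D'
    have hAm := hA.measurableSet
    have hBm : MeasurableSet (T ⁻¹' A) := hT.measurable hAm
    have h1 := hD' _ hBm (hTD A hA)
    have h2 := (abs_measureReal_sub_le_symmDiff (φ := φ) S A).trans hSA.le
    have hSB : φ.real (symmDiff S (T ⁻¹' A)) < ε / 5 := by
      have e : symmDiff S (T ⁻¹' A) = T ⁻¹' (symmDiff S A) := by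
        rw [Set.preimage_symmDiff, hTS]
      rw [e, measureReal_def, hT.measure_preimage (hS.symmDiff hAm).nullMeasurableSet]
      exact hSA
    have h3 := abs_measureReal_sub_le_symmDiff (φ := φ) S (A ∩ T ⁻¹' A)
    have h4 : φ.real (symmDiff S (A ∩ T ⁻¹' A))
        ≤ φ.real (symmDiff S A) + φ.real (symmDiff S (T ⁻¹' A)) := by
      refine (measureReal_mono ?_).trans (measureReal_union_le _ _)
      rintro x (⟨hx, hx'⟩ | ⟨⟨hx, hx''⟩, hx'⟩)
      · by_cases h : x ∈ A
        · exact Or.inr (Or.inl ⟨hx, fun h' => hx' ⟨h, h'⟩⟩)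
        · exact Or.inl (Or.inl ⟨hx, h⟩)
      · exact Or.inl (Or.inr ⟨hx, hx'⟩)
    have hB : φ.real (T ⁻¹' A) = φ.real A := by
      rw [measureReal_def, hT.measure_preimage hAm.nullMeasurableSet, measureReal_def]
    rw [hB] at h1
    have b1 : 0 ≤ φ.real S := measureReal_nonneg
    have b2 : φ.real S ≤ 1 := measureReal_le_one
    have b3 : 0 ≤ φ.real A := measureReal_nonneg
    have b4 : φ.real A ≤ 1 := measureReal_le_one
    have h5 : |φ.real A * φ.real A - φ.real S * φ.real S| ≤ 2 * (ε / 5) := by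
      have e : φ.real A * φ.real A - φ.real S * φ.real S
          = -((φ.real S - φ.real A) * (φ.real S + φ.real A)) := by ring
      rw [e, abs_neg, abs_mul, mul_comm]
      refine mul_le_mul ?_ h2 (abs_nonneg _) (by norm_num)
      rw [abs_of_nonneg (by linarith)]
      linarith
    rw [abs_le] at h1 h3 h5 ⊢
    constructor <;> linarith [h1.1, h1.2, h3.1, h3.2, h5.1, h5.2]
  have : φ.real S * (1 - φ.real S) = 0 := by linarith
  rcases mul_eq_zero.1 this with h | h
  · exact Or.inl h
  · exact Or.inr (by linarith)

end TailTrivial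

/-! ### Removing finite sets of edges; trifurcations -/

theorem ConnectedIn.or_hit {ω : CL} {S : Set EL} {a c : V} (h : ConnectedIn AdjL ω S a c)
    (D : Finset EL) : ConnectedIn AdjL ω {e | e ∈ S ∧ e ∉ D} a c ∨
      ∃ y ∈ vertexSet AdjL D, ConnectedIn AdjL ω {e | e ∈ S ∧ e ∉ D} a y := by
  induction h with
  | refl => exact Or.inl .refl
  | @tail b c _ h ih =>
    obtain ⟨e, h1, h2, h3, h4⟩ := h
    rcases ih with ih | ih
    · by_cases he : e ∈ D
      · exact Or.inr ⟨b, ⟨e, he, h3⟩, ih⟩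
      · exact Or.inl (ih.trans (.step (e := e) ⟨h1, he⟩ h2 h3 h4))
    · exact Or.inr ih

theorem ConnectedIn.exists_hit {ω : CL} {S : Set EL} {a c : V} (h : ConnectedIn AdjL ω S a c)
    {D : Finset EL} (hc : c ∈ vertexSet AdjL D) :
    ∃ y ∈ vertexSet AdjL D, ConnectedIn AdjL ω {e | e ∈ S ∧ e ∉ D} a y := by
  rcases h.or_hit D with h | h
  exacts [⟨c, hc, h⟩, h]

theorem ConnectedIn.avoid {ω : CL} {S : Set EL} {a c : V} (h : ConnectedIn AdjL ω S a c)
    {D : Finset EL} (hD : ∀ y ∈ vertexSet AdjL D, ¬ ConnectedIn AdjL ω S a y) :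
    ConnectedIn AdjL ω {e | e ∈ S ∧ e ∉ D} a c := by
  rcases h.or_hit D with h | ⟨y, hy, h⟩
  · exact h
  · exact absurd (h.mono fun e he => he.1) (hD y hy)

theorem InfCluster.avoid {ω : CL} {S : Set EL} {a : V} (h : InfCluster AdjL ω S a)
    {D : Finset EL} (hD : ∀ y ∈ vertexSet AdjL D, ¬ ConnectedIn AdjL ω S a y) :
    InfCluster AdjL ω {e | e ∈ S ∧ e ∉ D} a :=
  Set.Infinite.mono (fun _ hc => ConnectedIn.avoid hc hD) h

theorem InfCluster.exists_remove {ω : CL} {S : Set EL} {u : V} (h : InfCluster AdjL ω S u)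
    (D : Finset EL) : ∃ y, (y = u ∨ y ∈ vertexSet AdjL D) ∧ ConnectedIn AdjL ω S u y ∧
      InfCluster AdjL ω {e | e ∈ S ∧ e ∉ D} y := by
  by_contra! hcon
  have hfin : (⋃ y ∈ {y | (y = u ∨ y ∈ vertexSet AdjL D) ∧ ConnectedIn AdjL ω S u y},
      {c | ConnectedIn AdjL ω {e | e ∈ S ∧ e ∉ D} y c}).Finite := by
    refine Set.Finite.biUnion ?_ fun y hy => Set.not_infinite.1 (hcon y hy.1 hy.2)
    refine ((finite_vertexSet D).insert u).subset fun y hy => hy.1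
  refine h (hfin.subset fun c hc => ?_)
  have hc : ConnectedIn AdjL ω S u c := hc
  rcases hc.symm.or_hit D with h1 | ⟨y, hy, h1⟩
  · exact Set.mem_biUnion (x := u) ⟨Or.inl rfl, .refl⟩ h1.symm
  · exact Set.mem_biUnion (x := y) ⟨Or.inr hy, hc.trans (h1.mono fun e he => he.1)⟩ h1.symm

/-- `D` is a coarse trifurcation of `ω`: it is internally connected and its removal leaves
three of its vertices in distinct infinite clusters. -/
structure Trif (ω : CL) (D : Finset EL) : Prop where
  conn : ∀ x ∈ vertexSet AdjL D, ∀ y ∈ vertexSet AdjL D, ConnectedIn AdjL ω ↑D x y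
  arms : ∃ y : Fin 3 → V, (∀ i, y i ∈ vertexSet AdjL D) ∧
    (∀ i, InfCluster AdjL ω {e | e ∉ D} (y i)) ∧
    ∀ i j, i ≠ j → ¬ ConnectedIn AdjL ω {e | e ∉ D} (y i) (y j)

section Trif

variable {ι : Type*} {ω : CL} {I : Finset ι} {b : ι → Finset EL}

theorem exists_extremal_trif (hI : I.Nonempty) (ht : ∀ i ∈ I, Trif ω (b i))
    (hd : ∀ i ∈ I, ∀ j ∈ I, i ≠ j → ∀ e ∈ b i, e ∉ b j) :
    ∃ i ∈ I, ∃ c : V, ∀ k ∈ I, k ≠ i → ∀ x ∈ vertexSet AdjL (b k), ∀ y ∈ vertexSet AdjL (b i),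
      ConnectedIn AdjL ω {e | e ∉ b i} x y → ConnectedIn AdjL ω {e | e ∉ b i} c y := by
  classical
  have hx : ∀ i : I, ∃ x, x ∈ vertexSet AdjL (b i) := fun i => by
    obtain ⟨y, h, -⟩ := (ht i.1 i.2).arms
    exact ⟨_, h 0⟩
  choose x hx using hx
  set P : Finset (I × I) :=
    Finset.univ.filter fun z => z.1 ≠ z.2 ∧ ConnectedIn AdjL ω Set.univ (x z.1) (x z.2) with hP
  have hsub : ∀ i k : I, i ≠ k → (↑(b k) : Set EL) ⊆ {e | e ∉ b i} := fun i k hik e he =>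
    hd k.1 k.2 i.1 i.2 (fun h => hik (Subtype.ext h.symm)) e he
  by_cases hne : P.Nonempty
  · obtain ⟨⟨i, j⟩, hij, hmax⟩ := Finset.exists_max_image P
      (fun z => (Finset.univ.filter fun l : I =>
        l ≠ z.1 ∧ ConnectedIn AdjL ω {e | e ∉ b z.1} (x l) (x z.2)).card) hne
    simp only [hP, Finset.mem_filter, Finset.mem_univ, true_and] at hij
    refine ⟨i.1, i.2, x j, fun k hk hki z hz y hy hzy => ?_⟩
    by_contra hcon
    have hkc : ∀ w ∈ vertexSet AdjL (b k), ConnectedIn AdjL ω {e | e ∉ b i} w y := fun w hw =>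
      (((ht k hk).conn w hw z hz).mono
        (hsub i ⟨k, hk⟩ fun h => hki (congrArg Subtype.val h).symm)).trans hzy
    have hki' : (⟨k, hk⟩ : I) ≠ i := fun h => hki (congrArg Subtype.val h)
    have hav : ∀ w, ConnectedIn AdjL ω {e | e ∉ b i} (x j) w →
        ConnectedIn AdjL ω {e | e ∉ b k} (x j) w := fun w hw =>
      (hw.avoid (D := b k) fun v hv hc => hcon (hc.trans (hkc v hv))).mono fun e he => he.2
    have hlt := hmax ⟨⟨k, hk⟩, i⟩ (by
      simp only [hP, Finset.mem_filter, Finset.mem_univ, true_and]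
      refine ⟨hki', ?_⟩
      refine ((hkc _ (hx ⟨k, hk⟩)).mono (Set.subset_univ _)).trans ?_
      exact ((ht i.1 i.2).conn y hy _ (hx i)).mono (Set.subset_univ _))
    refine absurd hlt (not_le.2 (Finset.card_lt_card ?_))
    have hji : ConnectedIn AdjL ω {e | e ∉ b k} (x j) (x i) := by
      obtain ⟨y', hy', hc⟩ := hij.2.symm.exists_hit (hx i)
      refine (hav y' (hc.mono fun e he => he.2)).trans ?_
      exact ((ht i.1 i.2).conn y' hy' _ (hx i)).mono (hsub ⟨k, hk⟩ i hki')
    refine Finset.ssubset_iff_subset_ne.2 ⟨fun l hl => ?_, fun heq => ?_⟩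
    · simp only [Finset.mem_filter, Finset.mem_univ, true_and] at hl ⊢
      refine ⟨?_, (hav _ hl.2.symm).symm.trans hji⟩
      rintro rfl
      exact hcon (hl.2.symm.trans (hkc _ (hx ⟨k, hk⟩)))
    · have : i ∈ Finset.univ.filter fun l : I =>
          l ≠ i ∧ ConnectedIn AdjL ω {e | e ∉ b i} (x l) (x j) := by
        rw [heq]
        simp only [Finset.mem_filter, Finset.mem_univ, true_and]
        exact ⟨hki'.symm, .refl⟩
      simp at this
  · obtain ⟨i, hi⟩ := hI
    refine ⟨i, hi, (0, 0), fun k hk hki z hz y hy hzy => absurd ?_ hne⟩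
    refine ⟨(⟨k, hk⟩, ⟨i, hi⟩), ?_⟩
    simp only [hP, Finset.mem_filter, Finset.mem_univ, true_and]
    refine ⟨fun h => hki (congrArg Subtype.val h), ?_⟩
    refine (((ht k hk).conn _ (hx ⟨k, hk⟩) z hz).mono (Set.subset_univ _)).trans ?_
    refine (hzy.mono (Set.subset_univ _)).trans ?_
    exact ((ht i hi).conn y hy _ (hx ⟨i, hi⟩)).mono (Set.subset_univ _)

theorem exists_rays_of_trif (ht : ∀ i ∈ I, Trif ω (b i))
    (hd : ∀ i ∈ I, ∀ j ∈ I, i ≠ j → ∀ e ∈ b i, e ∉ b j) :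
    ∃ R : Finset V, I.card ≤ R.card ∧ (∀ r ∈ R, ∃ i ∈ I, r ∈ vertexSet AdjL (b i)) ∧
      (∀ r ∈ R, InfCluster AdjL ω {e | ∀ i ∈ I, e ∉ b i} r) ∧
      ∀ r ∈ R, ∀ r' ∈ R, r ≠ r' → ¬ ConnectedIn AdjL ω {e | ∀ i ∈ I, e ∉ b i} r r' := by
  classical
  induction hn : I.card generalizing I with
  | zero => exact ⟨∅, by simp, by simp, by simp, by simp⟩
  | succ n ih =>
    have hne : I.Nonempty := Finset.card_pos.1 (by omega)
    obtain ⟨i, hi, c, hc⟩ := exists_extremal_trif hne ht hd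
    obtain ⟨R', h1, h2, h3, h4⟩ := ih (I := I.erase i)
      (fun k hk => ht k (Finset.mem_of_mem_erase hk))
      (fun k hk l hl => hd k (Finset.mem_of_mem_erase hk) l (Finset.mem_of_mem_erase hl))
      (by rw [Finset.card_erase_of_mem hi]; omega)
    set E' : Set EL := {e | ∀ k ∈ I.erase i, e ∉ b k} with hE'
    set E : Set EL := {e | ∀ k ∈ I, e ∉ b k} with hE
    have hEE' : E ⊆ E' := fun e he k hk => he k (Finset.mem_of_mem_erase hk)
    have hEb : E ⊆ {e | e ∉ b i} := fun e he => he i hi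
    have hbE' : (↑(b i) : Set EL) ⊆ E' := fun e he k hk =>
      hd i hi k (Finset.mem_of_mem_erase hk) (Finset.ne_of_mem_erase hk).symm e he
    have hE'E : {e | e ∈ E' ∧ e ∉ b i} ⊆ E := fun e he k hk => by
      by_cases h : k = i
      · exact h ▸ he.2
      · exact he.1 k (Finset.mem_erase.2 ⟨h, hk⟩)
    obtain ⟨y, hy, hyinf, hydis⟩ := (ht i hi).arms
    have harm : ∀ a, ¬ ConnectedIn AdjL ω {e | e ∉ b i} c (y a) → InfCluster AdjL ω E (y a) := by
      intro a ha
      refine ((hyinf a).avoid (D := (I.erase i).biUnion b) ?_).mono ?_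
      · rintro w ⟨e, he, hw⟩ hcon
        obtain ⟨k, hk, hek⟩ := Finset.mem_biUnion.1 he
        exact ha (hc k (Finset.mem_of_mem_erase hk) (Finset.ne_of_mem_erase hk) w ⟨e, hek, hw⟩
          _ (hy a) hcon.symm)
      · rintro e ⟨he, he'⟩
        exact hE'E ⟨fun k hk hek => he' (Finset.mem_biUnion.2 ⟨k, hk, hek⟩), he⟩
    have htwo : ∃ a a', a ≠ a' ∧ ¬ ConnectedIn AdjL ω {e | e ∉ b i} c (y a) ∧
        ¬ ConnectedIn AdjL ω {e | e ∉ b i} c (y a') := by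
      have key : ∀ a a', a ≠ a' → ConnectedIn AdjL ω {e | e ∉ b i} c (y a) →
          ¬ ConnectedIn AdjL ω {e | e ∉ b i} c (y a') := fun a a' hne h h' =>
        hydis a a' hne (h.symm.trans h')
      by_cases h0 : ConnectedIn AdjL ω {e | e ∉ b i} c (y 0)
      · exact ⟨1, 2, by decide, key 0 1 (by decide) h0, key 0 2 (by decide) h0⟩
      · by_cases h5 : ConnectedIn AdjL ω {e | e ∉ b i} c (y 1)
        · exact ⟨0, 2, by decide, h0, key 1 2 (by decide) h5⟩
        · exact ⟨0, 1, by decide, h0, h5⟩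
    obtain ⟨a, a', haa, ha, ha'⟩ := htwo
    have hyne : y a ≠ y a' := fun h => hydis a a' haa (h ▸ .refl)
    set R'' := R'.filter fun r => ∀ w ∈ vertexSet AdjL (b i), ¬ ConnectedIn AdjL ω E' r w with hR''
    have hcard : R'.card ≤ R''.card + 1 := by
      rw [← Finset.card_filter_add_card_filter_not
        (fun r => ∀ w ∈ vertexSet AdjL (b i), ¬ ConnectedIn AdjL ω E' r w)]
      refine Nat.add_le_add_left (Finset.card_le_one.2 ?_) _
      intro r hr r' hr'
      rw [Finset.mem_filter] at hr hr'
      by_contra hne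
      obtain ⟨hr, hr2⟩ := hr
      obtain ⟨hr', hr2'⟩ := hr'
      push Not at hr2 hr2'
      obtain ⟨w, hw, hrw⟩ := hr2
      obtain ⟨w', hw', hrw'⟩ := hr2'
      exact h4 r hr r' hr' hne
        (hrw.trans ((((ht i hi).conn w hw w' hw').mono hbE').trans hrw'.symm))
    have hnot : ∀ a, y a ∉ R'' := fun a h => (Finset.mem_filter.1 h).2 _ (hy a) .refl
    refine ⟨insert (y a) (insert (y a') R''), ?_, ?_, ?_, ?_⟩
    · rw [Finset.card_insert_of_notMem, Finset.card_insert_of_notMem (hnot a')]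
      · omega
      · simp [hyne, hnot a]
    · intro r hr
      simp only [Finset.mem_insert] at hr
      rcases hr with rfl | rfl | hr
      · exact ⟨i, hi, hy a⟩
      · exact ⟨i, hi, hy a'⟩
      · obtain ⟨k, hk, h⟩ := h2 r (Finset.mem_filter.1 hr).1
        exact ⟨k, Finset.mem_of_mem_erase hk, h⟩
    · intro r hr
      simp only [Finset.mem_insert] at hr
      rcases hr with rfl | rfl | hr
      · exact harm a ha
      · exact harm a' ha'
      · rw [hR'', Finset.mem_filter] at hr
        exact ((h3 r hr.1).avoid hr.2).mono hE'E
    · have hry : ∀ r ∈ R'', ∀ a, ¬ ConnectedIn AdjL ω E r (y a) := fun r hr a h =>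
        (Finset.mem_filter.1 hr).2 _ (hy a) (h.mono hEE')
      have hyy : ¬ ConnectedIn AdjL ω E (y a) (y a') := fun h => hydis a a' haa (h.mono hEb)
      intro r hr r' hr' hne
      simp only [Finset.mem_insert] at hr hr'
      rcases hr with rfl | rfl | hr <;> rcases hr' with rfl | rfl | hr'
      · exact absurd rfl hne
      · exact hyy
      · exact fun h => hry _ hr' _ h.symm
      · exact fun h => hyy h.symm
      · exact absurd rfl hne
      · exact fun h => hry _ hr' _ h.symm
      · exact hry _ hr _
      · exact hry _ hr _
      · exact fun h => h4 r (Finset.mem_filter.1 hr).1 r' (Finset.mem_filter.1 hr').1 hne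
          (h.mono hEE')

end Trif

/-- The sup norm of a vertex. -/
def nrm (v : V) : ℤ := max |v.1| |v.2|

theorem nrm_le {v : V} {n : ℤ} : nrm v ≤ n ↔ |v.1| ≤ n ∧ |v.2| ≤ n := max_le_iff

theorem nrm_le_of_adj {u v : V} (h1 : v.1 = u.1 + 1 ∨ v.1 = u.1 - 1 ∨ v.1 = u.1)
    (h2 : v.2 = u.2 + 1 ∨ v.2 = u.2 - 1 ∨ v.2 = u.2) : nrm v ≤ nrm u + 1 := by
  have := nrm_le.1 (le_refl (nrm u))
  rw [nrm_le]
  simp only [abs_le] at this ⊢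
  omega

theorem nrm_le_of_inc {u v : V} {e : EL} (hu : Inc AdjL u e) (hv : Inc AdjL v e) :
    nrm v ≤ nrm u + 1 := by
  rcases Inc.eq_or_adj hu hv with rfl | ⟨h, -⟩
  · omega
  · obtain ⟨-, h1, h2⟩ := adjL_iff.1 h
    exact nrm_le_of_adj (by omega) (by omega)

theorem finite_nrm_le (n : ℤ) : {v : V | nrm v ≤ n}.Finite := by
  refine (Set.finite_Icc ((-n, -n) : V) (n, n)).subset fun v hv => ?_
  have := nrm_le.1 hv
  simp only [abs_le] at this
  exact ⟨⟨this.1.1, this.2.1⟩, ⟨this.1.2, this.2.2⟩⟩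

/-- Intermediate values along discrete paths. -/
theorem reflTransGen_exists_eq {α : Type*} {r : α → α → Prop} {f : α → ℤ}
    (hf : ∀ a b, r a b → f b ≤ f a + 1) {a b : α} (h : Relation.ReflTransGen r a b) {n : ℤ}
    (ha : f a ≤ n) (hb : n ≤ f b) : ∃ c, Relation.ReflTransGen r a c ∧ f c = n := by
  induction h with
  | refl => exact ⟨a, .refl, le_antisymm ha hb⟩
  | @tail x y h h' ih =>
    by_cases hx : n ≤ f x
    · exact ih hx
    · exact ⟨y, h.tail h', le_antisymm (by have := hf _ _ h'; omega) hb⟩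

theorem InfCluster.exists_nrm_eq {ω : CL} {S : Set EL} {u : V} (h : InfCluster AdjL ω S u) {n : ℤ}
    (hu : nrm u ≤ n) : ∃ v, ConnectedIn AdjL ω S u v ∧ nrm v = n := by
  obtain ⟨w, hw, hwn⟩ := h.exists_notMem_finite (finite_nrm_le n)
  rw [Set.mem_ofPred_eq, not_le] at hwn
  refine reflTransGen_exists_eq (f := nrm) ?_ hw hu hwn.le
  rintro a b ⟨e, -, -, h1, h2⟩
  exact nrm_le_of_inc h1 h2

theorem card_nrm_eq_le (n : ℕ) (R : Finset V) (hR : ∀ r ∈ R, nrm r = n) :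
    R.card ≤ 4 * (2 * n + 1) := by
  classical
  set J := Finset.Icc (-n : ℤ) n with hJ
  have hJc : J.card = 2 * n + 1 := by
    rw [hJ, Int.card_Icc]
    omega
  have hsub : R ⊆ (({(n : ℤ), -(n : ℤ)} : Finset ℤ) ×ˢ J) ∪ (J ×ˢ {(n : ℤ), -(n : ℤ)}) := by
    intro r hr
    have h := hR r hr
    have h2 := nrm_le.1 h.le
    have h3 : |r.1| = n ∨ |r.2| = n := by
      rcases max_choice |r.1| |r.2| with h' | h'
      · exact Or.inl (h' ▸ h)
      · exact Or.inr (h' ▸ h)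
    simp only [abs_le] at h2
    simp only [Finset.mem_union, Finset.mem_product, Finset.mem_insert, Finset.mem_singleton, hJ,
      Finset.mem_Icc]
    rcases h3 with h3 | h3
    · left
      rcases abs_choice r.1 with h4 | h4 <;> omega
    · right
      rcases abs_choice r.2 with h4 | h4 <;> omega
  have hc2 : ({(n : ℤ), -(n : ℤ)} : Finset ℤ).card ≤ 2 := Finset.card_le_two
  have h1 := (Finset.card_le_card hsub).trans (Finset.card_union_le _ _)
  rw [Finset.card_product, Finset.card_product, hJc] at h1
  nlinarith

theorem card_trif_le {ι : Type*} {ω : CL} {I : Finset ι} {b : ι → Finset EL} {n : ℕ}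
    (ht : ∀ i ∈ I, Trif ω (b i)) (hd : ∀ i ∈ I, ∀ j ∈ I, i ≠ j → ∀ e ∈ b i, e ∉ b j)
    (hn : ∀ i ∈ I, ∀ v ∈ vertexSet AdjL (b i), nrm v ≤ n) : I.card ≤ 4 * (2 * n + 1) := by
  classical
  obtain ⟨R, h1, h2, h3, h4⟩ := exists_rays_of_trif ht hd
  have hex : ∀ r : R, ∃ v, ConnectedIn AdjL ω {e | ∀ i ∈ I, e ∉ b i} r v ∧ nrm v = n := fun r => by
    obtain ⟨i, hi, hr⟩ := h2 r r.2
    exact (h3 r r.2).exists_nrm_eq (hn i hi _ hr)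
  choose f hf hfn using hex
  have hinj : Function.Injective f := fun r r' h => by
    by_contra hne
    exact h4 r r.2 r' r'.2 (fun h => hne (Subtype.ext h)) ((hf r).trans (h ▸ (hf r').symm))
  refine h1.trans ?_
  have := card_nrm_eq_le n (Finset.univ.image f) (by
    intro v hv
    obtain ⟨r, -, rfl⟩ := Finset.mem_image.1 hv
    exact hfn r)
  rwa [Finset.card_image_of_injective _ hinj, Finset.card_univ, Fintype.card_coe] at this

/-! ### Translations -/

section Shift

variable {t s : V} (ht : IsLatticeVec t) (hs : IsLatticeVec s)

theorem IsLatticeVec.neg {t : V} (ht : IsLatticeVec t) : IsLatticeVec (-t) := by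
  have h : Even (t.1 + t.2) := ht
  show Even (-t.1 + -t.2)
  rw [← neg_add]
  exact h.neg

theorem IsLatticeVec.add {t s : V} (ht : IsLatticeVec t) (hs : IsLatticeVec s) :
    IsLatticeVec (t + s) := by
  have h : Even (t.1 + t.2) := ht
  have h' : Even (s.1 + s.2) := hs
  show Even ((t.1 + s.1) + (t.2 + s.2))
  rw [add_add_add_comm]
  exact h.add h'

theorem shiftV_injective (t : V) : Function.Injective (shiftV t) := fun u v h => by
  simp only [shiftV, Prod.mk.injEq, add_left_inj] at h
  exact Prod.ext h.1 h.2

theorem shiftV_shiftV_neg (t v : V) : shiftV t (shiftV (-t) v) = v := by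
  simp [shiftV]

theorem shiftV_neg_shiftV (t v : V) : shiftV (-t) (shiftV t v) = v := by
  simp [shiftV]

theorem shiftEdge_mkE {u v : V} (h : AdjL u v) :
    shiftEdge t ht (mkE u v h) = mkE (shiftV t u) (shiftV t v) (adjL_shift ht h) := rfl

theorem inc_shiftEdge {v : V} {e : EL} : Inc AdjL (shiftV t v) (shiftEdge t ht e) ↔ Inc AdjL v e := by
  obtain ⟨a, b, h, rfl⟩ := exists_eq_mkE e
  rw [shiftEdge_mkE, inc_mkE, inc_mkE, (shiftV_injective t).eq_iff, (shiftV_injective t).eq_iff]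

theorem shiftEdge_shiftEdge_neg (e : EL) : shiftEdge t ht (shiftEdge (-t) ht.neg e) = e := by
  obtain ⟨a, b, h, rfl⟩ := exists_eq_mkE e
  simp only [shiftEdge_mkE, shiftV_shiftV_neg]

theorem shiftEdge_neg_shiftEdge (e : EL) : shiftEdge (-t) ht.neg (shiftEdge t ht e) = e := by
  obtain ⟨a, b, h, rfl⟩ := exists_eq_mkE e
  simp only [shiftEdge_mkE, shiftV_neg_shiftV]

theorem shift_shift (ω : CL) : Shift t ht (Shift s hs ω) = Shift (t + s) (ht.add hs) ω := by
  funext e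
  obtain ⟨a, b, h, rfl⟩ := exists_eq_mkE e
  simp only [Shift, shiftEdge_mkE]
  congr 2 <;> simp [shiftV, add_assoc]

theorem shift_neg_shift (ω : CL) : Shift (-t) ht.neg (Shift t ht ω) = ω := by
  funext e
  exact congrArg ω (shiftEdge_shiftEdge_neg ht e)

theorem measurable_shift : Measurable (Shift t ht) :=
  measurable_pi_lambda _ fun _ => measurable_pi_apply _

theorem ConnectedIn.shift {ω : CL} {S S' : Set EL} (hS : ∀ e ∈ S, shiftEdge t ht e ∈ S') {u v : V}
    (h : ConnectedIn AdjL (Shift t ht ω) S u v) :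
    ConnectedIn AdjL ω S' (shiftV t u) (shiftV t v) := by
  refine Relation.ReflTransGen.lift (shiftV t) ?_ _ _ h
  rintro a b ⟨e, h1, h2, h3, h4⟩
  exact ⟨shiftEdge t ht e, hS e h1, h2, (inc_shiftEdge ht).2 h3, (inc_shiftEdge ht).2 h4⟩

theorem connectedIn_shift {ω : CL} {S S' : Set EL} (hS : ∀ e, e ∈ S ↔ shiftEdge t ht e ∈ S')
    {u v : V} : ConnectedIn AdjL (Shift t ht ω) S u v ↔
      ConnectedIn AdjL ω S' (shiftV t u) (shiftV t v) := by
  refine ⟨fun h => h.shift ht fun e => (hS e).1, fun h => ?_⟩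
  rw [← shift_neg_shift ht ω] at h
  have := h.shift ht.neg (S' := S) fun e he => (hS _).2 (by rwa [shiftEdge_shiftEdge_neg])
  rwa [shiftV_neg_shiftV, shiftV_neg_shiftV] at this

theorem infCluster_shift {ω : CL} {S S' : Set EL} (hS : ∀ e, e ∈ S ↔ shiftEdge t ht e ∈ S')
    {u : V} : InfCluster AdjL (Shift t ht ω) S u ↔ InfCluster AdjL ω S' (shiftV t u) := by
  unfold InfCluster
  have : {v | ConnectedIn AdjL ω S' (shiftV t u) v}
      = shiftV t '' {v | ConnectedIn AdjL (Shift t ht ω) S u v} := by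
    ext v
    constructor
    · intro h
      refine ⟨shiftV (-t) v, ?_, shiftV_shiftV_neg t v⟩
      rw [Set.mem_ofPred_eq, connectedIn_shift ht hS, shiftV_shiftV_neg]
      exact h
    · rintro ⟨w, hw, rfl⟩
      exact (connectedIn_shift ht hS).1 hw
  rw [this, Set.infinite_image_iff (shiftV_injective t).injOn]

theorem DualStep.shift {ω : CL} {w w' : V} (h : DualStep (Shift t ht ω) Set.univ w w') :
    DualStep ω Set.univ (shiftV t w) (shiftV t w') := by
  obtain ⟨h1, h2, h3, h4, h5, -, h6⟩ := h
  have ht' : Even (t.1 + t.2) := ht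
  refine ⟨?_, ?_, ?_, ?_, edgeSet_shift ht h5, trivial, h6⟩
  · have : Odd ((w.1 + w.2) + (t.1 + t.2)) := h1.add_even ht'
    show Odd ((w.1 + t.1) + (w.2 + t.2))
    rwa [add_add_add_comm]
  · have : Odd ((w'.1 + w'.2) + (t.1 + t.2)) := h2.add_even ht'
    show Odd ((w'.1 + t.1) + (w'.2 + t.2))
    rwa [add_add_add_comm]
  · simpa [shiftV] using h3
  · simpa [shiftV] using h4

theorem DualInfCluster.shift {ω : CL} {w : V} (h : DualInfCluster (Shift t ht ω) Set.univ w) :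
    DualInfCluster ω Set.univ (shiftV t w) := by
  refine Set.Infinite.mono ?_ (Set.Infinite.image (shiftV_injective t).injOn h)
  rintro _ ⟨v, hv, rfl⟩
  exact Relation.ReflTransGen.lift (shiftV t) (fun _ _ h => DualStep.shift ht h) _ _ hv

theorem dualInfCluster_shift {ω : CL} {w : V} :
    DualInfCluster (Shift t ht ω) Set.univ w ↔ DualInfCluster ω Set.univ (shiftV t w) := by
  refine ⟨fun h => h.shift ht, fun h => ?_⟩
  rw [← shift_neg_shift ht ω] at h
  have := h.shift ht.neg
  rwa [shiftV_neg_shiftV] at this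

end Shift

/-- `φ` is invariant under the translations by `K ℤ²`. -/
structure IsPer (φ : Measure CL) (K : ℤ) : Prop where
  pos : 0 < K
  even : Even K
  inv : ∀ (a b : ℤ) (h : IsLatticeVec (K * a, K * b)),
    MeasurePreserving (Shift (K * a, K * b) h) φ φ

theorem IsPer.isLatticeVec {φ : Measure CL} {K : ℤ} (h : IsPer φ K) (a b : ℤ) :
    IsLatticeVec (K * a, K * b) := by
  show Even (K * a + K * b)
  rw [← mul_add]
  exact h.even.mul_right _

theorem exists_isPer {φ : Measure CL} (hinv : ∃ (t₁ t₂ : V) (ht₁ : IsLatticeVec t₁)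
    (ht₂ : IsLatticeVec t₂), t₁.1 * t₂.2 - t₁.2 * t₂.1 ≠ 0 ∧
      φ.map (Shift t₁ ht₁) = φ ∧ φ.map (Shift t₂ ht₂) = φ) : ∃ K, IsPer φ K := by
  obtain ⟨t₁, t₂, ht₁, ht₂, hdet, h1, h2⟩ := hinv
  set G : AddSubgroup V :=
    { carrier := {t | ∃ h : IsLatticeVec t, MeasurePreserving (Shift t h) φ φ}
      zero_mem' := ⟨by show Even (0 + 0 : ℤ); simp, by
        have : ∀ h, Shift 0 h = id := fun h => by
          funext ω e
          obtain ⟨a, b, h, rfl⟩ := exists_eq_mkE e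
          simp [Shift, shiftEdge_mkE, shiftV]
        rw [this]
        exact MeasurePreserving.id φ⟩
      add_mem' := by
        rintro a b ⟨ha, ha'⟩ ⟨hb, hb'⟩
        refine ⟨ha.add hb, ?_⟩
        have : Shift (a + b) (ha.add hb) = Shift a ha ∘ Shift b hb := by
          funext ω
          exact (shift_shift ha hb ω).symm
        rw [this]
        exact ha'.comp hb'
      neg_mem' := by
        rintro a ⟨ha, ha'⟩
        refine ⟨ha.neg, measurable_shift _, ?_⟩
        conv_lhs => rw [← ha'.map_eq]
        rw [Measure.map_map (measurable_shift _) (measurable_shift _)]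
        have : Shift (-a) ha.neg ∘ Shift a ha = id := funext fun ω => shift_neg_shift ha ω
        rw [this, Measure.map_id] } with hG
  have m1 : t₁ ∈ G := ⟨ht₁, measurable_shift _, h1⟩
  have m2 : t₂ ∈ G := ⟨ht₂, measurable_shift _, h2⟩
  set d := t₁.1 * t₂.2 - t₁.2 * t₂.1 with hd
  refine ⟨2 * |d|, by positivity, even_two_mul _, fun a b h => ?_⟩
  have key : ((2 * |d| * a, 2 * |d| * b) : V) ∈ G := by
    obtain ⟨σ, hσ⟩ : ∃ σ : ℤ, |d| = σ * d := by
      rcases abs_choice d with h | h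
      · exact ⟨1, by rw [h]; ring⟩
      · exact ⟨-1, by rw [h]; ring⟩
    have e : ((2 * |d| * a, 2 * |d| * b) : V)
        = (2 * σ * (a * t₂.2 - b * t₂.1)) • t₁ + (2 * σ * (b * t₁.1 - a * t₁.2)) • t₂ := by
      rw [hσ, hd]
      refine Prod.ext ?_ ?_
      · simp only [Prod.fst_add, Prod.smul_fst, smul_eq_mul]
        ring
      · simp only [Prod.snd_add, Prod.smul_snd, smul_eq_mul]
        ring
    rw [e]
    exact G.add_mem (G.zsmul_mem m1 _) (G.zsmul_mem m2 _)
  exact key.2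

theorem depOn_preimage_shift {D D' : Finset EL} {t : V} (ht : IsLatticeVec t)
    (h : ∀ e ∈ D, shiftEdge t ht e ∉ D') {E : Set CL} (hE : DepOn ↑D E) :
    DepOn {e | e ∉ D'} (Shift t ht ⁻¹' E) :=
  fun _ _ hω => hE _ _ fun e he => hω _ (h e he)

/-- Large translations move finite sets of edges away from each other. -/
theorem IsPer.exists_far {φ : Measure CL} {K : ℤ} (h : IsPer φ K) (D D' : Finset EL) :
    ∃ a : ℤ, ∀ e ∈ D, shiftEdge (K * a, K * 0) (h.isLatticeVec a 0) e ∉ D' := by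
  obtain ⟨n, hn⟩ := exists_subset_boxE D
  obtain ⟨m, hm⟩ := exists_subset_boxE D'
  refine ⟨n + m + 1, fun e he he' => ?_⟩
  obtain ⟨u, v, huv, rfl⟩ := exists_eq_mkE e
  have h1 := (mem_boxE.1 (hn he) u (inc_left huv)).1
  have h2 := (mem_boxE.1 (hm he') _ (inc_left (adjL_shift (h.isLatticeVec _ _) huv))).1
  simp only [shiftV, abs_le] at h1 h2
  have hK := h.pos
  nlinarith [h1.1, h2.2]

theorem IsPer.zero_or_one {p q : ℝ} (hp0 : 0 < p) (hp1 : p < 1) (hq : 1 ≤ q) {φ : Measure CL}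
    (hφ : IsGibbs AdjL 4 p q φ) (htail : TailTrivial AdjL φ) {K : ℤ} (h : IsPer φ K) {S : Set CL}
    (hS : MeasurableSet S) (hinv : ∀ t (ht : IsLatticeVec t), Shift t ht ⁻¹' S = S) :
    φ.real S = 0 ∨ φ.real S = 1 := by
  refine zero_or_one_of_invariant hp0 hp1 hq hφ htail hS fun D D' => ?_
  obtain ⟨a, ha⟩ := h.exists_far D D'
  exact ⟨_, h.inv a 0 (h.isLatticeVec a 0), hinv _ _, fun E hE => depOn_preimage_shift _ ha hE⟩

/-! ### Uniqueness of the infinite cluster -/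

theorem InfCluster.exists_inc {ω : CL} {S : Set EL} {u : V} (h : InfCluster AdjL ω S u) :
    ∃ e, Inc AdjL u e := by
  obtain ⟨w, hw, hne⟩ := h.exists_notMem_finite (Set.finite_singleton u)
  rcases Relation.ReflTransGen.cases_head hw with h | ⟨c, ⟨e, -, -, h3, -⟩, -⟩
  · exact absurd h.symm hne
  · exact ⟨e, h3⟩

theorem exists_mem_vertexSet_boxE {S : Finset V} (hS : ∀ u ∈ S, ∃ e, Inc AdjL u e) :
    ∃ n : ℕ, ∀ u ∈ S, u ∈ vertexSet AdjL (boxE n) := by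
  classical
  induction S using Finset.induction_on with
  | empty => exact ⟨0, by simp⟩
  | insert u S _ ih =>
    obtain ⟨n, hn⟩ := ih fun v hv => hS v (Finset.mem_insert_of_mem hv)
    obtain ⟨e, he⟩ := hS u (Finset.mem_insert_self _ _)
    obtain ⟨m, hm⟩ := exists_mem_boxE e
    refine ⟨max n m, fun v hv => ?_⟩
    rcases Finset.mem_insert.1 hv with rfl | hv
    · exact ⟨e, boxE_mono (by simp) hm, he⟩
    · exact vertexSet_mono (boxE_mono (by simp)) (hn v hv)

theorem nrm_le_of_mem_vertexSet_boxE {n : ℤ} {v : V} (hv : v ∈ vertexSet AdjL (boxE n)) :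
    nrm v ≤ n := by
  obtain ⟨e, he, hi⟩ := hv
  exact nrm_le.2 (mem_boxE.1 he v hi)

theorem even_of_mem_vertexSet {D : Finset EL} {v : V} (hv : v ∈ vertexSet AdjL D) :
    Even (v.1 + v.2) := by
  obtain ⟨e, -, hi⟩ := hv
  exact hi.even

theorem connectedIn_boxE_origin {ω : CL} {n : ℕ} (ho : ∀ e ∈ boxE n, ω e = true) (k : ℕ)
    (hk : k ≤ n) (x : V) (hx : Even (x.1 + x.2)) (hxk : nrm x ≤ k) :
    ConnectedIn AdjL ω ↑(boxE n) x (0, 0) := by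
  induction k generalizing x with
  | zero =>
    have := nrm_le.1 hxk
    have h1 : x.1 = 0 := by simpa using this.1
    have h2 : x.2 = 0 := by simpa using this.2
    rw [show x = (0, 0) from Prod.ext h1 h2]
    exact .refl
  | succ k ih =>
    by_cases h0 : x = (0, 0)
    · rw [h0]
      exact .refl
    have hd : ∀ a : ℤ, ∃ b : ℤ, (b = a + 1 ∨ b = a - 1) ∧ (a ≠ 0 → |b| ≤ |a| - 1) ∧
        (a = 0 → |b| = 1) := by
      intro a
      rcases lt_trichotomy a 0 with h | h | h
      · exact ⟨a + 1, by omega, by intro; simp only [abs_le]; rw [abs_of_neg h]; omega, by omega⟩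
      · exact ⟨1, by omega, by omega, by simp⟩
      · exact ⟨a - 1, by omega, by intro; simp only [abs_le]; rw [abs_of_pos h]; omega, by omega⟩
    obtain ⟨a, ha, ha1, ha2⟩ := hd x.1
    obtain ⟨b, hb, hb1, hb2⟩ := hd x.2
    have hxk' := nrm_le.1 hxk
    have hadj : AdjL x (a, b) := adjL_iff.2 ⟨hx, ha, hb⟩
    have h1 : nrm (a, b) ≤ k := by
      rw [nrm_le]
      have h00 : x.1 ≠ 0 ∨ x.2 ≠ 0 := by
        by_contra! h
        exact h0 (Prod.ext h.1 h.2)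
      rw [Int.even_iff] at hx
      push_cast at hxk'
      by_cases h1 : x.1 = 0
      · have h2 : x.2 ≠ 0 := by omega
        have h3 := ha2 h1
        have h4 := hb1 h2
        have h5 : 2 ≤ |x.2| := by
          rcases abs_choice x.2 with h | h <;> have := abs_nonneg x.2 <;> omega
        show |a| ≤ _ ∧ |b| ≤ _
        omega
      · have h3 := ha1 h1
        by_cases h2 : x.2 = 0
        · have h4 := hb2 h2
          have h5 : 2 ≤ |x.1| := by
            rcases abs_choice x.1 with h | h <;> have := abs_nonneg x.1 <;> omega
          show |a| ≤ _ ∧ |b| ≤ _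
          omega
        · have h4 := hb1 h2
          show |a| ≤ _ ∧ |b| ≤ _
          omega
    have hmem : mkE x (a, b) hadj ∈ boxE n := by
      rw [mem_boxE_mkE]
      have h2 := nrm_le.1 h1
      have hkn : (k : ℤ) + 1 ≤ n := by omega
      push_cast at hxk'
      exact ⟨⟨by omega, by omega⟩, by omega, by omega⟩
    exact (ConnectedIn.step (by exact hmem) (ho _ hmem) (inc_left _) (inc_right _)).trans
      (ih (by omega) (a, b) hadj.2.1 h1)

theorem connectedIn_boxE {ω : CL} {n : ℕ} (ho : ∀ e ∈ boxE n, ω e = true) {x y : V}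
    (hx : x ∈ vertexSet AdjL (boxE n)) (hy : y ∈ vertexSet AdjL (boxE n)) :
    ConnectedIn AdjL ω ↑(boxE n) x y :=
  (connectedIn_boxE_origin ho n le_rfl x (even_of_mem_vertexSet hx)
    (nrm_le_of_mem_vertexSet_boxE hx)).trans
    (connectedIn_boxE_origin ho n le_rfl y (even_of_mem_vertexSet hy)
      (nrm_le_of_mem_vertexSet_boxE hy)).symm

theorem measurableSet_trif (D : Finset EL) : MeasurableSet {ω | Trif ω D} := by
  have : {ω | Trif ω D} = {ω | (∀ x, x ∈ vertexSet AdjL D → ∀ y, y ∈ vertexSet AdjL D →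
      ConnectedIn AdjL ω ↑D x y) ∧ ∃ y : Fin 3 → V, (∀ i, y i ∈ vertexSet AdjL D) ∧
      (∀ i, InfCluster AdjL ω {e | e ∉ D} (y i)) ∧
      ∀ i j, i ≠ j → ¬ ConnectedIn AdjL ω {e | e ∉ D} (y i) (y j)} :=
    Set.ext fun ω => ⟨fun h => ⟨h.conn, h.arms⟩, fun h => ⟨h.1, h.2⟩⟩
  rw [this]
  have h1 : MeasurableSet {ω : CL | ∀ x, x ∈ vertexSet AdjL D → ∀ y, y ∈ vertexSet AdjL D →
      ConnectedIn AdjL ω ↑D x y} := by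
    simp only [Set.ofPred_forall]
    exact .iInter fun _ => .iInter fun _ => .iInter fun _ => .iInter fun _ =>
      measurableSet_connectedIn _ _ _
  have h2 (y : Fin 3 → V) : MeasurableSet {ω : CL | ∀ i, InfCluster AdjL ω {e | e ∉ D} (y i)} := by
    simp only [Set.ofPred_forall]
    exact .iInter fun _ => measurableSet_infCluster _ _
  have h3 (y : Fin 3 → V) : MeasurableSet {ω : CL | ∀ i j, i ≠ j →
      ¬ ConnectedIn AdjL ω {e | e ∉ D} (y i) (y j)} := by
    simp only [Set.ofPred_forall]
    exact .iInter fun _ => .iInter fun _ => .iInter fun _ =>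
      (measurableSet_connectedIn _ _ _).compl
  have h4 : MeasurableSet {ω : CL | ∃ y : Fin 3 → V, (∀ i, y i ∈ vertexSet AdjL D) ∧
      (∀ i, InfCluster AdjL ω {e | e ∉ D} (y i)) ∧
      ∀ i j, i ≠ j → ¬ ConnectedIn AdjL ω {e | e ∉ D} (y i) (y j)} := by
    rw [Set.ofPred_exists]
    exact .iUnion fun y => (MeasurableSet.const _).inter ((h2 y).inter (h3 y))
  exact h1.inter h4

theorem vertexSet_map_shiftEdge {t : V} (ht : IsLatticeVec t) [DecidableEq EL] (D : Finset EL) :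
    vertexSet AdjL (D.image (shiftEdge t ht)) = shiftV t '' vertexSet AdjL D := by
  ext v
  constructor
  · rintro ⟨e, he, hv⟩
    obtain ⟨e', he', rfl⟩ := Finset.mem_image.1 he
    rw [← shiftV_shiftV_neg t v, inc_shiftEdge] at hv
    exact ⟨_, ⟨e', he', hv⟩, shiftV_shiftV_neg t v⟩
  · rintro ⟨v, ⟨e, he, hv⟩, rfl⟩
    exact ⟨_, Finset.mem_image_of_mem _ he, (inc_shiftEdge ht).2 hv⟩

theorem mem_image_shiftEdge {t : V} (ht : IsLatticeVec t) [DecidableEq EL] (D : Finset EL)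
    (e : EL) : e ∈ D ↔ shiftEdge t ht e ∈ D.image (shiftEdge t ht) := by
  rw [Finset.mem_image]
  refine ⟨fun h => ⟨e, h, rfl⟩, fun ⟨e', h, he⟩ => ?_⟩
  have := congrArg (shiftEdge (-t) ht.neg) he
  rw [shiftEdge_neg_shiftEdge, shiftEdge_neg_shiftEdge] at this
  exact this ▸ h

theorem Trif.shift {t : V} (ht : IsLatticeVec t) [DecidableEq EL] {ω : CL} {D : Finset EL}
    (h : Trif (Shift t ht ω) D) : Trif ω (D.image (shiftEdge t ht)) := by
  have hD := mem_image_shiftEdge ht D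
  constructor
  · rw [vertexSet_map_shiftEdge]
    rintro _ ⟨x, hx, rfl⟩ _ ⟨y, hy, rfl⟩
    exact (connectedIn_shift ht hD).1 (h.conn x hx y hy)
  · obtain ⟨y, h1, h2, h3⟩ := h.arms
    have hD' : ∀ e, e ∈ {e | e ∉ D} ↔
        shiftEdge t ht e ∈ {e | e ∉ D.image (shiftEdge t ht)} := fun e => not_congr (hD e)
    refine ⟨fun i => shiftV t (y i), fun i => ?_, fun i => (infCluster_shift ht hD').1 (h2 i),
      fun i j hij h => h3 i j hij ((connectedIn_shift ht hD').2 h)⟩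
    rw [vertexSet_map_shiftEdge]
    exact Set.mem_image_of_mem _ (h1 i)

open Classical in
theorem sum_measureReal_le {Ω ι : Type*} [MeasurableSpace Ω] {μ : Measure Ω}
    [IsProbabilityMeasure μ] (I : Finset ι) {A : ι → Set Ω} (hA : ∀ i, MeasurableSet (A i)) {C : ℝ}
    (hC : ∀ ω, ((I.filter fun i => ω ∈ A i).card : ℝ) ≤ C) : ∑ i ∈ I, μ.real (A i) ≤ C := by
  have hint : ∀ i, Integrable ((A i).indicator fun _ => (1 : ℝ)) μ := fun i =>
    (integrable_const 1).indicator (hA i)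
  have e : ∑ i ∈ I, μ.real (A i) = ∫ ω, ∑ i ∈ I, (A i).indicator (fun _ => (1 : ℝ)) ω ∂μ := by
    rw [integral_finsetSum _ fun i _ => hint i]
    refine Finset.sum_congr rfl fun i _ => ?_
    rw [integral_indicator_const _ (hA i)]
    simp
  rw [e]
  have h2 : ∫ ω, ∑ i ∈ I, (A i).indicator (fun _ => (1 : ℝ)) ω ∂μ ≤ ∫ _, C ∂μ := by
    refine integral_mono (integrable_finsetSum _ fun i _ => hint i) (integrable_const _) fun ω => ?_
    have : ∑ i ∈ I, (A i).indicator (fun _ => (1 : ℝ)) ω = (I.filter fun i => ω ∈ A i).card := by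
      rw [Finset.card_filter, Nat.cast_sum]
      refine Finset.sum_congr rfl fun i _ => ?_
      by_cases h : ω ∈ A i <;> simp [h]
    show ∑ i ∈ I, (A i).indicator (fun _ => (1 : ℝ)) ω ≤ C
    rw [this]
    exact hC ω
  simpa using h2

theorem IsPer.measureReal_trif_eq_zero {φ : Measure CL} [IsProbabilityMeasure φ] {K : ℤ}
    (hK : IsPer φ K) (n : ℕ) : φ.real {ω | Trif ω (boxE n)} = 0 := by
  classical
  by_contra hne
  set c := φ.real {ω | Trif ω (boxE n)} with hc
  have hcpos : 0 < c := lt_of_le_of_ne measureReal_nonneg (Ne.symm hne)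
  have hK0 := hK.pos
  obtain ⟨L, hL⟩ : ∃ L : ℕ, (L : ℤ) = K * (2 * n + 1) := ⟨(K * (2 * n + 1)).toNat, by
    rw [Int.toNat_of_nonneg (by positivity)]⟩
  set t : ℕ × ℕ → V := fun i => (K * ((2 * n + 1) * i.1), K * ((2 * n + 1) * i.2)) with ht
  have hlat : ∀ i, IsLatticeVec (t i) := fun i => hK.isLatticeVec _ _
  set b : ℕ × ℕ → Finset EL := fun i => (boxE n).image (shiftEdge (t i) (hlat i)) with hb
  have hLn : (2 * n : ℤ) < L := by
    rw [hL]
    nlinarith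
  have htL : ∀ i, t i = (((L : ℤ) * (i.1 : ℤ), (L : ℤ) * (i.2 : ℤ)) : V) := fun i => by
    rw [ht, hL]
    refine Prod.ext ?_ ?_ <;> simp only <;> ring
  have hvb : ∀ i, ∀ v ∈ vertexSet AdjL (b i), |v.1 - L * i.1| ≤ n ∧ |v.2 - L * i.2| ≤ n := by
    intro i v hv
    rw [hb, vertexSet_map_shiftEdge] at hv
    obtain ⟨w, hw, rfl⟩ := hv
    have := nrm_le.1 (nrm_le_of_mem_vertexSet_boxE hw)
    rw [htL]
    simpa [shiftV] using this
  have hclose : ∀ i j : ℕ, ∀ x : ℤ, |x - L * i| ≤ n → |x - L * j| ≤ n → i = j := by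
    intro i j x h1 h2
    rw [abs_le] at h1 h2
    by_contra h
    rcases Nat.lt_or_gt_of_ne h with h | h
    · have : (i : ℤ) + 1 ≤ j := by omega
      nlinarith [h1.1, h1.2, h2.1, h2.2]
    · have : (j : ℤ) + 1 ≤ i := by omega
      nlinarith [h1.1, h1.2, h2.1, h2.2]
  have hd : ∀ i j, i ≠ j → ∀ e ∈ b i, e ∉ b j := by
    intro i j hij e he he'
    obtain ⟨u, v, h, rfl⟩ := exists_eq_mkE e
    have h1 := hvb i u ⟨_, he, inc_left h⟩
    have h2 := hvb j u ⟨_, he', inc_left h⟩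
    exact hij (Prod.ext (hclose _ _ _ h1.1 h2.1) (hclose _ _ _ h1.2 h2.2))
  obtain ⟨m, hm⟩ := exists_nat_gt ((8 * L + 8 * n + 4 : ℝ) / c)
  rw [div_lt_iff₀ hcpos] at hm
  have hm1 : (1 : ℝ) ≤ m := by
    have : m ≠ 0 := by
      rintro rfl
      have h0 : (0 : ℝ) ≤ 8 * L + 8 * n + 4 := by positivity
      simp only [CharP.cast_eq_zero, zero_mul] at hm
      linarith
    exact_mod_cast Nat.one_le_iff_ne_zero.2 this
  have hub := sum_measureReal_le (μ := φ) (Finset.range m ×ˢ Finset.range m)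
    (A := fun i => {ω | Trif ω (b i)}) (fun i => measurableSet_trif _)
    (C := 4 * (2 * (L * m + n) + 1)) fun ω => by
      have := card_trif_le (ω := ω) (b := b) (n := L * m + n)
        (I := (Finset.range m ×ˢ Finset.range m).filter fun i => ω ∈ {ω | Trif ω (b i)})
        (fun i hi => (Finset.mem_filter.1 hi).2) (fun i _ j _ => hd i j) (fun i hi v hv => by
          have h1 := hvb i v hv
          have h2 := (Finset.mem_filter.1 hi).1
          rw [Finset.mem_product, Finset.mem_range, Finset.mem_range] at h2
          have h3 : (L : ℤ) * i.1 ≤ L * m := by gcongr; exact h2.1.le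
          have h4 : (L : ℤ) * i.2 ≤ L * m := by gcongr; exact h2.2.le
          have h5 : (0 : ℤ) ≤ L * i.1 := by positivity
          have h6 : (0 : ℤ) ≤ L * i.2 := by positivity
          rw [nrm_le]
          push_cast
          simp only [abs_le] at h1 ⊢
          omega)
      exact_mod_cast this
  have hlb : ∀ i, c ≤ φ.real {ω | Trif ω (b i)} := by
    intro i
    have hmp := hK.inv ((2 * n + 1) * i.1) ((2 * n + 1) * i.2) (hlat i)
    rw [hc, measureReal_def, ← hmp.measure_preimage (measurableSet_trif _).nullMeasurableSet]
    exact measureReal_mono fun ω h => Trif.shift (hlat i) h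
  have hlb' := Finset.card_nsmul_le_sum (Finset.range m ×ˢ Finset.range m)
    (fun i => φ.real {ω | Trif ω (b i)}) c fun i _ => hlb i
  rw [Finset.card_product, Finset.card_range, nsmul_eq_mul] at hlb'
  push_cast at hlb'
  have hn0 : (0 : ℝ) ≤ n := Nat.cast_nonneg n
  nlinarith [hlb'.trans hub]

/-- Three distinct infinite clusters. -/
def threeInf : Set CL := {ω | ∃ y : Fin 3 → V, (∀ i, InfCluster AdjL ω Set.univ (y i)) ∧
  ∀ i j, i ≠ j → ¬ ConnectedIn AdjL ω Set.univ (y i) (y j)}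

/-- Two distinct infinite clusters. -/
def twoInf : Set CL := {ω | ∃ u v : V, InfCluster AdjL ω Set.univ u ∧
  InfCluster AdjL ω Set.univ v ∧ ¬ ConnectedIn AdjL ω Set.univ u v}

theorem measurableSet_twoInf : MeasurableSet twoInf := by
  simp only [twoInf, Set.ofPred_exists]
  exact .iUnion fun u => .iUnion fun v => (measurableSet_infCluster _ _).inter
    ((measurableSet_infCluster _ _).inter (measurableSet_connectedIn _ _ _).compl)

theorem trif_of_threeInf {ω : CL} {y : Fin 3 → V} (hy : ∀ i, InfCluster AdjL ω Set.univ (y i))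
    (hd : ∀ i j, i ≠ j → ¬ ConnectedIn AdjL ω Set.univ (y i) (y j)) {n : ℕ}
    (hn : ∀ i, y i ∈ vertexSet AdjL (boxE n)) : Trif (repl (boxE n) (fun _ => true) ω) (boxE n) := by
  refine ⟨fun x hx y hy => connectedIn_boxE (fun e he => repl_of_mem he) hx hy, ?_⟩
  choose z hz1 hz2 hz3 using fun i => (hy i).exists_remove (boxE n)
  have hr : ∀ e ∈ {e | e ∉ boxE n}, repl (boxE n) (fun _ => true) ω e = ω e := fun e he =>
    repl_of_notMem he
  refine ⟨z, fun i => ?_, fun i => ?_, fun i j hij hc => hd i j hij ?_⟩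
  · rcases hz1 i with h | h
    exacts [h ▸ hn i, h]
  · rw [InfCluster.congr hr]
    exact (hz3 i).mono fun e he => he.2
  · rw [ConnectedIn.congr hr] at hc
    exact (hz2 i).trans ((hc.mono (Set.subset_univ _)).trans (hz2 j).symm)

theorem mem_threeInf_of_repl {ω : CL} (n : ℕ) {u v : V} (hu : InfCluster AdjL ω Set.univ u)
    (hv : InfCluster AdjL ω Set.univ v) (huv : ¬ ConnectedIn AdjL ω Set.univ u v)
    (hun : u ∈ vertexSet AdjL (boxE n)) (hvn : v ∈ vertexSet AdjL (boxE n))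
    (h : repl (boxE n) (fun _ => true) ω ∈ twoInf) : ω ∈ threeInf := by
  obtain ⟨s, t, hs, ht, hst⟩ := h
  have hr : ∀ e ∈ {e | e ∉ boxE n}, repl (boxE n) (fun _ => true) ω e = ω e := fun e he =>
    repl_of_notMem he
  have key : ∀ s, InfCluster AdjL (repl (boxE n) (fun _ => true) ω) Set.univ s →
      (∀ y ∈ vertexSet AdjL (boxE n),
        ¬ ConnectedIn AdjL (repl (boxE n) (fun _ => true) ω) Set.univ s y) → ω ∈ threeInf := by
    intro s hs hsn
    have h1 : InfCluster AdjL ω Set.univ s := by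
      have := (hs.avoid hsn).mono (S' := {e | e ∉ boxE n}) fun e he => he.2
      rw [InfCluster.congr hr] at this
      exact this.mono (Set.subset_univ _)
    have h2 : ∀ w ∈ vertexSet AdjL (boxE n), ¬ ConnectedIn AdjL ω Set.univ s w := by
      intro w hw hc
      obtain ⟨y, hy, hc⟩ := hc.exists_hit hw
      have := hc.mono (S' := {e | e ∉ boxE n}) fun e he => he.2
      rw [← ConnectedIn.congr hr] at this
      exact hsn y hy (this.mono (Set.subset_univ _))
    refine ⟨![s, u, v], fun i => ?_, fun i j hij => ?_⟩
    · fin_cases i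
      exacts [h1, hu, hv]
    · fin_cases i <;> fin_cases j
      · exact absurd rfl hij
      · exact h2 u hun
      · exact h2 v hvn
      · exact fun h => h2 u hun h.symm
      · exact absurd rfl hij
      · exact huv
      · exact fun h => h2 v hvn h.symm
      · exact fun h => huv h.symm
      · exact absurd rfl hij
  by_cases hsn : ∀ y ∈ vertexSet AdjL (boxE n),
      ¬ ConnectedIn AdjL (repl (boxE n) (fun _ => true) ω) Set.univ s y
  · exact key s hs hsn
  · refine key t ht fun y' hy' hc' => ?_
    push Not at hsn
    obtain ⟨y, hy, hc⟩ := hsn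
    refine hst (hc.trans (ConnectedIn.trans ?_ hc'.symm))
    exact (connectedIn_boxE (fun e he => repl_of_mem he) hy hy').mono (Set.subset_univ _)

/-- Almost surely, after removal of any finite set of edges, there is at most one infinite
cluster. -/
theorem ae_unique {p q : ℝ} (hp0 : 0 < p) (hp1 : p < 1) (hq : 1 ≤ q) {φ : Measure CL}
    (hφ : IsGibbs AdjL 4 p q φ) (htail : TailTrivial AdjL φ) {K : ℤ} (hK : IsPer φ K) :
    ∀ᵐ ω ∂φ, ∀ (D : Finset EL) (u v : V), InfCluster AdjL ω {e | e ∉ D} u →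
      InfCluster AdjL ω {e | e ∉ D} v → ConnectedIn AdjL ω {e | e ∉ D} u v := by
  classical
  have := hφ.1
  have h3 : ∀ᵐ ω ∂φ, ω ∉ threeInf := by
    have h : ∀ᵐ ω ∂φ, ∀ n : ℕ, ¬ Trif (repl (boxE n) (fun _ => true) ω) (boxE n) :=
      ae_all_iff.2 fun n => ae_repl hp0 hp1 hq hφ (P := fun ω => ¬ Trif ω (boxE n))
        (measure_eq_zero_iff_ae_notMem.1
          ((measureReal_eq_zero_iff).1 (hK.measureReal_trif_eq_zero n))) _ _
    filter_upwards [h] with ω hω ⟨y, hy, hd⟩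
    obtain ⟨n, hn⟩ := exists_mem_vertexSet_boxE (S := Finset.univ.image y) fun u hu => by
      obtain ⟨i, -, rfl⟩ := Finset.mem_image.1 hu
      exact (hy i).exists_inc
    exact hω n (trif_of_threeInf hy hd fun i => hn _ (by simp))
  have h2 : ∀ᵐ ω ∂φ, ω ∉ twoInf := by
    rcases hK.zero_or_one hp0 hp1 hq hφ htail measurableSet_twoInf (by
      intro t ht
      have hS : ∀ e : EL, e ∈ Set.univ ↔ shiftEdge t ht e ∈ (Set.univ : Set EL) := fun _ => Iff.rfl
      ext ω
      constructor
      · rintro ⟨u, v, h1, h2, h3⟩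
        exact ⟨_, _, (infCluster_shift ht hS).1 h1, (infCluster_shift ht hS).1 h2,
          fun h => h3 ((connectedIn_shift ht hS).2 h)⟩
      · rintro ⟨u, v, h1, h2, h3⟩
        rw [← shiftV_shiftV_neg t u] at h1 h3
        rw [← shiftV_shiftV_neg t v] at h2 h3
        exact ⟨_, _, (infCluster_shift ht hS).2 h1, (infCluster_shift ht hS).2 h2,
          fun h => h3 ((connectedIn_shift ht hS).1 h)⟩) with h0 | h1
    · exact measure_eq_zero_iff_ae_notMem.1 ((measureReal_eq_zero_iff).1 h0)
    · exfalso
      have h1' : ∀ᵐ ω ∂φ, ω ∈ twoInf := by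
        have : φ twoInf = 1 := by
          rw [← ENNReal.toReal_eq_one_iff]
          exact h1
        exact (prob_compl_eq_zero_iff measurableSet_twoInf).2 this
      have h : ∀ᵐ ω ∂φ, ∀ n : ℕ, repl (boxE n) (fun _ => true) ω ∈ twoInf :=
        ae_all_iff.2 fun n => ae_repl hp0 hp1 hq hφ (P := fun ω => ω ∈ twoInf) h1' _ _
      obtain ⟨ω, ⟨u, v, hu, hv, huv⟩, hω3, hω⟩ := (h1'.and (h3.and h)).exists
      obtain ⟨n, hn⟩ := exists_mem_vertexSet_boxE (S := {u, v}) fun w hw => by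
        simp only [Finset.mem_insert, Finset.mem_singleton] at hw
        rcases hw with rfl | rfl
        exacts [hu.exists_inc, hv.exists_inc]
      exact hω3 (mem_threeInf_of_repl n hu hv huv (hn u (by simp)) (hn v (by simp)) (hω n))
  have h : ∀ᵐ ω ∂φ, ∀ D : Finset EL, repl D (fun _ => false) ω ∉ twoInf :=
    ae_all_iff.2 fun D => ae_repl hp0 hp1 hq hφ (P := fun ω => ω ∉ twoInf) h2 _ _
  filter_upwards [h] with ω hω D u v hu hv
  by_contra huv
  have hr : ∀ e, ω e = true → e ∈ {e | e ∉ D} →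
      e ∈ (Set.univ : Set EL) ∧ repl D (fun _ => false) ω e = true := fun e he heD =>
    ⟨trivial, (repl_of_notMem heD).trans he⟩
  refine hω D ⟨u, v, hu.mono' fun e he ho => hr e ho he, hv.mono' fun e he ho => hr e ho he,
    fun hc => huv (hc.mono' fun e _ ho => ?_)⟩
  by_cases he : e ∈ D
  · rw [repl_of_mem he] at ho
    cases ho
  · exact ⟨he, (repl_of_notMem he).symm.trans ho⟩

/-! ### Crossing parity of loops around dual vertices -/

/-- The edge `{u, v}` crosses the ray issued from the dual vertex `w` in direction `(1, 1)`. -/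
def ray (w u v : V) : Prop :=
  w.1 + w.2 < u.1 + u.2 ∧ w.1 + w.2 < v.1 + v.2 ∧ ¬ (u.1 - u.2 < w.1 - w.2 ↔ v.1 - v.2 < w.1 - w.2)

theorem ray_symm {w u v : V} : ray w u v ↔ ray w v u := by
  unfold ray
  tauto

theorem ray_shiftV {t w u v : V} : ray (shiftV t w) (shiftV t u) (shiftV t v) ↔ ray w u v := by
  simp only [ray, shiftV]
  omega

/-- A step along an open edge of `S`, recording the parity of the number of edges in `h`. -/
def LiftStep (h : V → V → Prop) (ω : CL) (S : Set EL) (a b : V × Bool) : Prop :=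
  ∃ e, e ∈ S ∧ ω e = true ∧ Inc AdjL a.1 e ∧ Inc AdjL b.1 e ∧
    (b.2 = true ↔ ¬ (a.2 = true ↔ h a.1 b.1))

/-- Connection by an open path in `S`, recording the parity of the number of edges in `h`. -/
def LiftConn (h : V → V → Prop) (ω : CL) (S : Set EL) : V × Bool → V × Bool → Prop :=
  Relation.ReflTransGen (LiftStep h ω S)

section Lift

variable {h h' : V → V → Prop} {ω ω' : CL} {S S' : Set EL} {a b : V} {s t : Bool}

theorem LiftConn.mono' {x y : V × Bool} (hc : LiftConn h ω S x y)
    (hS : ∀ e ∈ S, ω e = true → e ∈ S' ∧ ω' e = true) : LiftConn h ω' S' x y := by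
  refine Relation.ReflTransGen.mono ?_ _ _ hc
  rintro a b ⟨e, h1, h2, h3⟩
  exact ⟨e, (hS e h1 h2).1, (hS e h1 h2).2, h3⟩

theorem LiftConn.mono {x y : V × Bool} (hc : LiftConn h ω S x y) (hS : S ⊆ S') :
    LiftConn h ω S' x y :=
  hc.mono' fun _ he ho => ⟨hS he, ho⟩

theorem LiftConn.congr {x y : V × Bool} (hω : ∀ e ∈ S, ω e = ω' e) :
    LiftConn h ω S x y ↔ LiftConn h ω' S x y :=
  ⟨fun hc => hc.mono' fun e he ho => ⟨he, hω e he ▸ ho⟩,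
    fun hc => hc.mono' fun e he ho => ⟨he, (hω e he).symm ▸ ho⟩⟩

theorem LiftConn.connectedIn {x y : V × Bool} (hc : LiftConn h ω S x y) :
    ConnectedIn AdjL ω S x.1 y.1 := by
  refine Relation.ReflTransGen.lift Prod.fst ?_ _ _ hc
  rintro a b ⟨e, h1, h2, h3, h4, -⟩
  exact ⟨e, h1, h2, h3, h4⟩

open Classical in
theorem LiftConn.gauge (g : V → Prop) (hc : LiftConn h ω S (a, s) (b, t))
    (hg : ∀ e ∈ S, ω e = true → ∀ u v, Inc AdjL u e → Inc AdjL v e →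
      (h' u v ↔ (h u v ↔ (g u ↔ g v)))) :
    LiftConn h' ω S (a, decide (¬ (s = true ↔ g a))) (b, decide (¬ (t = true ↔ g b))) := by
  refine Relation.ReflTransGen.lift (fun x : V × Bool => (x.1, decide (¬ (x.2 = true ↔ g x.1))))
    ?_ _ _ hc
  rintro ⟨x, s⟩ ⟨y, t⟩ ⟨e, h1, h2, h3, h4, h5⟩
  refine ⟨e, h1, h2, h3, h4, ?_⟩
  have := hg e h1 h2 x y h3 h4
  simp only [decide_eq_true_eq] at h5 ⊢
  tauto

theorem LiftConn.flip (hc : LiftConn h ω S (a, s) (b, t)) :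
    LiftConn h ω S (a, !s) (b, !t) := by
  have := hc.gauge (h' := h) (fun _ => True) (fun _ _ _ _ _ _ _ => by tauto)
  cases s <;> cases t <;> simpa using this

theorem LiftConn.symm (hh : ∀ u v, h u v ↔ h v u) {x y : V × Bool} (hc : LiftConn h ω S x y) :
    LiftConn h ω S y x := by
  refine reflTransGen_symm ?_ hc
  rintro ⟨a, s⟩ ⟨b, t⟩ ⟨e, h1, h2, h3, h4, h5⟩
  refine ⟨e, h1, h2, h4, h3, ?_⟩
  have := hh a b
  simp only at h5 ⊢
  tauto

theorem ConnectedIn.exists_liftConn (h : V → V → Prop) (hc : ConnectedIn AdjL ω S a b) (s : Bool) :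
    ∃ t, LiftConn h ω S (a, s) (b, t) := by
  classical
  induction hc with
  | refl => exact ⟨s, .refl⟩
  | @tail b c _ hstep ih =>
    obtain ⟨t, ht⟩ := ih
    obtain ⟨e, h1, h2, h3, h4⟩ := hstep
    refine ⟨decide (¬ (t = true ↔ h b c)), Relation.ReflTransGen.tail ht ⟨e, h1, h2, h3, h4, ?_⟩⟩
    simp only [decide_eq_true_eq]

theorem LiftConn.parity_of_exact (g : V → Prop) (hc : LiftConn h ω S (a, s) (b, t))
    (hg : ∀ e ∈ S, ∀ u v, Inc AdjL u e → Inc AdjL v e → (h u v ↔ ¬ (g u ↔ g v))) :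
    (s = true ↔ g a) ↔ (t = true ↔ g b) := by
  have key : ∀ x y : V × Bool, LiftConn h ω S x y → ((x.2 = true ↔ g x.1) ↔ (y.2 = true ↔ g y.1)) := by
    intro x y hc
    induction hc with
    | refl => rfl
    | @tail y z _ hstep ih =>
      obtain ⟨e, h1, h2, h3, h4, h5⟩ := hstep
      have := hg e h1 y.1 z.1 h3 h4
      tauto
  exact key _ _ hc

theorem ConnectedIn.liftConn_of_eq_zero (hc : ConnectedIn AdjL ω S a b)
    (hh : ∀ e ∈ S, ∀ u v, Inc AdjL u e → Inc AdjL v e → ¬ h u v) (s : Bool) :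
    LiftConn h ω S (a, s) (b, s) := by
  obtain ⟨t, ht⟩ := hc.exists_liftConn h s
  have := ht.parity_of_exact (fun _ => False) fun e he u v hu hv => by
    have := hh e he u v hu hv
    tauto
  cases s <;> cases t <;> first | exact ht | simp at this

end Lift

theorem ray_of_diag {a b x y : ℤ} : ray (x, y) (a, b) (a + 1, b + 1) ↔ False :=
  iff_of_false (fun h => h.2.2 (by dsimp only; constructor <;> intro <;> omega)) not_false

theorem ray_of_diag' {a b x y : ℤ} : ray (x, y) (a, b) (a - 1, b - 1) ↔ False :=
  iff_of_false (fun h => h.2.2 (by dsimp only; constructor <;> intro <;> omega)) not_false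

theorem ray_of_antidiag {a b x y : ℤ} (hu : (a + b) % 2 = 0)
    (h1 : (x + y) % 2 = 1) :
    ray (x, y) (a, b) (a + 1, b - 1) ↔ x + y < a + b ∧ x - y = a - b + 1 := by
  simp only [ray, not_iff, not_lt]
  refine ⟨fun ⟨h1, h2, h3⟩ => ⟨h1, ?_⟩, fun ⟨h1, h2⟩ => ⟨h1, by omega, by omega⟩⟩
  omega

theorem ray_of_antidiag' {a b x y : ℤ} (hu : (a + b) % 2 = 0)
    (h1 : (x + y) % 2 = 1) :
    ray (x, y) (a, b) (a - 1, b + 1) ↔ x + y < a + b ∧ x - y = a - b - 1 := by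
  simp only [ray, not_iff, not_lt]
  refine ⟨fun ⟨h1, h2, h3⟩ => ⟨h1, ?_⟩, fun ⟨h1, h2⟩ => ⟨h1, by omega, by omega⟩⟩
  omega

theorem ray_dualStep {ω : CL} {w w' : V} (hs : DualStep ω Set.univ w w') :
    ∃ g : V → Prop, ∀ e, ω e = true → ∀ u v, Inc AdjL u e → Inc AdjL v e →
      (ray w' u v ↔ (ray w u v ↔ (g u ↔ g v))) := by
  obtain ⟨h1, h2, h3, h4, hE, -, hcl⟩ := hs
  have h3 : w'.1 = w.1 + 1 ∨ w'.1 = w.1 - 1 := by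
    rcases mul_self_eq_one_iff.1 ((sq _).symm.trans h3) with h | h <;> omega
  have h4 : w'.2 = w.2 + 1 ∨ w'.2 = w.2 - 1 := by
    rcases mul_self_eq_one_iff.1 ((sq _).symm.trans h4) with h | h <;> omega
  refine ⟨fun v => w'.1 - w.1 ≠ w'.2 - w.2 ∧ w.1 + w.2 < v.1 + v.2 ∧
    v.1 - v.2 = w.1 - w.2 + (w'.1 - w.1), fun e he u v hu hv => ?_⟩
  rcases hu.eq_or_adj hv with rfl | ⟨hadj, rfl⟩
  · unfold ray
    tauto
  · have hne : ¬ (u = (w.1, w'.2) ∧ v = (w'.1, w.2)) ∧ ¬ (v = (w.1, w'.2) ∧ u = (w'.1, w.2)) := by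
      constructor
      · rintro ⟨rfl, rfl⟩
        have : ω (mkE _ _ hadj) = false := hcl
        rw [he] at this
        cases this
      · rintro ⟨rfl, rfl⟩
        have h5 : mkE _ _ hadj = (⟨crossSym w w', hE⟩ : EL) := Subtype.ext Sym2.eq_swap
        rw [h5, hcl] at he
        cases he
    obtain ⟨hev, hx, hy⟩ := adjL_iff.1 hadj
    clear he hcl hE
    obtain ⟨a, b⟩ := u
    obtain ⟨c, d⟩ := v
    obtain ⟨x, y⟩ := w
    obtain ⟨x', y'⟩ := w'
    simp only [IsDualV, Int.odd_iff, Int.even_iff, Prod.mk.injEq] at *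
    rcases hx with rfl | rfl <;> rcases hy with rfl | rfl
    · rw [ray_of_diag, ray_of_diag, false_iff, false_iff, not_not]
      rcases h3 with rfl | rfl <;> rcases h4 with rfl | rfl <;> omega
    · rw [ray_of_antidiag hev h1, ray_of_antidiag hev h2]
      rcases h3 with rfl | rfl <;> rcases h4 with rfl | rfl <;> omega
    · rw [ray_of_antidiag' hev h1, ray_of_antidiag' hev h2]
      rcases h3 with rfl | rfl <;> rcases h4 with rfl | rfl <;> omega
    · rw [ray_of_diag', ray_of_diag', false_iff, false_iff, not_not]
      rcases h3 with rfl | rfl <;> rcases h4 with rfl | rfl <;> omega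

theorem ray_exact_of_far {R : ℤ} {w : V} (hw : 2 * R < nrm w) :
    ∃ g : V → Prop, ∀ e ∈ boxE R, ∀ u v, Inc AdjL u e → Inc AdjL v e →
      (ray w u v ↔ ¬ (g u ↔ g v)) := by
  refine ⟨fun v => w.1 + w.2 < -(2 * R) ∧ v.1 - v.2 < w.1 - w.2, fun e he u v hu hv => ?_⟩
  have h1 := mem_boxE.1 he u hu
  have h2 := mem_boxE.1 he v hv
  have h3 : ¬ nrm w ≤ 2 * R := not_le.2 hw
  rw [nrm_le] at h3
  simp only [abs_le] at h1 h2 h3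
  unfold ray
  omega

theorem not_liftConn_of_dualInfCluster {ω : CL} {w a : V} {R : ℤ} {s : Bool}
    (hw : DualInfCluster ω Set.univ w) :
    ¬ LiftConn (ray w) ω ↑(boxE R) (a, s) (a, !s) := by
  intro hc
  have key : ∀ w', DualConnectedIn ω Set.univ w w' →
      LiftConn (ray w') ω ↑(boxE R) (a, false) (a, true) := by
    intro w' hw'
    induction hw' with
    | refl => cases s <;> first | exact hc | exact hc.flip
    | tail _ hs ih =>
      obtain ⟨g, hg⟩ := ray_dualStep hs
      have := ih.gauge g fun e _ he => hg e he
      by_cases hga : g a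
      · simpa [hga] using this.flip
      · simpa [hga] using this
  obtain ⟨w', hw', hn⟩ : ∃ w' ∈ {w' | DualConnectedIn ω Set.univ w w'}, w' ∉ {v | nrm v ≤ 2 * R} :=
    hw.exists_notMem_finite (finite_nrm_le _)
  obtain ⟨g, hg⟩ := ray_exact_of_far (R := R) (w := w') (not_le.1 hn)
  have := (key w' hw').parity_of_exact g hg
  simp at this

/-! ### Infinite primal and dual clusters do not coexist -/

theorem exists_sub_le_measureReal {φ : Measure CL} [IsProbabilityMeasure φ] {A : ℕ → Set CL}
    (hA : Monotone A) {S : Set CL} (h : ∀ᵐ ω ∂φ, ω ∈ S → ∃ n, ω ∈ A n) {ε : ℝ} (hε : 0 < ε) :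
    ∃ n, φ.real S - ε ≤ φ.real (A n) := by
  have h1 : Tendsto (fun n => φ.real (A n)) atTop (nhds (φ.real (⋃ n, A n))) :=
    (ENNReal.tendsto_toReal (measure_ne_top _ _)).comp (tendsto_measure_iUnion_atTop hA)
  have h2 : φ.real S ≤ φ.real (⋃ n, A n) := by
    refine ENNReal.toReal_mono (measure_ne_top _ _) (measure_mono_ae ?_)
    filter_upwards [h] with ω hω hS
    exact Set.mem_iUnion.2 (hω hS)
  obtain ⟨n, hn⟩ := (h1.eventually (eventually_ge_nhds (show φ.real S - ε < _ by linarith))).exists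
  exact ⟨n, hn⟩

/-- The dual vertex `(1, 0)` is in an infinite dual cluster, and all edges of a box are closed. -/
def dualInfClosed (m : ℤ) : Set CL :=
  {ω | DualInfCluster ω Set.univ (1, 0) ∧ ∀ e ∈ boxE m, ω e = false}

theorem measurableSet_dualInfClosed (m : ℤ) : MeasurableSet (dualInfClosed m) :=
  (measurableSet_dualInfCluster _ _).inter
    (DepOn.measurableSet (D := boxE m) fun _ _ h => forall₂_congr fun e he => by rw [h e he])

theorem measureReal_dualInfClosed_pos {p q : ℝ} (hp0 : 0 < p) (hp1 : p < 1) (hq : 1 ≤ q)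
    {φ : Measure CL} (hφ : IsGibbs AdjL 4 p q φ)
    (hd : φ {ω | DualInfCluster ω Set.univ (1, 0)} ≠ 0) (m : ℤ) :
    0 < φ.real (dualInfClosed m) := by
  have := hφ.1
  refine lt_of_le_of_ne measureReal_nonneg fun h0 => hd ?_
  have h1 := ae_repl hp0 hp1 hq hφ (P := fun ω => ω ∉ dualInfClosed m)
    (measure_eq_zero_iff_ae_notMem.1 ((measureReal_eq_zero_iff).1 h0.symm)) (boxE m)
    (fun _ => false)
  refine measure_eq_zero_iff_ae_notMem.2 ?_
  filter_upwards [h1] with ω hω hdual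
  refine hω ⟨hdual.mono' fun e _ he => ⟨trivial, ?_⟩, fun e he => repl_of_mem he⟩
  by_cases h : e ∈ boxE m
  exacts [repl_of_mem h, (repl_of_notMem h).trans he]

theorem ray_congr_of_mem_dualInfClosed {K : ℤ} (hK : 0 < K) {ω : CL} (hω : ω ∈ dualInfClosed (K + 1))
    {e : EL} (he : ω e = true) {u v : V} (hu : Inc AdjL u e) (hv : Inc AdjL v e) :
    ray (1, 0) u v ↔ ray (1 + K, K) u v := by
  rcases hu.eq_or_adj hv with rfl | ⟨hadj, rfl⟩
  · unfold ray
    tauto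
  have hn : mkE u v hadj ∉ boxE (K + 1) := fun h => by
    rw [hω.2 _ h] at he
    cases he
  rw [mem_boxE_mkE] at hn
  obtain ⟨hev, hx, hy⟩ := adjL_iff.1 hadj
  obtain ⟨a, b⟩ := u
  obtain ⟨c, d⟩ := v
  simp only [Int.even_iff, abs_le] at hev hx hy hn
  have h2 : (1 + K + K) % 2 = 1 := by omega
  rcases hx with rfl | rfl <;> rcases hy with rfl | rfl
  · rw [ray_of_diag, ray_of_diag]
  · rw [ray_of_antidiag hev (by norm_num), ray_of_antidiag hev h2]
    omega
  · rw [ray_of_antidiag' hev (by norm_num), ray_of_antidiag' hev h2]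
    omega
  · rw [ray_of_diag', ray_of_diag']

/-- All crossings of the annulus between the boxes of sizes `n` and `R` are connected to each
other inside this annulus. -/
def annulusUnique (n R : ℕ) : Set CL :=
  {ω | ∀ a ∈ vertexSet AdjL (boxE n), ∀ a' ∈ vertexSet AdjL (boxE n),
    (∃ v, (R : ℤ) < nrm v ∧ ConnectedIn AdjL ω {e | e ∉ boxE n} a v) →
    (∃ v, (R : ℤ) < nrm v ∧ ConnectedIn AdjL ω {e | e ∉ boxE n} a' v) →
    ConnectedIn AdjL ω {e | e ∈ boxE R ∧ e ∉ boxE n} a a'}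

theorem measurableSet_annulusUnique (n R : ℕ) : MeasurableSet (annulusUnique n R) := by
  have h (a : V) : MeasurableSet {ω : CL | ∃ v, (R : ℤ) < nrm v ∧
      ConnectedIn AdjL ω {e | e ∉ boxE n} a v} := by
    rw [Set.ofPred_exists]
    exact .iUnion fun v => (MeasurableSet.const _).inter (measurableSet_connectedIn _ _ _)
  have h' (a a' : V) : MeasurableSet {ω : CL |
      (∃ v, (R : ℤ) < nrm v ∧ ConnectedIn AdjL ω {e | e ∉ boxE n} a v) →
      (∃ v, (R : ℤ) < nrm v ∧ ConnectedIn AdjL ω {e | e ∉ boxE n} a' v) →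
      ConnectedIn AdjL ω {e | e ∈ boxE R ∧ e ∉ boxE n} a a'} :=
    (h a).imp ((h a').imp (measurableSet_connectedIn _ _ _))
  simp only [annulusUnique, Set.ofPred_forall]
  exact .iInter fun a => .iInter fun _ => .iInter fun a' => .iInter fun _ => h' a a'

theorem exists_annulusUnique {p q : ℝ} (hp0 : 0 < p) (hp1 : p < 1) (hq : 1 ≤ q) {φ : Measure CL}
    (hφ : IsGibbs AdjL 4 p q φ) (htail : TailTrivial AdjL φ) {K : ℤ} (hK : IsPer φ K) (n : ℕ)
    {ε : ℝ} (hε : 0 < ε) : ∃ R, 1 - ε ≤ φ.real (annulusUnique n R) := by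
  have := hφ.1
  have hmono : Monotone (annulusUnique n) := by
    rintro R R' hR ω hω a ha a' ha' ⟨v, hv, h1⟩ ⟨v', hv', h2⟩
    have hR' : (R : ℤ) ≤ R' := by exact_mod_cast hR
    exact (hω a ha a' ha' ⟨v, by omega, h1⟩ ⟨v', by omega, h2⟩).mono
      fun e he => ⟨boxE_mono hR' he.1, he.2⟩
  obtain ⟨R, hR⟩ := exists_sub_le_measureReal (φ := φ) hmono (S := Set.univ) (by
    filter_upwards [ae_unique hp0 hp1 hq hφ htail hK] with ω hω _
    have hfin : ∀ x : V × V, ∃ R : ℕ, x.1 ∈ vertexSet AdjL (boxE n) →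
        x.2 ∈ vertexSet AdjL (boxE n) →
        (∃ v, (R : ℤ) < nrm v ∧ ConnectedIn AdjL ω {e | e ∉ boxE n} x.1 v) →
        (∃ v, (R : ℤ) < nrm v ∧ ConnectedIn AdjL ω {e | e ∉ boxE n} x.2 v) →
        ConnectedIn AdjL ω {e | e ∈ boxE R ∧ e ∉ boxE n} x.1 x.2 := by
      have hbd : ∀ a, ¬ InfCluster AdjL ω {e | e ∉ boxE n} a → ∃ R : ℕ, ∀ v,
          ConnectedIn AdjL ω {e | e ∉ boxE n} a v → nrm v ≤ R := by
        intro a ha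
        obtain ⟨M, hM⟩ := ((Set.not_infinite.1 ha).image nrm).bddAbove
        exact ⟨M.toNat, fun v hv => (hM ⟨v, hv, rfl⟩).trans (Int.self_le_toNat _)⟩
      rintro ⟨a, a'⟩
      by_cases h1 : InfCluster AdjL ω {e | e ∉ boxE n} a
      · by_cases h2 : InfCluster AdjL ω {e | e ∉ boxE n} a'
        · obtain ⟨F, hF, hc⟩ := (hω _ _ _ h1 h2).exists_finset
          obtain ⟨R, hR⟩ := exists_subset_boxE F
          exact ⟨R, fun _ _ _ _ => hc.mono fun e he => ⟨hR he, hF he⟩⟩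
        · obtain ⟨R, hR⟩ := hbd a' h2
          exact ⟨R, fun _ _ _ ⟨v, h3, h4⟩ => absurd (hR v h4) (not_le.2 h3)⟩
      · obtain ⟨R, hR⟩ := hbd a h1
        exact ⟨R, fun _ _ ⟨v, h3, h4⟩ => absurd (hR v h4) (not_le.2 h3)⟩
    choose f hf using hfin
    obtain ⟨R, hR⟩ : ∃ R, ∀ x ∈ vertexSet AdjL (boxE n) ×ˢ vertexSet AdjL (boxE n), f x ≤ R := by
      obtain ⟨R, hR⟩ := (((finite_vertexSet (boxE n)).prod (finite_vertexSet (boxE n))).image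
        f).bddAbove
      exact ⟨R, fun x hx => hR ⟨x, hx, rfl⟩⟩
    refine ⟨R, fun a ha a' ha' ⟨v, hv, h1⟩ ⟨v', hv', h2⟩ => ?_⟩
    have hR' : ((f (a, a') : ℕ) : ℤ) ≤ R := by exact_mod_cast hR (a, a') ⟨ha, ha'⟩
    exact (hf (a, a') ha ha' ⟨v, by omega, h1⟩ ⟨v', by omega, h2⟩).mono
      fun e he => ⟨boxE_mono hR' he.1, he.2⟩) hε
  exact ⟨R, by simpa using hR⟩

theorem exists_hit_infCluster {φ : Measure CL} [IsProbabilityMeasure φ]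
    (hi : ∀ᵐ ω ∂φ, ∃ u, InfCluster AdjL ω Set.univ u) {ε : ℝ} (hε : 0 < ε) :
    ∃ n : ℕ, 1 - ε ≤ φ.real {ω | ∃ a ∈ vertexSet AdjL (boxE n), InfCluster AdjL ω Set.univ a} := by
  obtain ⟨n, hn⟩ := exists_sub_le_measureReal (φ := φ)
    (A := fun n : ℕ => {ω | ∃ a ∈ vertexSet AdjL (boxE n), InfCluster AdjL ω Set.univ a})
    (fun n m hnm ω ⟨a, ha, h⟩ => ⟨a, vertexSet_mono (boxE_mono (by exact_mod_cast hnm)) ha, h⟩)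
    (S := Set.univ) (by
      filter_upwards [hi] with ω ⟨u, hu⟩ _
      obtain ⟨n, hn⟩ := exists_mem_vertexSet_boxE (S := {u}) fun w hw => by
        rw [Finset.mem_singleton.1 hw]
        exact hu.exists_inc
      exact ⟨n, u, hn u (by simp), hu⟩) hε
  exact ⟨n, by simpa using hn⟩

theorem measurableSet_hit_infCluster (D : Finset EL) :
    MeasurableSet {ω | ∃ a ∈ vertexSet AdjL D, InfCluster AdjL ω Set.univ a} := by
  rw [Set.ofPred_exists]
  exact .iUnion fun v => (MeasurableSet.const _).inter (measurableSet_infCluster _ _)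

theorem exists_mem_not_mem_succ {P : ℤ → Prop} {a b : ℤ} (hab : a ≤ b) (ha : P a) (hb : ¬ P b) :
    ∃ k, P k ∧ ¬ P (k + 1) := by
  by_contra! h
  exact hb (Int.leInduction ha (fun k _ hk => h k hk) b hab)

/-- Two boxes are joined by an open path outside of them whose parity is prescribed. -/
def parityCross (w : V) (B B' D : Finset EL) (s : Bool) : Set CL :=
  {ω | ∃ a ∈ vertexSet AdjL B, ∃ b ∈ vertexSet AdjL B',
    LiftConn (ray w) ω {e | e ∈ D ∧ e ∉ B ∧ e ∉ B'} (a, false) (b, s)}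

theorem depOn_parityCross (w : V) (B B' D : Finset EL) (s : Bool) :
    DepOn ↑D (parityCross w B B' D s) := by
  intro ω ω' h
  have : ∀ x y, LiftConn (ray w) ω {e | e ∈ D ∧ e ∉ B ∧ e ∉ B'} x y ↔
      LiftConn (ray w) ω' {e | e ∈ D ∧ e ∉ B ∧ e ∉ B'} x y := fun x y =>
    LiftConn.congr fun e he => h e he.1
  simp only [parityCross, Set.mem_ofPred_eq, this]

theorem isUpperSet_parityCross (w : V) (B B' D : Finset EL) (s : Bool) :
    IsUpperSet (parityCross w B B' D s) := by
  rintro ω ω' h ⟨a, ha, b, hb, hc⟩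
  exact ⟨a, ha, b, hb, hc.mono' fun e he ho => ⟨he, by
    have := h e
    rw [ho] at this
    exact Bool.eq_true_of_true_le this⟩⟩

theorem ConnectedIn.mem_parityCross {ω : CL} {B B' D : Finset EL} {a b : V}
    (hc : ConnectedIn AdjL ω ↑D a b) (ha : a ∈ vertexSet AdjL B) (hb : b ∈ vertexSet AdjL B') (w : V) :
    ω ∈ parityCross w B B' D true ∪ parityCross w B B' D false := by
  obtain ⟨b, hb, hc⟩ := hc.exists_hit hb
  obtain ⟨a, ha, hc⟩ := hc.symm.exists_hit ha
  obtain ⟨s, hs⟩ := hc.symm.exists_liftConn (ray w) false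
  have := hs.mono (S' := {e | e ∈ D ∧ e ∉ B ∧ e ∉ B'}) fun e he => ⟨he.1.1, he.2, he.1.2⟩
  cases s
  · exact Or.inr ⟨a, ha, b, hb, this⟩
  · exact Or.inl ⟨a, ha, b, hb, this⟩

theorem not_ray_of_iff {w u v : V} (h : u.1 - u.2 < w.1 - w.2 ↔ v.1 - v.2 < w.1 - w.2) :
    ¬ ray w u v :=
  fun hr => hr.2.2 h

/-- Two crossings of different parity around neighbouring ends of a closed dual segment in an
infinite dual cluster cannot be closed up to a loop. -/
theorem false_of_parityCross {ω : CL} {K J j : ℤ} (hK : 0 < K) {n R : ℕ} (hJ : (n : ℤ) + R + 1 ≤ J)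
    {t w₁ w₂ : V} (hs : IsLatticeVec (J + j, j - J)) (ht : IsLatticeVec t)
    (ht_def : t = (2 * J, -2 * J))
    (hw₁ : w₁ = (1 + (J + j), j - J)) (hw₂ : w₂ = (1 + K + (J + j), K + (j - J)))
    {D B : Finset EL} (hB : ∀ e, e ∈ boxE n ↔ shiftEdge t ht e ∈ B)
    (h1 : ω ∈ parityCross w₁ (boxE n) B D true) (h2 : ω ∈ parityCross w₂ (boxE n) B D false)
    (h3 : Shift (J + j, j - J) hs ω ∈ dualInfClosed (K + 1)) (h4 : ω ∈ annulusUnique n R)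
    (h5 : Shift t ht ω ∈ annulusUnique n R) : False := by
  classical
  have hVB : ∀ b ∈ vertexSet AdjL B, shiftV (-t) b ∈ vertexSet AdjL (boxE n) := by
    rintro b ⟨e, he, hi⟩
    refine ⟨shiftEdge (-t) ht.neg e, (hB _).2 ?_, (inc_shiftEdge ht.neg).2 hi⟩
    rwa [shiftEdge_shiftEdge_neg]
  obtain ⟨a, ha, b, hb, hab⟩ := h1
  obtain ⟨a', ha', b', hb', hab'⟩ := h2
  have hfar : ∀ b ∈ vertexSet AdjL B, (R : ℤ) < nrm b := by
    intro b hb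
    have := nrm_le.1 (nrm_le_of_mem_vertexSet_boxE (hVB b hb))
    by_contra h
    have h := nrm_le.1 (not_lt.1 h)
    simp only [shiftV, ht_def, abs_le, Prod.fst_neg] at this h
    omega
  have hfar' : ∀ a ∈ vertexSet AdjL (boxE n), (R : ℤ) < nrm (shiftV (-t) a) := by
    intro b hb
    have := nrm_le.1 (nrm_le_of_mem_vertexSet_boxE hb)
    by_contra h
    have h := nrm_le.1 (not_lt.1 h)
    simp only [shiftV, ht_def, abs_le, Prod.fst_neg] at this h
    omega
  set S : Set EL := {e | e ∈ D ∧ e ∉ boxE n ∧ e ∉ B}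
  have hout : ∀ {a b}, b ∈ vertexSet AdjL B → ConnectedIn AdjL ω S a b →
      ∃ v, (R : ℤ) < nrm v ∧ ConnectedIn AdjL ω {e | e ∉ boxE n} a v :=
    fun {a b} hb h => ⟨b, hfar b hb, h.mono fun e he => he.2.1⟩
  have hout' : ∀ {a b}, a ∈ vertexSet AdjL (boxE n) → ConnectedIn AdjL ω S a b →
      ∃ v, (R : ℤ) < nrm v ∧
        ConnectedIn AdjL (Shift t ht ω) {e | e ∉ boxE n} (shiftV (-t) b) v :=
    fun {a b} ha h => ⟨shiftV (-t) a, hfar' a ha, by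
      have := connectedIn_shift ht (ω := ω) (S := {e | e ∉ boxE n}) (S' := {e | e ∉ B})
        (fun e => not_congr (hB e)) (u := shiftV (-t) b) (v := shiftV (-t) a)
      rw [this, shiftV_shiftV_neg, shiftV_shiftV_neg]
      exact h.symm.mono fun e he => he.2.2⟩
  have haa := h4 a ha a' ha' (hout hb hab.connectedIn) (hout hb' hab'.connectedIn)
  obtain ⟨E, hE⟩ : ∃ E : Finset EL, ∀ e, e ∈ E ↔ ∃ e' ∈ boxE R, shiftEdge t ht e' = e :=
    ⟨(boxE R).image (shiftEdge t ht), fun e => Finset.mem_image⟩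
  have hbb := (h5 _ (hVB b hb) _ (hVB b' hb') (hout' ha hab.connectedIn)
    (hout' ha' hab'.connectedIn)).shift ht
    (S' := ↑E) fun e he => (hE _).2 ⟨e, he.1, rfl⟩
  rw [shiftV_shiftV_neg, shiftV_shiftV_neg] at hbb
  have hδ : w₁.1 - w₁.2 = 1 + 2 * J := by
    rw [hw₁]
    ring
  have haa := haa.liftConn_of_eq_zero (h := ray w₁) (fun e he u v hu hv =>
    not_ray_of_iff (iff_of_true (by
      have := mem_boxE.1 he.1 u hu
      simp only [abs_le] at this
      omega) (by
      have := mem_boxE.1 he.1 v hv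
      simp only [abs_le] at this
      omega))) true
  have hfar₂ : ∀ e ∈ E, ∀ u, Inc AdjL u e →
      ¬ u.1 - u.2 < w₁.1 - w₁.2 := by
    intro e he u hu
    obtain ⟨e, he', rfl⟩ := (hE _).1 he
    rw [← shiftV_shiftV_neg t u, inc_shiftEdge] at hu
    have h1 := mem_boxE.1 he' _ hu
    simp only [shiftV, ht_def, abs_le, Prod.fst_neg, Prod.snd_neg] at h1
    omega
  have hbb := hbb.liftConn_of_eq_zero (h := ray w₁) (fun e he u v hu hv =>
    not_ray_of_iff (iff_of_false (hfar₂ e he u hu) (hfar₂ e he v hv))) true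
  have hray : ∀ e ∈ S, ω e = true → ∀ u v, Inc AdjL u e → Inc AdjL v e →
      (ray w₁ u v ↔ (ray w₂ u v ↔ (False ↔ False))) := by
    intro e _ he u v hu hv
    have e1 : w₁ = shiftV (J + j, j - J) (1, 0) := by
      rw [hw₁]
      simp [shiftV]
    have e2 : w₂ = shiftV (J + j, j - J) (1 + K, K) := by
      rw [hw₂]
      simp [shiftV]
    rw [← shiftEdge_shiftEdge_neg hs e] at he hu hv
    rw [← shiftV_shiftV_neg (J + j, j - J) u, inc_shiftEdge] at hu
    rw [← shiftV_shiftV_neg (J + j, j - J) v, inc_shiftEdge] at hv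
    have := ray_congr_of_mem_dualInfClosed hK h3 he hu hv
    rw [← shiftV_shiftV_neg (J + j, j - J) u, ← shiftV_shiftV_neg (J + j, j - J) v, e1, e2,
      ray_shiftV, ray_shiftV]
    tauto
  have hab' := (hab'.gauge (fun _ => False) hray).symm (fun _ _ => ray_symm) |>.flip
  simp only [Bool.false_eq_true, not_true_eq_false, decide_false, Bool.not_false] at hab'
  obtain ⟨Q, hQ⟩ := exists_subset_boxE (D ∪ boxE R ∪ E)
  have hS : S ⊆ ↑(boxE Q) := fun e he => hQ (by simp [he.1])
  have loop := (((hab.mono hS).trans (hbb.mono fun e he => hQ (Finset.mem_union_right _ he))).trans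
    (hab'.mono hS)).trans ((haa.symm fun _ _ => ray_symm).mono fun e he => hQ (by simp [he.1]))
  refine not_liftConn_of_dualInfCluster (s := false) (w := w₁) ?_ loop
  have := (dualInfCluster_shift hs).1 h3.1
  rw [hw₁]
  simpa [shiftV] using this

theorem parityCross_true_eq_empty {w : V} {B B' : Finset EL} {M : ℤ} (hw : 2 * M ≤ w.1 + w.2) :
    parityCross w B B' (boxE M) true = ∅ := by
  refine Set.eq_empty_of_forall_notMem ?_
  rintro ω ⟨a, -, b, -, h⟩
  have := h.parity_of_exact (fun _ => False) fun e he u v hu hv => by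
    have h1 := mem_boxE.1 he.1 u hu
    simp only [abs_le] at h1
    refine iff_of_false (fun hr => ?_) (by simp)
    have := hr.1
    omega
  simp at this

theorem parityCross_false_eq_empty {w : V} {B B' : Finset EL} {M : ℤ}
    (hw : w.1 + w.2 < -(2 * M)) (hB : ∀ a ∈ vertexSet AdjL B, a.1 - a.2 < w.1 - w.2)
    (hB' : ∀ b ∈ vertexSet AdjL B', ¬ b.1 - b.2 < w.1 - w.2) :
    parityCross w B B' (boxE M) false = ∅ := by
  refine Set.eq_empty_of_forall_notMem ?_
  rintro ω ⟨a, ha, b, hb, h⟩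
  have := h.parity_of_exact (fun v => v.1 - v.2 < w.1 - w.2) fun e he u v hu hv => by
    have h1 := mem_boxE.1 he.1 u hu
    have h2 := mem_boxE.1 he.1 v hv
    simp only [abs_le] at h1 h2
    refine ⟨fun hr => hr.2.2, fun hr => ⟨by omega, by omega, hr⟩⟩
  have h1 := hB a ha
  have h2 := hB' b hb
  simp only [Bool.false_eq_true, false_iff] at this
  tauto

theorem add_sub_one_le_measureReal_inter {φ : Measure CL} [IsProbabilityMeasure φ] {A B : Set CL}
    (hB : MeasurableSet B) : φ.real A + φ.real B - 1 ≤ φ.real (A ∩ B) := by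
  have := measureReal_union_add_inter (μ := φ) (s := A) hB
  have := measureReal_le_one (μ := φ) (s := A ∪ B)
  linarith

theorem IsPer.measurePreserving {φ : Measure CL} {K : ℤ} (hK : IsPer φ K) {t : V}
    (ht : IsLatticeVec t) (h1 : K ∣ t.1) (h2 : K ∣ t.2) : MeasurePreserving (Shift t ht) φ φ := by
  obtain ⟨x, y⟩ := t
  obtain ⟨a, rfl⟩ := h1
  obtain ⟨b, rfl⟩ := h2
  exact hK.inv a b ht

theorem measure_dualInfCluster_eq_zero {p q : ℝ} (hp0 : 0 < p) (hp1 : p < 1) (hq : 1 ≤ q)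
    {φ : Measure CL} (hφ : IsGibbs AdjL 4 p q φ) (htail : TailTrivial AdjL φ) {K : ℤ}
    (hK : IsPer φ K) (hi : ∀ᵐ ω ∂φ, ∃ u, InfCluster AdjL ω Set.univ u) :
    φ {ω | DualInfCluster ω Set.univ (1, 0)} = 0 := by
  classical
  by_contra hd
  have := hφ.1
  have hK1 : 1 ≤ K := hK.pos
  set c := φ.real (dualInfClosed (K + 1)) with hc_def
  have hc : 0 < c := measureReal_dualInfClosed_pos hp0 hp1 hq hφ hd _
  set s := c / 5 with hs_def
  have hs : 0 < s := by positivity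
  have hc1 : c ≤ 1 := measureReal_le_one
  obtain ⟨n, hn⟩ := exists_hit_infCluster hi (ε := s ^ 2 / 4) (by positivity)
  obtain ⟨R, hR⟩ := exists_annulusUnique hp0 hp1 hq hφ htail hK n hs
  set H : Set CL := {ω | ∃ a ∈ vertexSet AdjL (boxE n), InfCluster AdjL ω Set.univ a}
  have hHm : MeasurableSet H := measurableSet_hit_infCluster _
  obtain ⟨J, hJK, hJ⟩ : ∃ J : ℤ, K ∣ J ∧ (n : ℤ) + R + 1 ≤ J :=
    ⟨K * (n + R + 1), Dvd.intro _ rfl, by nlinarith⟩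
  obtain ⟨t, ht_def⟩ : ∃ t : V, t = (2 * J, -2 * J) := ⟨_, rfl⟩
  have ht : IsLatticeVec t := by
    rw [ht_def]
    exact ⟨0, by ring⟩
  have hmpt : MeasurePreserving (Shift t ht) φ φ := by
    refine hK.measurePreserving ht ?_ ?_ <;> rw [ht_def]
    exacts [hJK.mul_left _, hJK.mul_left _]
  obtain ⟨B, hB⟩ : ∃ B : Finset EL, ∀ e, e ∈ boxE n ↔ shiftEdge t ht e ∈ B :=
    ⟨_, mem_image_shiftEdge ht (boxE n)⟩
  have hVB : ∀ {b}, b ∈ vertexSet AdjL (boxE n) → shiftV t b ∈ vertexSet AdjL B := by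
    rintro b ⟨e, he, hi⟩
    exact ⟨shiftEdge t ht e, (hB _).1 he, (inc_shiftEdge ht).2 hi⟩
  have hVB' : ∀ {b}, b ∈ vertexSet AdjL B → shiftV (-t) b ∈ vertexSet AdjL (boxE n) := by
    rintro b ⟨e, he, hi⟩
    refine ⟨shiftEdge (-t) ht.neg e, (hB _).2 ?_, (inc_shiftEdge ht.neg).2 hi⟩
    rwa [shiftEdge_shiftEdge_neg]
  obtain ⟨M, hM⟩ := exists_sub_le_measureReal (φ := φ)
    (A := fun M : ℕ => {ω | ∃ a ∈ vertexSet AdjL (boxE n), ∃ b ∈ vertexSet AdjL B,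
      ConnectedIn AdjL ω ↑(boxE M) a b})
    (fun M M' hMM ω ⟨a, ha, b, hb, h⟩ =>
      ⟨a, ha, b, hb, h.mono (boxE_mono (by exact_mod_cast hMM))⟩)
    (S := H ∩ Shift t ht ⁻¹' H) (by
      filter_upwards [ae_unique hp0 hp1 hq hφ htail hK] with ω hω ⟨⟨a, ha, ha'⟩, ⟨b, hb, hb'⟩⟩
      have hb' := (infCluster_shift ht (S := Set.univ) (S' := Set.univ) fun e => Iff.rfl).1 hb'
      obtain ⟨F, -, hc⟩ := (hω ∅ a (shiftV t b) (ha'.mono' fun e _ ho => ⟨by simp, ho⟩)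
        (hb'.mono' fun e _ ho => ⟨by simp, ho⟩)).exists_finset
      obtain ⟨M, hM⟩ := exists_subset_boxE F
      exact ⟨M, a, ha, shiftV t b, hVB hb, hc.mono fun e he => hM he⟩)
    (ε := s ^ 2 / 4) (by positivity)
  have hHH := add_sub_one_le_measureReal_inter (φ := φ) (A := H) (hmpt.measurable hHm)
  have hH' : φ.real (Shift t ht ⁻¹' H) = φ.real H :=
    hmpt.measureReal_preimage hHm.nullMeasurableSet
  set A : Set CL := {ω | ∃ a ∈ vertexSet AdjL (boxE n), ∃ b ∈ vertexSet AdjL B,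
      ConnectedIn AdjL ω ↑(boxE M) a b} with hA_def
  set w : ℤ → V := fun k => (1 + (J + K * k), K * k - J) with hw_def
  set U : ℤ → Bool → Set CL := fun k b => parityCross (w k) (boxE n) B (boxE M) b with hU
  have hUm : ∀ k b, MeasurableSet (U k b) := fun k b => (depOn_parityCross _ _ _ _ _).measurableSet
  have hor : ∀ k, 1 - s ≤ φ.real (U k true) ∨ 1 - s ≤ φ.real (U k false) := by
    intro k
    have h1 : φ.real A ≤ φ.real (U k true ∪ U k false) := measureReal_mono
      fun ω ⟨a, ha, b, hb, h⟩ => h.mem_parityCross ha hb _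
    have h2 := measureReal_union_add_inter (μ := φ) (s := U k true) (hUm k false)
    have h3 := mul_le_measureReal_inter hp0 hp1 hq hφ htail
      (depOn_parityCross (w k) (boxE n) B (boxE M) true)
      (depOn_parityCross (w k) (boxE n) B (boxE M) false)
      (isUpperSet_parityCross _ _ _ _ _) (isUpperSet_parityCross _ _ _ _ _)
    by_contra! h
    nlinarith [h.1, h.2]
  obtain ⟨k, hk1, hk2⟩ := exists_mem_not_mem_succ (P := fun k => 1 - s ≤ φ.real (U k true))
    (a := -(M + 1 : ℤ)) (b := M) (by omega) ((hor _).resolve_right (by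
      have : U (-(M + 1 : ℤ)) false = ∅ := by
        refine parityCross_false_eq_empty ?_ ?_ ?_
        · simp only [hw_def]
          nlinarith
        · intro a ha
          have := nrm_le.1 (nrm_le_of_mem_vertexSet_boxE ha)
          simp only [hw_def, abs_le] at this ⊢
          omega
        · intro b hb
          have := nrm_le.1 (nrm_le_of_mem_vertexSet_boxE (hVB' hb))
          simp only [hw_def, shiftV, ht_def, Prod.fst_neg, Prod.snd_neg, abs_le] at this ⊢
          omega
      rw [this, measureReal_empty]
      linarith)) (by
      have : U M true = ∅ := by
        refine parityCross_true_eq_empty ?_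
        simp only [hw_def]
        nlinarith
      rw [this, measureReal_empty]
      linarith)
  have hk2 := (hor (k + 1)).resolve_left hk2
  have hs : IsLatticeVec (J + K * k, K * k - J) := ⟨K * k, by ring⟩
  have hmps : MeasurePreserving (Shift (J + K * k, K * k - J) hs) φ φ :=
    hK.measurePreserving hs (hJK.add (Dvd.intro _ rfl)) ((Dvd.intro _ rfl).sub hJK)
  have e1 : φ.real (Shift (J + K * k, K * k - J) hs ⁻¹' dualInfClosed (K + 1)) = c :=
    hmps.measureReal_preimage (measurableSet_dualInfClosed _).nullMeasurableSet
  have e2 : φ.real (Shift t ht ⁻¹' annulusUnique n R) = φ.real (annulusUnique n R) :=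
    hmpt.measureReal_preimage (measurableSet_annulusUnique _ _).nullMeasurableSet
  have i1 := add_sub_one_le_measureReal_inter (φ := φ) (A := U k true) (hUm (k + 1) false)
  have i2 := add_sub_one_le_measureReal_inter (φ := φ) (A := U k true ∩ U (k + 1) false)
    (hmps.measurable (measurableSet_dualInfClosed (K + 1)))
  have i3 := add_sub_one_le_measureReal_inter (φ := φ)
    (A := annulusUnique n R) (hmpt.measurable (measurableSet_annulusUnique n R))
  have i4 := add_sub_one_le_measureReal_inter (φ := φ) (A := U k true ∩ U (k + 1) false ∩
      Shift (J + K * k, K * k - J) hs ⁻¹' dualInfClosed (K + 1))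
    ((measurableSet_annulusUnique n R).inter (hmpt.measurable (measurableSet_annulusUnique n R)))
  have hpos : φ.real (U k true ∩ U (k + 1) false ∩
      Shift (J + K * k, K * k - J) hs ⁻¹' dualInfClosed (K + 1) ∩
      (annulusUnique n R ∩ Shift t ht ⁻¹' annulusUnique n R)) ≠ 0 := by
    refine ne_of_gt ?_
    linarith
  obtain ⟨ω, ⟨⟨h1, h2⟩, h3⟩, h4, h5⟩ := nonempty_of_measureReal_ne_zero hpos
  refine false_of_parityCross hK.pos hJ hs ht ht_def rfl ?_ hB h1 h2 h3 h4 h5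
  simp only [hw_def, Prod.mk.injEq]
  constructor <;> ring

/-! ### Comparison with the free and wired measures -/

theorem opn_eq_cylinder (F : Finset EL) : opn F = cylinder AdjL F fun _ => true :=
  Set.ext fun _ => ⟨fun h e => h e.1 e.2, fun h e he => h ⟨e, he⟩⟩

theorem tendsto_wProb_of_weakLim {p q : ℝ} (hp0 : 0 < p) (hp1 : p < 1) (hq : 1 ≤ q)
    {μ : Measure CL} {ξ : ∀ k : ℕ, Setoid (bdry AdjL 4 (boxE k))}
    (h : WeakLim AdjL (fun k : ℕ => (fkFin AdjL p q 4 (boxE k) (ξ k)).map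
      (extendBy AdjL (boxE k))) μ) [IsProbabilityMeasure μ] (F : Finset EL) :
    Tendsto (fun k : ℕ => wProb (fkWeight AdjL p q 4 (boxE k) (ξ k))
      {η | extendBy AdjL (boxE k) η ∈ opn F}) atTop (nhds (μ.real (opn F))) := by
  have h1 := (ENNReal.tendsto_toReal (measure_ne_top _ _)).comp (h F fun _ => true)
  rw [← opn_eq_cylinder] at h1
  refine h1.congr fun k => ?_
  simp only [Function.comp_apply]
  rw [Measure.map_apply .of_discrete (measurableSet_opn F)]
  erw [fkFin_apply hp0 hp1 hq]
  exact ENNReal.toReal_ofReal (wProb_nonneg (fun a => (fkWeight_pos hp0 hp1 hq _ _ a).le) _)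

theorem isExhaustion_boxE : IsExhaustion AdjL fun k : ℕ => boxE k :=
  ⟨fun _ _ h => boxE_mono (by exact_mod_cast h), exists_mem_boxE⟩

theorem IsFreeLimit.wProb_le {p q : ℝ} (hp0 : 0 < p) (hp1 : p < 1) (hq : 1 ≤ q)
    {φ0 : Measure CL} (h : IsFreeLimit AdjL 4 p q φ0)
    (D F : Finset EL) :
    wProb (fkWeight AdjL p q 4 D ⊥) {η | extendBy AdjL D η ∈ opn F} ≤ φ0.real (opn F) := by
  have := h.1
  refine ge_of_tendsto (tendsto_wProb_of_weakLim hp0 hp1 hq (h.2 _ isExhaustion_boxE) F) ?_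
  obtain ⟨n, hn⟩ := exists_subset_boxE D
  filter_upwards [eventually_ge_atTop n] with k hk
  exact wProb_free_mono hp0 hp1 hq (hn.trans (boxE_mono (by exact_mod_cast hk))) F

theorem IsWiredLimit.le_wProb {p q : ℝ} (hp0 : 0 < p) (hp1 : p < 1) (hq : 1 ≤ q)
    {φ1 : Measure CL} (h : IsWiredLimit AdjL 4 p q φ1)
    {D F : Finset EL} (hD : D.Nonempty) (hF : F ⊆ D) :
    φ1.real (opn F) ≤ wProb (fkWeight AdjL p q 4 D ⊤) {η | extendBy AdjL D η ∈ opn F} := by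
  have := h.1
  refine le_of_tendsto (tendsto_wProb_of_weakLim hp0 hp1 hq (h.2 _ isExhaustion_boxE) F) ?_
  obtain ⟨n, hn⟩ := exists_subset_boxE D
  filter_upwards [eventually_ge_atTop n] with k hk
  exact wProb_wired_anti hp0 hp1 hq (hn.trans (boxE_mono (by exact_mod_cast hk))) hD hF

theorem DepOn.opn_of_subset {F D : Finset EL} (h : F ⊆ D) : DepOn ↑D (opn F) :=
  (depOn_opn F).mono (Finset.coe_subset.2 h)

theorem IsFreeLimit.le_measureReal_opn {p q : ℝ} (hp0 : 0 < p) (hp1 : p < 1) (hq : 1 ≤ q)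
    {φ : Measure CL} (hφ : IsGibbs AdjL 4 p q φ)
    {φ0 : Measure CL} (h : IsFreeLimit AdjL 4 p q φ0)
    (F : Finset EL) : φ0.real (opn F) ≤ φ.real (opn F) := by
  have := h.1
  have := hφ.1
  refine le_of_tendsto (tendsto_wProb_of_weakLim hp0 hp1 hq (h.2 _ isExhaustion_boxE) F) ?_
  obtain ⟨n, hn⟩ := exists_subset_boxE F
  filter_upwards [eventually_ge_atTop n] with k hk
  have hF : F ⊆ boxE k := hn.trans (boxE_mono (by exact_mod_cast hk))
  have := le_measureReal_inter_of_le_condP hp0 hp1 hq hφ (boxE k) MeasurableSet.univ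
    (fun _ _ _ => Iff.rfl) (DepOn.opn_of_subset hF) (fun ω _ =>
      wProb_fkWeight_mono_bc hp0 hp1 hq (boxE k) bot_le (isUpperSet_extendBy_opn _ _))
  simpa using this

theorem IsWiredLimit.measureReal_opn_le {p q : ℝ} (hp0 : 0 < p) (hp1 : p < 1) (hq : 1 ≤ q)
    {φ : Measure CL} (hφ : IsGibbs AdjL 4 p q φ)
    {φ1 : Measure CL} (h : IsWiredLimit AdjL 4 p q φ1)
    (F : Finset EL) : φ.real (opn F) ≤ φ1.real (opn F) := by
  have := h.1
  have := hφ.1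
  refine ge_of_tendsto (tendsto_wProb_of_weakLim hp0 hp1 hq (h.2 _ isExhaustion_boxE) F) ?_
  obtain ⟨n, hn⟩ := exists_subset_boxE F
  filter_upwards [eventually_ge_atTop n] with k hk
  have hF : F ⊆ boxE k := hn.trans (boxE_mono (by exact_mod_cast hk))
  have := measureReal_inter_le_of_condP_le hp0 hp1 hq hφ (boxE k) MeasurableSet.univ
    (fun _ _ _ => Iff.rfl) (DepOn.opn_of_subset hF) (fun ω _ =>
      wProb_fkWeight_mono_bc hp0 hp1 hq (boxE k) le_top (isUpperSet_extendBy_opn _ _))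
  simpa using this

/-- A random finite domain which is a function of the configuration outside of it. -/
structure IsExplored (Λ : Finset EL) (Dmap : CL → Finset EL) : Prop where
  subset : ∀ ω, Dmap ω ⊆ Λ
  local' : ∀ ω ω', (∀ e ∈ Λ, ω e = ω' e) → Dmap ω' = Dmap ω
  congr : ∀ ω ω', (∀ e, e ∉ Dmap ω → ω e = ω' e) → Dmap ω' = Dmap ω

theorem IsExplored.depOn {Λ : Finset EL} {Dmap : CL → Finset EL} (h : IsExplored Λ Dmap)
    (D : Finset EL) : DepOn {e | e ∉ D} {ω | Dmap ω = D} := by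
  refine fun ω ω' hω => ⟨?_, ?_⟩
  · rintro (rfl : Dmap ω = D)
    exact h.congr ω ω' hω
  · rintro (rfl : Dmap ω' = D)
    exact h.congr ω' ω fun e he => (hω e he).symm

theorem IsExplored.measurableSet {Λ : Finset EL} {Dmap : CL → Finset EL} (h : IsExplored Λ Dmap)
    (D : Finset EL) : MeasurableSet {ω | Dmap ω = D} :=
  DepOn.measurableSet (D := Λ) fun ω ω' hω => by
    show Dmap ω = D ↔ Dmap ω' = D
    rw [h.local' ω ω' hω]

open Classical in
theorem IsExplored.measureReal_eq_sum {Λ : Finset EL} {Dmap : CL → Finset EL}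
    (h : IsExplored Λ Dmap) {φ : Measure CL} [IsProbabilityMeasure φ] {A : Set CL}
    (hA : MeasurableSet A) (F : Finset EL) :
    φ.real (A ∩ {ω | F ⊆ Dmap ω}) =
      ∑ D ∈ Λ.powerset.filter (F ⊆ ·), φ.real (A ∩ {ω | Dmap ω = D}) := by
  rw [← measureReal_biUnion_finset]
  · congr 1
    ext ω
    simp only [Set.mem_inter_iff, Set.mem_ofPred_eq, Set.mem_iUnion, Finset.mem_filter,
      Finset.mem_powerset, exists_prop]
    exact ⟨fun ⟨h1, h2⟩ => ⟨_, ⟨h.subset ω, h2⟩, h1, rfl⟩, fun ⟨_, ⟨_, h1⟩, h2, h3⟩ =>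
      ⟨h2, h3 ▸ h1⟩⟩
  · intro D _ D' _ hne
    exact Set.disjoint_left.2 fun ω h1 h2 => hne (h1.2.symm.trans h2.2)
  · exact fun D _ => hA.inter (h.measurableSet D)

theorem IsExplored.measureReal_opn_inter_le {p q : ℝ} (hp0 : 0 < p) (hp1 : p < 1) (hq : 1 ≤ q)
    {φ : Measure CL} (hφ : IsGibbs AdjL 4 p q φ) {Λ : Finset EL} {Dmap : CL → Finset EL}
    (h : IsExplored Λ Dmap) {F : Finset EL} {c : ℝ}
    (hc : ∀ ω, F ⊆ Dmap ω → condP p q (Dmap ω) (opn F) ω ≤ c) :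
    φ.real (opn F ∩ {ω | F ⊆ Dmap ω}) ≤ c * φ.real {ω | F ⊆ Dmap ω} := by
  classical
  have := hφ.1
  have h1 := h.measureReal_eq_sum (φ := φ) MeasurableSet.univ F
  simp only [Set.univ_inter] at h1
  rw [h.measureReal_eq_sum (measurableSet_opn F) F, h1, Finset.mul_sum]
  refine Finset.sum_le_sum fun D hD => ?_
  have hF := (Finset.mem_filter.1 hD).2
  refine measureReal_inter_le_of_condP_le hp0 hp1 hq hφ D (h.measurableSet D) (h.depOn D)
    (DepOn.opn_of_subset hF) ?_
  rintro ω (rfl : Dmap ω = D)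
  exact hc ω hF

theorem IsExplored.le_measureReal_opn_inter {p q : ℝ} (hp0 : 0 < p) (hp1 : p < 1) (hq : 1 ≤ q)
    {φ : Measure CL} (hφ : IsGibbs AdjL 4 p q φ) {Λ : Finset EL} {Dmap : CL → Finset EL}
    (h : IsExplored Λ Dmap) {F : Finset EL} {c : ℝ}
    (hc : ∀ ω, F ⊆ Dmap ω → c ≤ condP p q (Dmap ω) (opn F) ω) :
    c * φ.real {ω | F ⊆ Dmap ω} ≤ φ.real (opn F ∩ {ω | F ⊆ Dmap ω}) := by
  classical
  have := hφ.1
  have h1 := h.measureReal_eq_sum (φ := φ) MeasurableSet.univ F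
  simp only [Set.univ_inter] at h1
  rw [h.measureReal_eq_sum (measurableSet_opn F) F, h1, Finset.mul_sum]
  refine Finset.sum_le_sum fun D hD => ?_
  have hF := (Finset.mem_filter.1 hD).2
  refine le_measureReal_inter_of_le_condP hp0 hp1 hq hφ D (h.measurableSet D) (h.depOn D)
    (DepOn.opn_of_subset hF) ?_
  rintro ω (rfl : Dmap ω = D)
  exact hc ω hF

/-- The vertices joined inside `Λ` to the boundary of `Λ`. -/
def bdryCluster (Λ : Finset EL) (ω : CL) : Set V :=
  {v | ∃ b, (∃ e, Inc AdjL b e ∧ e ∉ Λ) ∧ ConnectedIn AdjL ω ↑Λ b v}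

open Classical in
/-- The edges of `Λ` not touching the cluster of the boundary of `Λ`. -/
def innerDomain (Λ : Finset EL) (ω : CL) : Finset EL :=
  Λ.filter fun e => ∀ v, Inc AdjL v e → v ∉ bdryCluster Λ ω

theorem mem_innerDomain {Λ : Finset EL} {ω : CL} {e : EL} :
    e ∈ innerDomain Λ ω ↔ e ∈ Λ ∧ ∀ v, Inc AdjL v e → v ∉ bdryCluster Λ ω :=
  by simp [innerDomain]

theorem bdryCluster_congr {Λ : Finset EL} {ω ω' : CL}
    (h : ∀ e ∈ Λ, e ∉ innerDomain Λ ω → ω e = ω' e) : bdryCluster Λ ω' = bdryCluster Λ ω := by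
  have hmem : ∀ e v, Inc AdjL v e → v ∈ bdryCluster Λ ω → e ∉ innerDomain Λ ω :=
    fun e v hi hv he => (mem_innerDomain.1 he).2 v hi hv
  ext v
  constructor
  · rintro ⟨b, hb, hc⟩
    induction hc with
    | refl => exact ⟨b, hb, .refl⟩
    | @tail x y _ hstep ih =>
      obtain ⟨e, he, ho, hx, hy⟩ := hstep
      obtain ⟨b', hb', hc'⟩ := ih
      rw [← h e he (hmem e x hx ⟨b', hb', hc'⟩)] at ho
      exact ⟨b', hb', hc'.tail ⟨e, he, ho, hx, hy⟩⟩
  · rintro ⟨b, hb, hc⟩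
    refine ⟨b, hb, ?_⟩
    induction hc with
    | refl => exact .refl
    | @tail x y hbx hstep ih =>
      obtain ⟨e, he, ho, hx, hy⟩ := hstep
      rw [h e he (hmem e x hx ⟨b, hb, hbx⟩)] at ho
      exact ih.tail ⟨e, he, ho, hx, hy⟩

theorem isExplored_innerDomain (Λ : Finset EL) : IsExplored Λ (innerDomain Λ) where
  subset _ _ he := (mem_innerDomain.1 he).1
  local' ω ω' h := by
    unfold innerDomain
    rw [bdryCluster_congr fun e he _ => h e he]
  congr ω ω' h := by
    unfold innerDomain
    rw [bdryCluster_congr fun e _ he => h e he]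

theorem inducedBC_innerDomain (Λ : Finset EL) (ω : CL) :
    inducedBC AdjL 4 (innerDomain Λ ω) ω = ⊥ := by
  set D := innerDomain Λ ω with hD
  have key : ∀ u ∈ bdry AdjL 4 D, ∀ v, ConnectedIn AdjL ω {e | e ∉ D} u v → v = u := by
    rintro u hu v hc
    obtain ⟨⟨e₀, he₀, hu₀⟩, -⟩ := (mem_bdry_iff).1 hu
    have hu' := (mem_innerDomain.1 he₀).2 u hu₀
    induction hc with
    | refl => rfl
    | @tail x y _ hstep ih =>
      subst ih
      obtain ⟨e, he, ho, hx, hy⟩ := hstep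
      exfalso
      by_cases heΛ : e ∈ Λ
      · refine he (mem_innerDomain.2 ⟨heΛ, fun w hw hwc => hu' ?_⟩)
        obtain ⟨b, hb, hc⟩ := hwc
        exact ⟨b, hb, hc.tail ⟨e, heΛ, ho, hw, hx⟩⟩
      · exact hu' ⟨x, ⟨e, hx, heΛ⟩, .refl⟩
  refine Setoid.ext fun u v => ?_
  rw [inducedBC_r]
  constructor
  · rintro (h | ⟨h, -⟩)
    · exact (Subtype.ext (key u.1 u.2 v.1 h)).symm
    · exact absurd ((Set.finite_singleton u.1).subset fun w hw => key u.1 u.2 w hw)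
        (Set.not_infinite.2 ((Set.finite_singleton u.1).subset fun w hw => key u.1 u.2 w hw) h).elim
  · rintro rfl
    exact Or.inl ConnectedIn.refl

theorem eq_of_measureReal_opn_eq {φ ψ : Measure CL} [IsProbabilityMeasure φ]
    [IsProbabilityMeasure ψ] (h : ∀ F, φ.real (opn F) = ψ.real (opn F)) : φ = ψ := by
  classical
  refine ext_of_generate_finite (Set.range opn) ?_ ?_ ?_ (by simp)
  · refine le_antisymm ?_ (MeasurableSpace.generateFrom_le ?_)
    · have : @Measurable CL CL (MeasurableSpace.generateFrom (Set.range opn)) _ id := by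
        refine @measurable_pi_lambda _ _ _ (MeasurableSpace.generateFrom (Set.range opn)) _ _
          fun e => ?_
        refine @measurable_to_bool _ (MeasurableSpace.generateFrom (Set.range opn)) _ ?_
        refine MeasurableSpace.measurableSet_generateFrom ⟨{e}, ?_⟩
        ext ω
        simp [opn]
      simpa using this.comap_le
    · rintro _ ⟨F, rfl⟩
      exact measurableSet_opn F
  · rintro _ ⟨F, rfl⟩ _ ⟨F', rfl⟩ -
    refine ⟨F ∪ F', ?_⟩
    ext ω
    simp only [opn, Finset.mem_union, Set.mem_inter_iff, Set.mem_ofPred_eq]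
    exact ⟨fun h => ⟨fun e he => h e (Or.inl he), fun e he => h e (Or.inr he)⟩,
      fun h e he => he.elim (h.1 e) (h.2 e)⟩
  · rintro _ ⟨F, rfl⟩
    have := h F
    rwa [measureReal_def, measureReal_def, ENNReal.toReal_eq_toReal_iff' (measure_ne_top _ _)
      (measure_ne_top _ _)] at this

theorem eq_of_isFreeLimit {p q : ℝ} (hp0 : 0 < p) (hp1 : p < 1) (hq : 1 ≤ q) {φ : Measure CL}
    (hφ : IsGibbs AdjL 4 p q φ) (hno : ∀ᵐ ω ∂φ, ∀ u, ¬ InfCluster AdjL ω Set.univ u)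
    {φ0 : Measure CL} (h : IsFreeLimit AdjL 4 p q φ0) : φ = φ0 := by
  have := hφ.1
  have := h.1
  refine eq_of_measureReal_opn_eq fun F => le_antisymm ?_ (h.le_measureReal_opn hp0 hp1 hq hφ F)
  refine le_of_forall_pos_le_add fun ε hε => ?_
  obtain ⟨n, hn⟩ := exists_subset_boxE F
  obtain ⟨N, hN⟩ := exists_sub_le_measureReal (φ := φ) (A := fun N : ℕ => {ω |
      ∀ a ∈ vertexSet AdjL (boxE n), ∀ v, (N : ℤ) ≤ nrm v → ¬ ConnectedIn AdjL ω Set.univ a v})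
    (fun N N' hN ω hω a ha v hv => hω a ha v (le_trans (by exact_mod_cast hN) hv))
    (S := Set.univ) (by
      filter_upwards [hno] with ω hω _
      obtain ⟨M, hM⟩ := (((finite_vertexSet (boxE n)).biUnion fun a _ =>
        Set.not_infinite.1 (hω a)).image nrm).bddAbove
      refine ⟨(M + 1).toNat, fun a ha v hv hc => ?_⟩
      have := hM ⟨v, Set.mem_biUnion ha hc, rfl⟩
      omega) hε
  set Λ := boxE (max n N : ℕ) with hΛ
  set G : Set CL := {ω | F ⊆ innerDomain Λ ω} with hG
  have hsub : {ω | ∀ a ∈ vertexSet AdjL (boxE n), ∀ v, (N : ℤ) ≤ nrm v →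
      ¬ ConnectedIn AdjL ω Set.univ a v} ⊆ G := by
    intro ω hω e he
    have hnle : (n : ℤ) ≤ (max n N : ℕ) := by exact_mod_cast le_max_left n N
    refine mem_innerDomain.2 ⟨boxE_mono hnle (hn he), ?_⟩
    rintro v hv ⟨b, ⟨e', hb, he'⟩, hc⟩
    refine hω v ⟨e, hn he, hv⟩ b ?_ (hc.symm.mono (Set.subset_univ _))
    by_contra hlt
    refine he' (mem_boxE.2 fun w hw => nrm_le.1 ?_)
    have h1 := nrm_le_of_inc hb hw
    have : (N : ℤ) ≤ (max n N : ℕ) := by exact_mod_cast le_max_right n N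
    omega
  have hGm : MeasurableSet G := by
    have : G = ⋃ D ∈ {D : Finset EL | F ⊆ D}, {ω | innerDomain Λ ω = D} := by
      ext ω
      simp [hG]
    rw [this]
    exact .biUnion (Set.to_countable _) fun D _ => (isExplored_innerDomain Λ).measurableSet D
  have h1 : 1 - ε ≤ φ.real G := by
    have := measureReal_mono (μ := φ) hsub
    rw [probReal_univ] at hN
    linarith
  have h2 := (isExplored_innerDomain Λ).measureReal_opn_inter_le hp0 hp1 hq hφ (F := F)
    (c := φ0.real (opn F)) fun ω hω => by
      unfold condP
      rw [inducedBC_innerDomain]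
      exact h.wProb_le hp0 hp1 hq _ _
  have h3 := add_sub_one_le_measureReal_inter (φ := φ) (A := opn F) hGm
  have h4 : φ0.real (opn F) * φ.real G ≤ φ0.real (opn F) :=
    mul_le_of_le_one_right measureReal_nonneg measureReal_le_one
  linarith

theorem ae_not_dualInfCluster_of_dualStep {p q : ℝ} (hp0 : 0 < p) (hp1 : p < 1) (hq : 1 ≤ q)
    {φ : Measure CL} (hφ : IsGibbs AdjL 4 p q φ) {w w' : V}
    (h : ∀ᵐ ω ∂φ, ¬ DualInfCluster ω Set.univ w)
    (hw : DualStep (fun _ => false) Set.univ w w') :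
    ∀ᵐ ω ∂φ, ¬ DualInfCluster ω Set.univ w' := by
  obtain ⟨h1, h2, h3, h4, h5, -⟩ := hw
  filter_upwards [ae_repl hp0 hp1 hq hφ h {⟨crossSym w w', h5⟩} fun _ => false] with ω hω hi
  refine hω ?_
  have hi' : DualInfCluster (repl {⟨crossSym w w', h5⟩} (fun _ => false) ω) Set.univ w' := by
    refine hi.mono' fun e _ ho => ⟨trivial, ?_⟩
    by_cases he : e ∈ ({⟨crossSym w w', h5⟩} : Finset EL)
    exacts [repl_of_mem he, (repl_of_notMem he).trans ho]
  have hstep : DualStep (repl {⟨crossSym w w', h5⟩} (fun _ => false) ω) Set.univ w w' :=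
    ⟨h1, h2, h3, h4, h5, trivial, repl_of_mem (Finset.mem_singleton_self _)⟩
  exact hi'.of_conn (Relation.ReflTransGen.single hstep.symm)

/-! ### Faces of the lattice -/

theorem exists_potential {A B : ℤ → ℤ → ZMod 2} {J : ℤ} (hJ : 0 < J)
    (hv : ∀ i j, A i j + A (i + 1) j + B i j + B i (j + 1) = 0)
    (hA : ∀ i j, (J ≤ |i| ∨ (J ≤ |j| ∧ J ≤ |j + 1|)) → A i j = 0)
    (hB : ∀ i j, (J ≤ |j| ∨ (J ≤ |i| ∧ J ≤ |i + 1|)) → B i j = 0) :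
    ∃ f : ℤ → ℤ → ZMod 2, (∀ i j, f i j = A i j + f i (j + 1)) ∧
      (∀ i j, f i j = B i j + f (i + 1) j) ∧ ∀ i j, (J ≤ |i| ∨ J ≤ |j|) → f i j = 0 := by
  let f : ℤ → ℤ → ZMod 2 := fun i j => ∑ k ∈ Finset.range (J - j).toNat, A i (j + k)
  have f0 : ∀ i j, J ≤ j → f i j = 0 := fun i j h => by
    have : (J - j).toNat = 0 := by omega
    simp only [f, this, Finset.range_zero, Finset.sum_empty]
  have fA : ∀ i j, f i j = A i j + f i (j + 1) := by
    intro i j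
    by_cases h : J ≤ j
    · rw [f0 i j h, f0 i (j + 1) (by omega), hA i j (Or.inr ⟨h.trans (le_abs_self _), by
        have := le_abs_self (j + 1); omega⟩), add_zero]
    · have e : (J - j).toNat = (J - (j + 1)).toNat + 1 := by omega
      simp only [f, e]
      rw [Finset.sum_range_succ', add_comm]
      congr 1
      · simp
      · refine Finset.sum_congr rfl fun k _ => ?_
        congr 1
        push_cast
        ring
  have fB' : ∀ n : ℕ, ∀ i j, J - j ≤ n → f i j = B i j + f (i + 1) j := by
    intro n
    induction n with
    | zero =>
      intro i j h
      have h' : J ≤ j := by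
        push_cast at h
        omega
      rw [f0 i j h', f0 (i + 1) j h', hB i j (Or.inl (h'.trans (le_abs_self _))), add_zero]
    | succ n ih =>
      intro i j h
      have h1 := ih i (j + 1) (by push_cast at h; omega)
      have h2 := fA i j
      have h3 := fA (i + 1) j
      have h4 := hv i j
      have h5 : ∀ a : ZMod 2, a + a = 0 := by decide
      have h6 := h5 (A (i + 1) j)
      have h7 := h5 (B i j)
      linear_combination h2 + h1 + h4 - h3 - h6 - h7
  have fB : ∀ i j, f i j = B i j + f (i + 1) j := fun i j =>
    fB' (J - j).toNat i j (Int.self_le_toNat _)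
  refine ⟨f, fA, fB, fun i j h => ?_⟩
  have fi : ∀ i j, J ≤ |i| → f i j = 0 := fun i j h =>
    Finset.sum_eq_zero fun k _ => hA _ _ (Or.inl h)
  rcases h with h | h
  · exact fi i j h
  · have hn : ∀ n : ℕ, f i j = f (i + n) j := by
      intro n
      induction n with
      | zero => simp
      | succ n ih =>
        rw [ih, fB, hB _ _ (Or.inl h), zero_add]
        push_cast
        rw [add_assoc]
    rw [hn (J + |i|).toNat]
    refine fi _ _ ?_
    have h1 := neg_abs_le i
    have h2 := abs_nonneg i
    rw [Int.toNat_of_nonneg (by omega)]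
    exact le_trans (by omega) (le_abs_self _)

/-- The dual vertex with index `p`. -/
def faceV (p : ℤ × ℤ) : V := (1 + p.1 + p.2, p.1 - p.2)

/-- The primal vertex with index `p`: the common corner of the faces `p`, `p + (1, 0)`,
`p + (0, 1)` and `p + (1, 1)`. -/
def cornerV (p : ℤ × ℤ) : V := (2 + p.1 + p.2, p.1 - p.2)

theorem adjL_cornerV_left (p : ℤ × ℤ) : AdjL (cornerV p) (cornerV (p.1 - 1, p.2)) := by
  rw [adjL_iff]
  refine ⟨⟨1 + p.1, ?_⟩, Or.inr ?_, Or.inr ?_⟩ <;> simp only [cornerV] <;> ring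

theorem adjL_cornerV_down (p : ℤ × ℤ) : AdjL (cornerV p) (cornerV (p.1, p.2 - 1)) := by
  rw [adjL_iff]
  refine ⟨⟨1 + p.1, ?_⟩, Or.inr ?_, Or.inl ?_⟩ <;> simp only [cornerV] <;> ring

/-- The edge between the faces `p` and `p + (0, 1)`. -/
def edgeA (p : ℤ × ℤ) : EL := mkE _ _ (adjL_cornerV_left p)

/-- The edge between the faces `p` and `p + (1, 0)`. -/
def edgeB (p : ℤ × ℤ) : EL := mkE _ _ (adjL_cornerV_down p)

theorem cornerV_injective : Function.Injective cornerV := by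
  intro p q h
  simp only [cornerV, Prod.mk.injEq] at h
  ext <;> omega

theorem exists_cornerV {v : V} (hv : Even (v.1 + v.2)) : ∃ p, v = cornerV p := by
  obtain ⟨k, hk⟩ := hv
  refine ⟨(k - 1, v.1 - 1 - k), ?_⟩
  ext <;> simp only [cornerV] <;> omega

theorem faceV_injective : Function.Injective faceV := by
  intro p q h
  simp only [faceV, Prod.mk.injEq] at h
  ext <;> omega

theorem inc_edgeA {v p : ℤ × ℤ} :
    Inc AdjL (cornerV v) (edgeA p) ↔ v = p ∨ v = (p.1 - 1, p.2) := by
  rw [edgeA, inc_mkE, cornerV_injective.eq_iff, cornerV_injective.eq_iff]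

theorem inc_edgeB {v p : ℤ × ℤ} :
    Inc AdjL (cornerV v) (edgeB p) ↔ v = p ∨ v = (p.1, p.2 - 1) := by
  rw [edgeB, inc_mkE, cornerV_injective.eq_iff, cornerV_injective.eq_iff]

theorem exists_edgeA_or_edgeB (e : EL) : ∃ p, e = edgeA p ∨ e = edgeB p := by
  obtain ⟨u, v, h, rfl⟩ := exists_eq_mkE e
  obtain ⟨hu, h1, h2⟩ := adjL_iff.1 h
  obtain ⟨a, rfl⟩ := exists_cornerV hu
  obtain ⟨b, rfl⟩ := exists_cornerV h.symm.1
  simp only [cornerV] at h1 h2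
  have hs : (b = (a.1 - 1, a.2) ∨ b = (a.1, a.2 - 1)) ∨ (a = (b.1 - 1, b.2) ∨ a = (b.1, b.2 - 1)) := by
    simp only [Prod.ext_iff]
    omega
  rcases hs with (hb | hb) | (hb | hb)
  · exact ⟨a, Or.inl ((mkE_eq_iff _ _).2 (Or.inl ⟨rfl, by rw [hb]⟩))⟩
  · exact ⟨a, Or.inr ((mkE_eq_iff _ _).2 (Or.inl ⟨rfl, by rw [hb]⟩))⟩
  · exact ⟨b, Or.inl ((mkE_eq_iff _ _).2 (Or.inr ⟨by rw [hb], rfl⟩))⟩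
  · exact ⟨b, Or.inr ((mkE_eq_iff _ _).2 (Or.inr ⟨by rw [hb], rfl⟩))⟩

theorem edgeA_injective : Function.Injective edgeA := by
  intro p q h
  have h1 := (inc_edgeA (v := p) (p := q)).1 (h ▸ inc_edgeA.2 (Or.inl rfl))
  have h2 := (inc_edgeA (v := q) (p := p)).1 (h ▸ inc_edgeA.2 (Or.inl rfl))
  simp only [Prod.ext_iff] at h1 h2 ⊢
  omega

theorem edgeB_injective : Function.Injective edgeB := by
  intro p q h
  have h1 := (inc_edgeB (v := p) (p := q)).1 (h ▸ inc_edgeB.2 (Or.inl rfl))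
  have h2 := (inc_edgeB (v := q) (p := p)).1 (h ▸ inc_edgeB.2 (Or.inl rfl))
  simp only [Prod.ext_iff] at h1 h2 ⊢
  omega

theorem edgeA_ne_edgeB (p q : ℤ × ℤ) : edgeA p ≠ edgeB q := by
  intro h
  have h1 := (inc_edgeB (v := p) (p := q)).1 (h ▸ inc_edgeA.2 (Or.inl rfl))
  have h2 := (inc_edgeB (v := (p.1 - 1, p.2)) (p := q)).1 (h ▸ inc_edgeA.2 (Or.inr rfl))
  simp only [Prod.ext_iff] at h1 h2
  omega

/-- The edge `e` separates the faces `p` and `q`. -/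
def Sep (e : EL) (p q : ℤ × ℤ) : Prop :=
  (e = edgeA p ∧ q = (p.1, p.2 + 1)) ∨ (e = edgeA q ∧ p = (q.1, q.2 + 1)) ∨
    (e = edgeB p ∧ q = (p.1 + 1, p.2)) ∨ (e = edgeB q ∧ p = (q.1 + 1, q.2))

theorem Sep.symm {e : EL} {p q : ℤ × ℤ} (h : Sep e p q) : Sep e q p := by
  unfold Sep at *
  tauto

theorem sep_edgeA (p : ℤ × ℤ) : Sep (edgeA p) p (p.1, p.2 + 1) := Or.inl ⟨rfl, rfl⟩

theorem sep_edgeB (p : ℤ × ℤ) : Sep (edgeB p) p (p.1 + 1, p.2) := Or.inr (Or.inr (Or.inl ⟨rfl, rfl⟩))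

theorem sep_edgeA_iff {p a b : ℤ × ℤ} : Sep (edgeA p) a b ↔
    (a = p ∧ b = (p.1, p.2 + 1)) ∨ (b = p ∧ a = (p.1, p.2 + 1)) := by
  constructor
  · rintro (⟨h, rfl⟩ | ⟨h, rfl⟩ | ⟨h, -⟩ | ⟨h, -⟩)
    · obtain rfl := edgeA_injective h
      exact Or.inl ⟨rfl, rfl⟩
    · obtain rfl := edgeA_injective h
      exact Or.inr ⟨rfl, rfl⟩
    · exact absurd h (edgeA_ne_edgeB _ _)
    · exact absurd h (edgeA_ne_edgeB _ _)
  · rintro (⟨rfl, rfl⟩ | ⟨rfl, rfl⟩)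
    exacts [sep_edgeA _, (sep_edgeA _).symm]

theorem sep_edgeB_iff {p a b : ℤ × ℤ} : Sep (edgeB p) a b ↔
    (a = p ∧ b = (p.1 + 1, p.2)) ∨ (b = p ∧ a = (p.1 + 1, p.2)) := by
  constructor
  · rintro (⟨h, -⟩ | ⟨h, -⟩ | ⟨h, rfl⟩ | ⟨h, rfl⟩)
    · exact absurd h.symm (edgeA_ne_edgeB _ _)
    · exact absurd h.symm (edgeA_ne_edgeB _ _)
    · obtain rfl := edgeB_injective h
      exact Or.inl ⟨rfl, rfl⟩
    · obtain rfl := edgeB_injective h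
      exact Or.inr ⟨rfl, rfl⟩
  · rintro (⟨rfl, rfl⟩ | ⟨rfl, rfl⟩)
    exacts [sep_edgeB _, (sep_edgeB _).symm]

theorem exists_sep (e : EL) : ∃ p q, Sep e p q := by
  obtain ⟨p, rfl | rfl⟩ := exists_edgeA_or_edgeB e
  exacts [⟨_, _, sep_edgeA p⟩, ⟨_, _, sep_edgeB p⟩]

theorem Sep.eq_or_eq {e : EL} {p q a b : ℤ × ℤ} (h : Sep e p q) (h' : Sep e a b) :
    (a = p ∧ b = q) ∨ (a = q ∧ b = p) := by
  obtain ⟨c, rfl | rfl⟩ := exists_edgeA_or_edgeB e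
  · rw [sep_edgeA_iff] at h h'
    grind
  · rw [sep_edgeB_iff] at h h'
    grind

theorem Sep.dualStep {ω : CL} {e : EL} {p q : ℤ × ℤ} (h : Sep e p q) (he : ω e = false) :
    DualStep ω Set.univ (faceV p) (faceV q) := by
  have hd : ∀ p, IsDualV (faceV p) := fun p => ⟨p.1, by simp only [faceV]; ring⟩
  have key : ∀ p q, (e = edgeA p ∧ q = (p.1, p.2 + 1)) ∨ (e = edgeB p ∧ q = (p.1 + 1, p.2)) →
      DualStep ω Set.univ (faceV p) (faceV q) := by
    rintro p q h
    refine ⟨hd p, hd q, ?_, ?_, ?_⟩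
    · rcases h with ⟨-, rfl⟩ | ⟨-, rfl⟩ <;> simp only [faceV] <;> ring
    · rcases h with ⟨-, rfl⟩ | ⟨-, rfl⟩ <;> simp only [faceV] <;> ring
    · have hc : crossSym (faceV p) (faceV q) = e.1 := by
        rcases h with ⟨rfl, rfl⟩ | ⟨rfl, rfl⟩
        · refine Sym2.eq_iff.2 (Or.inr ⟨?_, ?_⟩) <;>
            ext <;> simp only [faceV, cornerV] <;> ring
        · refine Sym2.eq_iff.2 (Or.inr ⟨?_, ?_⟩) <;>
            ext <;> simp only [faceV, cornerV] <;> ring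
      refine ⟨hc ▸ e.2, trivial, ?_⟩
      rw [← he]
      congr 1
      exact Subtype.ext hc
  rcases h with h | h | h | h
  exacts [key _ _ (Or.inl h), (key _ _ (Or.inl h)).symm, key _ _ (Or.inr h),
    (key _ _ (Or.inr h)).symm]

/-! ### The exploration of dual clusters from far away -/

/-- The faces outside of a box. -/
def farFaces (N : ℕ) : Set (ℤ × ℤ) := {p | (N : ℤ) < |p.1| ∨ (N : ℤ) < |p.2|}

/-- The faces joined to a far face by a dual-open path. -/
inductive OuterFace (N : ℕ) (ω : CL) : ℤ × ℤ → Prop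
  | far {p : ℤ × ℤ} (hp : p ∈ farFaces N) : OuterFace N ω p
  | step {p q : ℤ × ℤ} {e : EL} (hq : OuterFace N ω q) (hp : p ∉ farFaces N) (h : Sep e p q)
      (he : ω e = false) : OuterFace N ω p

/-- The component of the face of index `0` in the complement of the outer faces. -/
def innerFaces (N : ℕ) (ω : CL) : Set (ℤ × ℤ) :=
  {p | ¬ OuterFace N ω (0, 0) ∧
    Relation.ReflTransGen (fun p q => (∃ e, Sep e p q) ∧ ¬ OuterFace N ω q) (0, 0) p}

/-- The edges separating an inner face from a face which is not inner. -/
def IsInterface (N : ℕ) (ω : CL) (e : EL) : Prop :=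
  ∃ p q, Sep e p q ∧ p ∈ innerFaces N ω ∧ q ∉ innerFaces N ω

section

variable {N : ℕ} {ω ω' : CL}

theorem not_outerFace_of_mem {p : ℤ × ℤ} (h : p ∈ innerFaces N ω) : ¬ OuterFace N ω p := by
  obtain ⟨h0, h⟩ := h
  cases h with
  | refl => exact h0
  | tail _ h => exact h.2

theorem mem_innerFaces_of_sep {p q : ℤ × ℤ} {e : EL} (h : p ∈ innerFaces N ω) (hs : Sep e p q)
    (hq : ¬ OuterFace N ω q) : q ∈ innerFaces N ω :=
  ⟨h.1, h.2.tail ⟨⟨e, hs⟩, hq⟩⟩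

theorem IsInterface.eq_true {e : EL} (h : IsInterface N ω e) : ω e = true := by
  obtain ⟨p, q, hs, hp, hq⟩ := h
  have hp' := not_outerFace_of_mem hp
  by_contra he
  exact hp' (.step (by_contra fun h => hq (mem_innerFaces_of_sep hp hs h)) (fun h => hp' (.far h))
    hs (by simpa using he))

theorem Sep.isInterface_iff {e : EL} {p q : ℤ × ℤ} (h : Sep e p q) :
    IsInterface N ω e ↔ ¬ (p ∈ innerFaces N ω ↔ q ∈ innerFaces N ω) := by
  constructor
  · rintro ⟨a, b, hs, ha, hb⟩ hiff
    rcases h.eq_or_eq hs with ⟨rfl, rfl⟩ | ⟨rfl, rfl⟩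
    exacts [hb (hiff.1 ha), hb (hiff.2 ha)]
  · intro hiff
    by_cases hp : p ∈ innerFaces N ω
    · exact ⟨p, q, h, hp, fun hq => hiff ⟨fun _ => hq, fun _ => hp⟩⟩
    · exact ⟨q, p, h.symm, by tauto, hp⟩

theorem far_notMem_innerFaces {p : ℤ × ℤ} (h : p ∈ farFaces N) : p ∉ innerFaces N ω :=
  fun hp => not_outerFace_of_mem hp (.far h)

theorem connectedIn_interface {e e' : EL} {u u' : V} (he : IsInterface N ω e) (hu : Inc AdjL u e)
    (he' : IsInterface N ω e') (hu' : Inc AdjL u' e') :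
    ConnectedIn AdjL ω {e | IsInterface N ω e} u u' := by
  classical
  set F1 : EL → Prop := fun e => IsInterface N ω e ∧
    ∃ v, Inc AdjL v e ∧ ConnectedIn AdjL ω {e | IsInterface N ω e} u v with hF1
  have hall : ∀ e, F1 e → ∀ v, Inc AdjL v e →
      ConnectedIn AdjL ω {e | IsInterface N ω e} u v := by
    rintro e ⟨he, w, hw, hc⟩ v hv
    exact hc.trans (.step he he.eq_true hw hv)
  set χ : EL → ZMod 2 := fun e => if F1 e then 1 else 0 with hχ
  have far0 : ∀ {e p q}, Sep e p q → p ∈ farFaces N → q ∈ farFaces N → χ e = 0 := by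
    intro e p q hs hp hq
    refine if_neg fun h => hs.isInterface_iff.1 h.1 ?_
    simp [far_notMem_innerFaces hp, far_notMem_innerFaces hq]
  have hv : ∀ i j, χ (edgeA (i, j)) + χ (edgeA (i + 1, j)) + χ (edgeB (i, j)) +
      χ (edgeB (i, j + 1)) = 0 := by
    intro i j
    have i1 : Inc AdjL (cornerV (i, j)) (edgeA (i, j)) := inc_edgeA.2 (Or.inl rfl)
    have i2 : Inc AdjL (cornerV (i, j)) (edgeA (i + 1, j)) := inc_edgeA.2 (Or.inr (by simp))
    have i3 : Inc AdjL (cornerV (i, j)) (edgeB (i, j)) := inc_edgeB.2 (Or.inl rfl)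
    have i4 : Inc AdjL (cornerV (i, j)) (edgeB (i, j + 1)) := inc_edgeB.2 (Or.inr (by simp))
    by_cases hc : ConnectedIn AdjL ω {e | IsInterface N ω e} u (cornerV (i, j))
    · have key : ∀ e, Inc AdjL (cornerV (i, j)) e → (F1 e ↔ IsInterface N ω e) :=
        fun e hi => ⟨fun h => h.1, fun h => ⟨h, _, hi, hc⟩⟩
      simp only [hχ, key _ i1, key _ i2, key _ i3, key _ i4, (sep_edgeA _).isInterface_iff,
        (sep_edgeB _).isInterface_iff]
      by_cases h1 : (i, j) ∈ innerFaces N ω <;> by_cases h2 : (i, j + 1) ∈ innerFaces N ω <;>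
        by_cases h3 : (i + 1, j) ∈ innerFaces N ω <;>
        by_cases h4 : (i + 1, j + 1) ∈ innerFaces N ω <;> simp [h1, h2, h3, h4] <;> decide
    · have key : ∀ e, Inc AdjL (cornerV (i, j)) e → χ e = 0 :=
        fun e hi => if_neg fun h => hc (hall e h _ hi)
      simp [key _ i1, key _ i2, key _ i3, key _ i4]
  obtain ⟨f, fA, fB, f0⟩ := exists_potential (A := fun i j => χ (edgeA (i, j)))
    (B := fun i j => χ (edgeB (i, j))) (J := N + 1) (by positivity) hv
    (fun i j h => far0 (sep_edgeA _) (by simp only [farFaces, Set.mem_ofPred_eq]; omega)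
      (by simp only [farFaces, Set.mem_ofPred_eq]; omega))
    (fun i j h => far0 (sep_edgeB _) (by simp only [farFaces, Set.mem_ofPred_eq]; omega)
      (by simp only [farFaces, Set.mem_ofPred_eq]; omega))
  have fs : ∀ {e p q}, Sep e p q → f p.1 p.2 = χ e + f q.1 q.2 := by
    have two : ∀ a : ZMod 2, a + a = 0 := by decide
    rintro e p q (⟨rfl, rfl⟩ | ⟨rfl, rfl⟩ | ⟨rfl, rfl⟩ | ⟨rfl, rfl⟩)
    · exact fA _ _
    · rw [fA q.1 q.2, ← add_assoc, two, zero_add]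
    · exact fB _ _
    · rw [fB q.1 q.2, ← add_assoc, two, zero_add]
  have fT : ∀ p, OuterFace N ω p → f p.1 p.2 = 0 := by
    intro p hp
    induction hp with
    | far hp =>
      simp only [farFaces, Set.mem_ofPred_eq] at hp
      exact f0 _ _ (by omega)
    | step hq hp hs he ih =>
      rw [fs hs, ih, add_zero]
      refine if_neg fun h => ?_
      rw [h.1.eq_true] at he
      cases he
  have fQ : ∀ p ∈ innerFaces N ω, f p.1 p.2 = f 0 0 := by
    rintro p ⟨h0, h⟩
    induction h with
    | refl => rfl
    | @tail a b hab hstep ih =>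
      obtain ⟨⟨e, hs⟩, hb⟩ := hstep
      rw [← ih, fs hs.symm]
      have : χ e = 0 := if_neg fun h => hs.isInterface_iff.1 h.1
        ⟨fun _ => ⟨h0, hab.tail ⟨⟨e, hs⟩, hb⟩⟩, fun _ => ⟨h0, hab⟩⟩
      rw [this, zero_add]
  have hout : ∀ {e p q}, Sep e p q → p ∈ innerFaces N ω → q ∉ innerFaces N ω →
      χ e = f 0 0 := by
    intro e p q hs hp hq
    have := fs hs
    rw [fQ p hp, fT q (by_contra fun h => hq (mem_innerFaces_of_sep hp hs h)), add_zero] at this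
    exact this.symm
  have hf0 : f 0 0 = 1 := by
    obtain ⟨p, q, hs, hp, hq⟩ := id he
    rw [← hout hs hp hq]
    exact if_pos ⟨he, u, hu, .refl⟩
  have hF : F1 e' := by
    obtain ⟨p, q, hs, hp, hq⟩ := id he'
    have := hout hs hp hq
    rw [hf0] at this
    by_contra h
    rw [hχ] at this
    simp [h] at this
  exact hall e' hF u' hu'

theorem outerFace_congr (h : ∀ e p q, Sep e p q → p ∉ farFaces N → OuterFace N ω q → ω e = ω' e) :
    OuterFace N ω' = OuterFace N ω := by
  ext p
  constructor
  · intro hp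
    induction hp with
    | far hp => exact .far hp
    | step hq hp hs he ih => exact .step ih hp hs ((h _ _ _ hs hp ih).trans he)
  · intro hp
    induction hp with
    | far hp => exact .far hp
    | step hq hp hs he ih => exact .step ih hp hs ((h _ _ _ hs hp hq).symm.trans he)

theorem finite_compl_farFaces (N : ℕ) : (farFaces N)ᶜ.Finite := by
  refine ((Finset.Icc (-N : ℤ) N) ×ˢ (Finset.Icc (-N : ℤ) N)).finite_toSet.subset fun p hp => ?_
  simp only [farFaces, Set.mem_compl_iff, Set.mem_ofPred_eq, not_or, not_lt, abs_le] at hp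
  simp only [Finset.coe_product, Set.mem_prod, Finset.coe_Icc, Set.mem_Icc]
  exact hp

theorem finite_nearEdges (N : ℕ) : {e : EL | ∃ p q, Sep e p q ∧ p ∉ farFaces N}.Finite := by
  have hf := finite_compl_farFaces N
  refine (((hf.image edgeA).union (hf.image fun p => edgeA (p.1, p.2 - 1))).union
    ((hf.image edgeB).union (hf.image fun p => edgeB (p.1 - 1, p.2)))).subset ?_
  rintro e ⟨p, q, ⟨rfl, rfl⟩ | ⟨rfl, rfl⟩ | ⟨rfl, rfl⟩ | ⟨rfl, rfl⟩, hp⟩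
  · exact Or.inl (Or.inl ⟨p, hp, rfl⟩)
  · exact Or.inl (Or.inr ⟨_, hp, by simp⟩)
  · exact Or.inr (Or.inl ⟨p, hp, rfl⟩)
  · exact Or.inr (Or.inr ⟨_, hp, by simp⟩)

/-- The edges having a face which is not far. -/
def nearEdges (N : ℕ) : Finset EL := (finite_nearEdges N).toFinset

theorem mem_nearEdges {e : EL} : e ∈ nearEdges N ↔ ∃ p q, Sep e p q ∧ p ∉ farFaces N := by
  simp [nearEdges]

open Classical in
/-- The edges separating two inner faces. -/
def wiredDomain (N : ℕ) (ω : CL) : Finset EL :=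
  (nearEdges N).filter fun e => ∀ p q, Sep e p q → p ∈ innerFaces N ω ∧ q ∈ innerFaces N ω

theorem mem_wiredDomain {e : EL} : e ∈ wiredDomain N ω ↔
    ∀ p q, Sep e p q → p ∈ innerFaces N ω ∧ q ∈ innerFaces N ω := by
  simp only [wiredDomain, Finset.mem_filter, mem_nearEdges, and_iff_right_iff_imp]
  intro h
  obtain ⟨p, q, hs⟩ := exists_sep e
  exact ⟨p, q, hs, fun hp => far_notMem_innerFaces hp (h p q hs).1⟩

theorem Sep.mem_wiredDomain {e : EL} {p q : ℤ × ℤ} (h : Sep e p q) : e ∈ wiredDomain N ω ↔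
    p ∈ innerFaces N ω ∧ q ∈ innerFaces N ω := by
  rw [FK.mem_wiredDomain]
  refine ⟨fun h' => h' p q h, fun h' a b hs => ?_⟩
  rcases h.eq_or_eq hs with ⟨rfl, rfl⟩ | ⟨rfl, rfl⟩
  exacts [h', h'.symm]

theorem wiredDomain_congr (h : OuterFace N ω' = OuterFace N ω) :
    wiredDomain N ω' = wiredDomain N ω := by
  unfold wiredDomain innerFaces
  rw [h]

theorem isExplored_wiredDomain (N : ℕ) : IsExplored (nearEdges N) (wiredDomain N) where
  subset ω e he := by
    obtain ⟨p, q, hs⟩ := exists_sep e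
    exact mem_nearEdges.2 ⟨p, q, hs, fun hp => far_notMem_innerFaces hp (hs.mem_wiredDomain.1 he).1⟩
  local' ω ω' h := wiredDomain_congr <| outerFace_congr fun e p q hs hp _ =>
    h e (mem_nearEdges.2 ⟨p, q, hs, hp⟩)
  congr ω ω' h := wiredDomain_congr <| outerFace_congr fun e p q hs _ hq =>
    h e fun he => not_outerFace_of_mem (hs.mem_wiredDomain.1 he).2 hq

theorem exists_interface_of_mem_bdry {u : V} (hu : u ∈ bdry AdjL 4 (wiredDomain N ω)) :
    ∃ e, IsInterface N ω e ∧ Inc AdjL u e := by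
  obtain ⟨⟨e, he, hi⟩, e', hi', he'⟩ := mem_bdry_iff.1 hu
  obtain ⟨⟨i, j⟩, rfl⟩ := exists_cornerV hi.even
  by_contra! hno
  have i1 : Inc AdjL (cornerV (i, j)) (edgeA (i, j)) := inc_edgeA.2 (Or.inl rfl)
  have i2 : Inc AdjL (cornerV (i, j)) (edgeA (i + 1, j)) := inc_edgeA.2 (Or.inr (by simp))
  have i3 : Inc AdjL (cornerV (i, j)) (edgeB (i, j)) := inc_edgeB.2 (Or.inl rfl)
  have i4 : Inc AdjL (cornerV (i, j)) (edgeB (i, j + 1)) := inc_edgeB.2 (Or.inr (by simp))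
  have h1 := mt (sep_edgeA _).isInterface_iff.2 fun h => hno _ h i1
  have h2 := mt (sep_edgeA _).isInterface_iff.2 fun h => hno _ h i2
  have h3 := mt (sep_edgeB _).isInterface_iff.2 fun h => hno _ h i3
  simp only [not_not] at h1 h2 h3
  have key : ∀ e, Inc AdjL (cornerV (i, j)) e →
      (e ∈ wiredDomain N ω ↔ (i, j) ∈ innerFaces N ω) := by
    intro e hi
    obtain ⟨p, rfl | rfl⟩ := exists_edgeA_or_edgeB e
    · rw [inc_edgeA] at hi
      rw [(sep_edgeA p).mem_wiredDomain]
      rcases hi with rfl | hi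
      · tauto
      · have : p = (i + 1, j) := by
          simp only [Prod.ext_iff] at hi ⊢
          omega
        subst this
        tauto
    · rw [inc_edgeB] at hi
      rw [(sep_edgeB p).mem_wiredDomain]
      rcases hi with rfl | hi
      · tauto
      · have : p = (i, j + 1) := by
          simp only [Prod.ext_iff] at hi ⊢
          omega
        subst this
        tauto
  exact he' ((key e' hi').2 ((key e hi).1 he))

theorem inducedBC_wiredDomain (N : ℕ) (ω : CL) :
    inducedBC AdjL 4 (wiredDomain N ω) ω = ⊤ := by
  refine Setoid.ext fun u v => ?_
  rw [inducedBC_r]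
  refine ⟨fun _ => trivial, fun _ => Or.inl ?_⟩
  obtain ⟨e, he, hu⟩ := exists_interface_of_mem_bdry u.2
  obtain ⟨e', he', hv⟩ := exists_interface_of_mem_bdry v.2
  refine (connectedIn_interface he hu he' hv).mono ?_
  rintro e ⟨p, q, hs, hp, hq⟩ h
  exact hq (hs.mem_wiredDomain.1 h).2

end

theorem OuterFace.anti {N N' : ℕ} (h : N ≤ N') {ω : CL} {p : ℤ × ℤ} (hp : OuterFace N' ω p) :
    OuterFace N ω p := by
  induction hp with
  | far hp =>
    refine .far ?_
    simp only [farFaces, Set.mem_ofPred_eq] at hp ⊢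
    omega
  | @step p q e hq hp hs he ih =>
    by_cases hp' : p ∈ farFaces N
    exacts [.far hp', .step ih hp' hs he]

theorem OuterFace.exists_dualConnectedIn {N : ℕ} {ω : CL} {p : ℤ × ℤ} (hp : OuterFace N ω p) :
    ∃ o ∈ farFaces N, DualConnectedIn ω Set.univ (faceV p) (faceV o) := by
  induction hp with
  | far hp => exact ⟨_, hp, .refl⟩
  | step hq hp hs he ih =>
    obtain ⟨o, ho, hc⟩ := ih
    exact ⟨o, ho, .head (hs.dualStep he) hc⟩

theorem mem_innerFaces_of_box {N m : ℕ} {ω : CL}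
    (h : ∀ p : ℤ × ℤ, |p.1| ≤ m → |p.2| ≤ m → ¬ OuterFace N ω p) {p : ℤ × ℤ}
    (h1 : |p.1| ≤ m) (h2 : |p.2| ≤ m) : p ∈ innerFaces N ω := by
  have h' : ∀ i j : ℤ, i.natAbs ≤ m → j.natAbs ≤ m → ¬ OuterFace N ω (i, j) := fun i j hi hj =>
    h (i, j) (by simp only [Int.abs_eq_natAbs]; omega) (by simp only [Int.abs_eq_natAbs]; omega)
  have hx : ∀ n : ℕ, ∀ i : ℤ, i.natAbs = n → n ≤ m → (i, 0) ∈ innerFaces N ω := by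
    intro n
    induction n with
    | zero =>
      intro i hi _
      obtain rfl : i = 0 := by omega
      exact ⟨h' _ _ (by simp) (by simp), .refl⟩
    | succ n ih =>
      intro i hi hn
      have ho : ¬ OuterFace N ω (i, 0) := h' _ _ (by omega) (by simp)
      rcases lt_or_ge i 0 with h0 | h0
      · exact mem_innerFaces_of_sep (ih (i + 1) (by omega) (by omega)) (sep_edgeB (i, 0)).symm ho
      · exact mem_innerFaces_of_sep (e := edgeB (i - 1, 0)) (ih (i - 1) (by omega) (by omega))
          (by simpa using sep_edgeB (i - 1, 0)) ho
  have hy : ∀ n : ℕ, ∀ i j : ℤ, i.natAbs ≤ m → j.natAbs = n → n ≤ m →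
      (i, j) ∈ innerFaces N ω := by
    intro n
    induction n with
    | zero =>
      intro i j hi hj _
      obtain rfl : j = 0 := by omega
      exact hx _ i rfl hi
    | succ n ih =>
      intro i j hi hj hn
      have ho : ¬ OuterFace N ω (i, j) := h' _ _ hi (by omega)
      rcases lt_or_ge j 0 with h0 | h0
      · exact mem_innerFaces_of_sep (ih i (j + 1) hi (by omega) (by omega))
          (sep_edgeA (i, j)).symm ho
      · exact mem_innerFaces_of_sep (e := edgeA (i, j - 1))
          (ih i (j - 1) hi (by omega) (by omega)) (by simpa using sep_edgeA (i, j - 1)) ho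
  simp only [Int.abs_eq_natAbs] at h1 h2
  exact hy _ p.1 p.2 (by omega) rfl (by omega)

theorem ae_not_dualInfCluster_faceV {p q : ℝ} (hp0 : 0 < p) (hp1 : p < 1) (hq : 1 ≤ q)
    {φ : Measure CL} (hφ : IsGibbs AdjL 4 p q φ)
    (hno : ∀ᵐ ω ∂φ, ¬ DualInfCluster ω Set.univ (1, 0)) (a : ℤ × ℤ) :
    ∀ᵐ ω ∂φ, ¬ DualInfCluster ω Set.univ (faceV a) := by
  set P : ℤ × ℤ → Prop := fun a => ∀ᵐ ω ∂φ, ¬ DualInfCluster ω Set.univ (faceV a)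
  have hs : ∀ {e a b}, Sep e a b → P a → P b := fun hs h =>
    ae_not_dualInfCluster_of_dualStep hp0 hp1 hq hφ h (hs.dualStep rfl)
  have h0 : P (0, 0) := hno
  have hx : ∀ i : ℤ, P (i, 0) := by
    intro i
    induction i using Int.induction_on with
    | zero => exact h0
    | succ i ih => exact hs (sep_edgeB (i, 0)) ih
    | pred i ih =>
      exact hs (e := edgeB (-i - 1, 0)) (by simpa using (sep_edgeB (-i - 1, 0)).symm) ih
  have hy : ∀ i j : ℤ, P (i, j) := by
    intro i j
    induction j using Int.induction_on with
    | zero => exact hx i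
    | succ j ih => exact hs (sep_edgeA (i, j)) ih
    | pred j ih =>
      exact hs (e := edgeA (i, -j - 1)) (by simpa using (sep_edgeA (i, -j - 1)).symm) ih
  exact hy a.1 a.2

theorem eq_of_isWiredLimit {p q : ℝ} (hp0 : 0 < p) (hp1 : p < 1) (hq : 1 ≤ q)
    {φ : Measure CL} (hφ : IsGibbs AdjL 4 p q φ)
    (hno : ∀ᵐ ω ∂φ, ¬ DualInfCluster ω Set.univ (1, 0))
    {φ1 : Measure CL} (h : IsWiredLimit AdjL 4 p q φ1) : φ = φ1 := by
  have := hφ.1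
  have := h.1
  refine eq_of_measureReal_opn_eq fun F => le_antisymm (h.measureReal_opn_le hp0 hp1 hq hφ F) ?_
  rcases F.eq_empty_or_nonempty with rfl | hFne
  · simp [opn]
  refine le_of_forall_pos_le_add fun ε hε => ?_
  obtain ⟨m, hm⟩ : ∃ m : ℕ, ∀ e ∈ F, ∀ a b, Sep e a b → |a.1| ≤ m ∧ |a.2| ≤ m := by
    induction F using Finset.induction_on with
    | empty => exact ⟨0, by simp⟩
    | insert e F _ ih =>
      have : ∃ m : ℕ, ∀ e ∈ F, ∀ a b, Sep e a b → |a.1| ≤ m ∧ |a.2| ≤ m := by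
        rcases F.eq_empty_or_nonempty with rfl | hF
        exacts [⟨0, by simp⟩, ih hF]
      obtain ⟨m, hm⟩ := this
      obtain ⟨a, b, hs⟩ := exists_sep e
      refine ⟨m + a.1.natAbs + a.2.natAbs + b.1.natAbs + b.2.natAbs, fun e' he' c d hs' => ?_⟩
      rcases Finset.mem_insert.1 he' with rfl | he'
      · rcases hs.eq_or_eq hs' with ⟨rfl, rfl⟩ | ⟨rfl, rfl⟩ <;> push_cast <;>
          simp only [Int.abs_eq_natAbs] <;> omega
      · have := hm e' he' c d hs'
        push_cast
        simp only [Int.abs_eq_natAbs] at *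
        omega
  have hall : ∀ᵐ ω ∂φ, ∀ a, ¬ DualInfCluster ω Set.univ (faceV a) :=
    ae_all_iff.2 (ae_not_dualInfCluster_faceV hp0 hp1 hq hφ hno)
  obtain ⟨N, hN⟩ := exists_sub_le_measureReal (φ := φ) (A := fun N : ℕ => {ω |
      ∀ a : ℤ × ℤ, |a.1| ≤ m → |a.2| ≤ m → ¬ OuterFace N ω a})
    (fun N N' hN ω hω a h1 h2 ho => hω a h1 h2 (ho.anti hN))
    (S := Set.univ) (by
      filter_upwards [hall] with ω hω _
      have hfin : (⋃ a ∈ (farFaces m)ᶜ,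
          {o | DualConnectedIn ω Set.univ (faceV a) (faceV o)}).Finite :=
        (finite_compl_farFaces m).biUnion fun a _ =>
          (Set.not_infinite.1 (hω a)).preimage faceV_injective.injOn
      obtain ⟨M, hM⟩ := (hfin.image fun o => max |o.1| |o.2|).bddAbove
      refine ⟨M.toNat, fun a h1 h2 ho => ?_⟩
      obtain ⟨o, ho, hc⟩ := ho.exists_dualConnectedIn
      have h3 := hM ⟨o, Set.mem_biUnion (by
        simp only [farFaces, Set.mem_compl_iff, Set.mem_ofPred_eq]
        omega) hc, rfl⟩
      simp only [farFaces, Set.mem_ofPred_eq] at ho h3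
      omega) hε
  set G : Set CL := {ω | F ⊆ wiredDomain N ω} with hG
  have hsub : {ω | ∀ a : ℤ × ℤ, |a.1| ≤ m → |a.2| ≤ m → ¬ OuterFace N ω a} ⊆ G := by
    intro ω hω e he
    refine mem_wiredDomain.2 fun a b hs => ⟨?_, ?_⟩
    · exact mem_innerFaces_of_box hω (hm e he a b hs).1 (hm e he a b hs).2
    · exact mem_innerFaces_of_box hω (hm e he b a hs.symm).1 (hm e he b a hs.symm).2
  have h1 : 1 - ε ≤ φ.real G := by
    have := measureReal_mono (μ := φ) hsub
    rw [probReal_univ] at hN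
    linarith
  have h2 := (isExplored_wiredDomain N).le_measureReal_opn_inter hp0 hp1 hq hφ (F := F)
    (c := φ1.real (opn F)) fun ω hω => by
      unfold condP
      rw [inducedBC_wiredDomain]
      exact h.le_wProb hp0 hp1 hq (hFne.mono hω) hω
  have h3 : φ.real (opn F ∩ G) ≤ φ.real (opn F) := measureReal_mono Set.inter_subset_left
  have h4 : φ1.real (opn F) ≤ 1 := measureReal_le_one
  have h5 : 0 ≤ φ1.real (opn F) := measureReal_nonneg
  nlinarith

/-! ### Conclusion -/

theorem measurableSet_exists_infCluster :
    MeasurableSet {ω : CL | ∃ u, InfCluster AdjL ω Set.univ u} := by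
  rw [Set.ofPred_exists]
  exact .iUnion fun u => measurableSet_infCluster _ u

theorem preimage_exists_infCluster (t : V) (ht : IsLatticeVec t) :
    Shift t ht ⁻¹' {ω : CL | ∃ u, InfCluster AdjL ω Set.univ u} =
      {ω : CL | ∃ u, InfCluster AdjL ω Set.univ u} := by
  have key : ∀ (ω : CL) u, InfCluster AdjL (Shift t ht ω) Set.univ u ↔
      InfCluster AdjL ω Set.univ (shiftV t u) :=
    fun ω u => infCluster_shift ht fun _ => by simp
  ext ω
  simp only [Set.mem_preimage, Set.mem_ofPred_eq, key]
  refine ⟨fun ⟨u, hu⟩ => ⟨_, hu⟩, fun ⟨u, hu⟩ => ⟨(u.1 - t.1, u.2 - t.2), ?_⟩⟩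
  simpa [shiftV] using hu

end FK

open FK in
/-- **Theorem.** A translation invariant, tail-trivial Gibbs measure for FK-percolation on
the square lattice has no infinite primal cluster or no infinite dual cluster, and is equal
to the free or to the wired infinite-volume measure. -/
theorem fk_translation_invariant_gibbs (p q : ℝ) (hp0 : 0 < p) (hp1 : p < 1) (hq : 1 ≤ q)
    (φ : Measure (Config AdjL)) (hφ : IsGibbs AdjL 4 p q φ)
    (hinv : ∃ (t₁ t₂ : V) (ht₁ : IsLatticeVec t₁) (ht₂ : IsLatticeVec t₂),
      t₁.1 * t₂.2 - t₁.2 * t₂.1 ≠ 0 ∧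
        φ.map (Shift t₁ ht₁) = φ ∧ φ.map (Shift t₂ ht₂) = φ)
    (htail : TailTrivial AdjL φ) :
    (φ {ω | InfCluster AdjL ω Set.univ ((0, 0) : V)} = 0 ∨
      φ {ω | DualInfCluster ω Set.univ ((1, 0) : V)} = 0) ∧
    ∀ φ0 φ1 : Measure (Config AdjL),
      IsFreeLimit AdjL 4 p q φ0 → IsWiredLimit AdjL 4 p q φ1 → (φ = φ0 ∨ φ = φ1) := by
  have := hφ.1
  obtain ⟨K, hK⟩ := exists_isPer hinv
  rcases hK.zero_or_one hp0 hp1 hq hφ htail measurableSet_exists_infCluster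
    preimage_exists_infCluster with h | h
  · have h0 : ∀ᵐ ω ∂φ, ∀ u, ¬ InfCluster AdjL ω Set.univ u := by
      rw [measureReal_eq_zero_iff] at h
      filter_upwards [measure_eq_zero_iff_ae_notMem.1 h] with ω hω u hu
      exact hω ⟨u, hu⟩
    refine ⟨Or.inl (measure_eq_zero_iff_ae_notMem.2 ?_), fun φ0 φ1 hφ0 _ =>
      Or.inl (eq_of_isFreeLimit hp0 hp1 hq hφ h0 hφ0)⟩
    filter_upwards [h0] with ω hω
    exact hω (0, 0)
  · have h1 : ∀ᵐ ω ∂φ, ∃ u, InfCluster AdjL ω Set.univ u := by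
      rw [measureReal_def, ENNReal.toReal_eq_one_iff] at h
      exact (prob_compl_eq_zero_iff measurableSet_exists_infCluster).2 h
    have hd := measure_dualInfCluster_eq_zero hp0 hp1 hq hφ htail hK h1
    exact ⟨Or.inr hd, fun φ0 φ1 _ hφ1 => Or.inr (eq_of_isWiredLimit hp0 hp1 hq hφ
      (measure_eq_zero_iff_ae_notMem.1 hd) hφ1)⟩
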